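/- arXiv:1510.02570 — 4 statements merged into one kernel-verified Lean document; each statement's English description precedes it below -/
import Mathlib

section
/- Let ν be a finite real signed Borel measure on ℝ for which every polynomial is integrable, let λ ≠ μ be real numbers, let m1, m2 ≥ 0 be integers with m = m1+m2 ≥ 1, and let M = (M_{i,j})_{i,j=0}^{m1−1} and N = (N_{i,j})_{i,j=0}^{m2−1} be real m1×m1 and m2×m2 matrices (taken to be 0 if m1 = 0, resp. m2 = 0). Assume the signed measure ν′ = (x−λ)^{m1}(μ−x)^{m2} dν has a sequence (p_n)_{n≥0} of orthogonal polynomials, i.e. deg p_n = n, ∫ p_n r dν′ = 0 for every polynomial r with deg r < n, and ∫ p_n² dν′ ≠ 0. Define the bilinear form ⟨p,q⟩ = ∫ p q dν + T^{m1}_{λ}(p)·M·T^{m1}_{λ}(q)^T + T^{m2}_{μ}(p)·N·T^{m2}_{μ}(q)^T, the numbers w^1_{n,i} = ∫ (x−λ)^i (μ−x)^{m2} p_n(x) dν and w^2_{n,j} = ∫ (x−λ)^{m1} (μ−x)^j p_n(x) dν, and R_l(n) = w^1_{n,l−1} + Σ_{i=0}^{m1−1} ( Σ_{j=l}^{min(l+m2,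 m1)} (j−1)! C(m2, j−l) M_{i,j−1} / ((−1)^{m2} (λ−μ)^{j−l−m2}) ) p_n^{(i)}(λ) for l = 1,…,m1, and R_l(n) = w^2_{n,l−m1−1} + Σ_{i=0}^{m2−1} ( Σ_{j=l−m1}^{min(l, m2)} (j−1)! C(m1, l−j) N_{i,j−1} / ((−1)^{l−m1−1} (μ−λ)^{j−l}) ) p_n^{(i)}(μ) for l = m1+1,…,m. Then the following are equivalent: (1) for every n ≥ m there exists a polynomial q_n of degree n with ⟨q_n, r⟩ = 0 for every polynomial r with deg r < n and ⟨q_n, q_n⟩ ≠ 0; (2) det( R_i(n−j) )_{i,j=1}^{m} ≠ 0 for every n ≥ m. Moreover, if these hold, then for each n ≥ m the polynomial q_n(x) given by the (m+1)×(m+1) determinant whose first row is (p_n(x), p_{n−1}(x), …, p_{n−m}(x)) and whose (l+1)-th row, l = 1,…,m, is (R_l(n), R_l(n−1), …, R_l(n−m)), has degree n and satisfies ⟨q_n, r⟩ = 0 for all deg r < n with ⟨q_n, q_n⟩ ≠ 0. -/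
open Polynomial MeasureTheory

/-- Integral of a function against a signed measure, via its Jordan decomposition. -/
noncomputable def signedIntegral (ν : MeasureTheory.SignedMeasure ℝ) (f : ℝ → ℝ) : ℝ :=
  (∫ x, f x ∂ν.toJordanDecomposition.posPart) - (∫ x, f x ∂ν.toJordanDecomposition.negPart)

/-- `T^k_λ(p) · A · T^k_λ(q)^T` where `T^k_λ(p) = (p(λ), p'(λ), …, p^{(k-1)}(λ))`. -/
noncomputable def Tform (k : ℕ) (lam : ℝ) (A : ℕ → ℕ → ℝ) (p q : Polynomial ℝ) : ℝ :=
  ∑ i ∈ Finset.range k, ∑ j ∈ Finset.range k,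
    ((⇑Polynomial.derivative)^[i] p).eval lam * A i j * ((⇑Polynomial.derivative)^[j] q).eval lam

section AbstractPart

lemma dso_sub_lt (p : ℕ → ℝ[X]) (hp : ∀ n : ℕ, (p n).degree = (n : ℕ)) (k : ℕ) (q : ℝ[X])
    (hq : q.degree < ((k + 1 : ℕ) : WithBot ℕ)) :
    ∃ c : ℝ, (q - c • p k).degree < (k : ℕ) ∧ (q.degree = (k : ℕ) → c ≠ 0) := by
  have hk : (p k).coeff k ≠ 0 := by
    have := Polynomial.coeff_ne_zero_of_eq_degree (hp k)
    exact this
  refine ⟨q.coeff k / (p k).coeff k, ?_, ?_⟩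
  · rw [Polynomial.degree_lt_iff_coeff_zero]
    intro i hi
    rcases Nat.eq_or_lt_of_le hi with h | h
    · subst h
      simp [hk]
    · rw [Polynomial.degree_lt_iff_coeff_zero] at hq
      have h1 : (p k).coeff i = 0 := by
        apply Polynomial.coeff_eq_zero_of_degree_lt
        rw [hp]; exact_mod_cast h
      simp [hq i h, h1]
  · intro h
    exact div_ne_zero (Polynomial.coeff_ne_zero_of_eq_degree h) hk

lemma dso_pair_ne (p : ℕ → ℝ[X]) (hp : ∀ n : ℕ, (p n).degree = (n : ℕ)) (J : ℝ[X] →ₗ[ℝ] ℝ)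
    (ho : ∀ n : ℕ, ∀ r : ℝ[X], r.degree < (n : ℕ) → J (p n * r) = 0)
    (hn : ∀ n, J (p n * p n) ≠ 0) (k : ℕ) (q : ℝ[X]) (hq : q.degree = (k : ℕ)) :
    J (p k * q) ≠ 0 := by
  obtain ⟨c, h1, h2⟩ := dso_sub_lt p hp k q (by rw [hq]; exact_mod_cast Nat.lt_succ_self k)
  have h3 := ho k _ h1
  have h4 : p k * (q - c • p k) = p k * q - c • (p k * p k) := by
    rw [mul_sub, mul_smul_comm]
  rw [h4, map_sub, map_smul, sub_eq_zero] at h3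
  rw [h3]
  exact mul_ne_zero (h2 hq) (hn k)

/-- expansion of polynomials orthogonal to low degree polynomials -/
lemma dso_expand (p : ℕ → ℝ[X]) (hp : ∀ n : ℕ, (p n).degree = (n : ℕ)) (J : ℝ[X] →ₗ[ℝ] ℝ)
    (ho : ∀ n : ℕ, ∀ r : ℝ[X], r.degree < (n : ℕ) → J (p n * r) = 0)
    (hn : ∀ n, J (p n * p n) ≠ 0) (k : ℕ) (t : ℕ) : ∀ (q : ℝ[X]),
    q.degree < ((k + t : ℕ) : WithBot ℕ) →
    (∀ s : ℝ[X], s.degree < (k : ℕ) → J (q * s) = 0) →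
    ∃ a : ℕ → ℝ, q = ∑ j ∈ Finset.range t, a j • p (k + j) := by
  induction t with
  | zero =>
    intro q hq hs
    refine ⟨0, ?_⟩
    simp only [Finset.range_zero, Finset.sum_empty]
    by_contra h0
    have hd : q.degree = (q.natDegree : ℕ) := Polynomial.degree_eq_natDegree h0
    have := dso_pair_ne p hp J ho hn q.natDegree q hd
    apply this
    rw [mul_comm]
    apply hs
    rw [hp, ← hd]
    simpa using hq
  | succ t ih =>
    intro q hq hs
    obtain ⟨c, h1, -⟩ := dso_sub_lt p hp (k + t) q hq
    obtain ⟨a, ha⟩ := ih (q - c • p (k + t)) h1 (by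
      intro s hsd
      rw [sub_mul, map_sub, hs s hsd, smul_mul_assoc, map_smul, ho _ s, smul_zero, sub_zero]
      refine hsd.trans_le ?_
      exact_mod_cast Nat.le_add_right k t)
    refine ⟨Function.update a t c, ?_⟩
    rw [Finset.sum_range_succ, Function.update_self]
    have : ∑ j ∈ Finset.range t, Function.update a t c j • p (k + j)
        = ∑ j ∈ Finset.range t, a j • p (k + j) := by
      apply Finset.sum_congr rfl
      intro j hj
      rw [Function.update_of_ne (Finset.mem_range.1 hj).ne]
    rw [this, ← ha, sub_add_cancel]

variable {m : ℕ}

lemma dso_decomp (F : ℝ[X]) (hF : F.degree = (m : ℕ)) (f : Fin m → ℝ[X])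
    (hf : LinearIndependent ℝ f) (hfd : ∀ i, (f i).degree < (m : ℕ)) (r : ℝ[X]) :
    ∃ c : Fin m → ℝ, r = F * (r / F) + ∑ i, c i • f i := by
  have hF0 : F ≠ 0 := by rintro rfl; simp at hF
  have hlt : r % F ∈ Polynomial.degreeLT ℝ m := by
    rw [Polynomial.mem_degreeLT, ← hF]
    exact Polynomial.degree_mod_lt r hF0
  let g : Fin m → Polynomial.degreeLT ℝ m := fun i => ⟨f i, Polynomial.mem_degreeLT.2 (hfd i)⟩
  have hg : LinearIndependent ℝ g := by
    apply LinearIndependent.of_comp (Polynomial.degreeLT ℝ m).subtype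
    exact hf
  have : FiniteDimensional ℝ (Polynomial.degreeLT ℝ m) :=
    LinearEquiv.finiteDimensional (Polynomial.degreeLTEquiv ℝ m).symm
  have hspan := hg.span_eq_top_of_card_eq_finrank' (by
    rw [(Polynomial.degreeLTEquiv ℝ m).finrank_eq]; simp)
  have hmem : (⟨r % F, hlt⟩ : Polynomial.degreeLT ℝ m) ∈ Submodule.span ℝ (Set.range g) := by
    rw [hspan]; trivial
  rw [Submodule.mem_span_range_iff_exists_fun] at hmem
  obtain ⟨c, hc⟩ := hmem
  refine ⟨c, ?_⟩
  have h2 := congrArg (Polynomial.degreeLT ℝ m).subtype hc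
  simp only [map_sum, map_smul, Submodule.subtype_apply, g] at h2
  rw [h2, EuclideanDomain.div_add_mod]

lemma dso_div_deg_lt (F : ℝ[X]) (hF : F.degree = (m : ℕ)) (r : ℝ[X]) (n : ℕ) (hmn : m ≤ n)
    (hr : r.degree < (n : ℕ)) : (r / F).degree < ((n - m : ℕ) : WithBot ℕ) := by
  have hF0 : F ≠ 0 := by rintro rfl; simp at hF
  by_cases h : F.degree ≤ r.degree
  · have h1 := Polynomial.degree_add_div hF0 h
    have hq0 : r / F ≠ 0 := by
      intro h0
      rw [h0, Polynomial.degree_zero, WithBot.add_bot] at h1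
      rw [← h1, hF] at h
      simp at h
    rw [Polynomial.degree_eq_natDegree hq0] at h1 ⊢
    rw [← h1, hF] at hr
    norm_cast at hr ⊢
    omega
  · rw [(Polynomial.div_eq_zero_iff hF0).2 (not_le.1 h), Polynomial.degree_zero]
    exact WithBot.bot_lt_coe _

lemma dso_div_deg_eq (F : ℝ[X]) (hF : F.degree = (m : ℕ)) (r : ℝ[X]) (n : ℕ) (hmn : m ≤ n)
    (hr : r.degree = (n : ℕ)) : (r / F).degree = ((n - m : ℕ) : WithBot ℕ) := by
  have hF0 : F ≠ 0 := by rintro rfl; simp at hF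
  have h1 := Polynomial.degree_add_div hF0 (p := r) (by rw [hF, hr]; exact_mod_cast hmn)
  have hq0 : r / F ≠ 0 := by
    intro h0
    rw [h0, Polynomial.degree_zero, WithBot.add_bot, hr] at h1
    simp at h1
  rw [Polynomial.degree_eq_natDegree hq0] at h1 ⊢
  rw [hF, hr] at h1
  norm_cast at h1 ⊢
  omega

/-- The set-up of the abstract argument. -/
structure DsoSetup (m : ℕ) (B : ℝ[X] →ₗ[ℝ] ℝ[X] →ₗ[ℝ] ℝ) (J : ℝ[X] →ₗ[ℝ] ℝ) (F : ℝ[X])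
    (f : Fin m → ℝ[X]) (p : ℕ → ℝ[X]) : Prop where
  hm : 1 ≤ m
  hp : ∀ n : ℕ, (p n).degree = (n : ℕ)
  ho : ∀ n : ℕ, ∀ r : ℝ[X], r.degree < (n : ℕ) → J (p n * r) = 0
  hn : ∀ n, J (p n * p n) ≠ 0
  hF : F.degree = (m : ℕ)
  hf : LinearIndependent ℝ f
  hfd : ∀ i, (f i).degree < (m : ℕ)
  hBr : ∀ q s, B q (F * s) = J (q * s)
  hBl : ∀ q s, B (F * q) s = J (q * s)

variable {B : ℝ[X] →ₗ[ℝ] ℝ[X] →ₗ[ℝ] ℝ} {J : ℝ[X] →ₗ[ℝ] ℝ} {F : ℝ[X]}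
    {f : Fin m → ℝ[X]} {p : ℕ → ℝ[X]}

/-- a combination `∑ a_j p_{n-j}` killing all `f i` is orthogonal to degree `< n`. -/
lemma DsoSetup.good (S : DsoSetup m B J F f p) (n : ℕ) (hmn : m ≤ n) (a : Fin (m + 1) → ℝ)
    (h0 : a 0 ≠ 0) (hlast : a (Fin.last m) ≠ 0)
    (ha : ∀ i, ∑ j : Fin (m + 1), a j * B (p (n - j)) (f i) = 0) :
    (∑ j : Fin (m + 1), a j • p (n - j)).degree = (n : ℕ) ∧
    (∀ r : ℝ[X], r.degree < (n : ℕ) → B (∑ j : Fin (m + 1), a j • p (n - j)) r = 0) ∧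
    B (∑ j : Fin (m + 1), a j • p (n - j)) (∑ j : Fin (m + 1), a j • p (n - j)) ≠ 0 := by
  set q := ∑ j : Fin (m + 1), a j • p (n - j) with hq
  have hdeg : q.degree = (n : ℕ) := by
    rw [hq, Fin.sum_univ_succ]
    have h1 : (a 0 • p (n - ((0 : Fin (m + 1)) : ℕ))).degree = (n : ℕ) := by
      rw [Polynomial.degree_smul_of_smul_regular _ (IsSMulRegular.of_ne_zero h0), S.hp]; simp
    rw [Polynomial.degree_add_eq_left_of_degree_lt, h1]
    rw [h1]
    rw [Polynomial.degree_lt_iff_coeff_zero]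
    intro i hi
    rw [Polynomial.finsetSum_coeff]
    apply Finset.sum_eq_zero
    intro j _
    rw [Polynomial.coeff_smul, Polynomial.coeff_eq_zero_of_degree_lt, smul_zero]
    rw [S.hp]
    have := S.hm
    have hj : ((j.succ : Fin (m + 1)) : ℕ) = j + 1 := by simp
    norm_cast
    omega
  have hqf : ∀ i, B q (f i) = 0 := by
    intro i
    rw [hq, map_sum, LinearMap.sum_apply, ← ha i]
    simp
  have hqc : ∀ c : Fin m → ℝ, B q (∑ i, c i • f i) = 0 := by
    intro c
    rw [map_sum]
    simp [hqf]
  have hJ : ∀ s, J (q * s) = ∑ j : Fin (m + 1), a j * J (p (n - j) * s) := by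
    intro s
    rw [hq, Finset.sum_mul, map_sum]
    simp
  refine ⟨hdeg, ?_, ?_⟩
  · intro r hr
    obtain ⟨c, hc⟩ := dso_decomp F S.hF f S.hf S.hfd r
    rw [hc, map_add, hqc, add_zero, S.hBr, hJ]
    apply Finset.sum_eq_zero
    intro j _
    rw [S.ho, mul_zero]
    refine (dso_div_deg_lt F S.hF r n hmn hr).trans_le ?_
    have := j.is_lt
    norm_cast
    omega
  · obtain ⟨c, hc⟩ := dso_decomp F S.hF f S.hf S.hfd q
    have hd := dso_div_deg_eq F S.hF q n hmn hdeg
    have hBqq : B q q = J (q * (q / F)) := by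
      calc B q q = B q (F * (q / F) + ∑ i, c i • f i) := congrArg (B q) hc
        _ = J (q * (q / F)) := by rw [map_add, hqc, add_zero, S.hBr]
    rw [hBqq, hJ, Fin.sum_univ_castSucc, Finset.sum_eq_zero, zero_add]
    · refine mul_ne_zero hlast ?_
      apply dso_pair_ne p S.hp J S.ho S.hn
      simpa using hd
    · intro j _
      rw [S.ho, mul_zero]
      rw [hd]
      have := j.is_lt
      have hj : ((j.castSucc : Fin (m + 1)) : ℕ) = j := by simp
      norm_cast
      omega

/-- existence of an orthogonal polynomial gives a linear recurrence for the `R`. -/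
lemma DsoSetup.recur (S : DsoSetup m B J F f p) (n : ℕ) (hmn : m ≤ n) (q : ℝ[X])
    (hd : q.degree = (n : ℕ)) (hqo : ∀ r : ℝ[X], r.degree < (n : ℕ) → B q r = 0)
    (hqq : B q q ≠ 0) :
    ∃ a : ℕ → ℝ, a 0 ≠ 0 ∧ a m ≠ 0 ∧
      ∀ i, ∑ j ∈ Finset.range (m + 1), a j * B (p (n - m + j)) (f i) = 0 := by
  have hF0 : F ≠ 0 := by rintro rfl; have := S.hF; simp at this
  have hFs : ∀ s : ℝ[X], s.degree < ((n - m : ℕ) : WithBot ℕ) → J (q * s) = 0 := by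
    intro s hs
    rw [← S.hBr]
    apply hqo
    rw [Polynomial.degree_mul, S.hF]
    by_cases h0 : s = 0
    · subst h0; simp
    · rw [Polynomial.degree_eq_natDegree h0] at hs ⊢
      norm_cast at hs ⊢
      omega
  obtain ⟨a, ha⟩ := dso_expand p S.hp J S.ho S.hn (n - m) (m + 1) q
    (by rw [hd]; norm_cast; omega) hFs
  have hfi : ∀ i, B q (f i) = 0 := fun i => hqo _ ((S.hfd i).trans_le (by exact_mod_cast hmn))
  refine ⟨a, ?_, ?_, ?_⟩
  · intro h0
    apply hqq
    obtain ⟨c, hc⟩ := dso_decomp F S.hF f S.hf S.hfd q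
    have hd' := dso_div_deg_eq F S.hF q n hmn hd
    have : B q (∑ i, c i • f i) = 0 := by rw [map_sum]; simp [hfi]
    have hBqq : B q q = J (q * (q / F)) := by
      calc B q q = B q (F * (q / F) + ∑ i, c i • f i) := congrArg (B q) hc
        _ = J (q * (q / F)) := by rw [map_add, this, add_zero, S.hBr]
    rw [hBqq]
    generalize q / F = s at hd'
    rw [ha, Finset.sum_mul, map_sum]
    apply Finset.sum_eq_zero
    intro j _
    rw [smul_mul_assoc, map_smul]
    rcases Nat.eq_zero_or_pos j with h | h
    · rw [h, h0, zero_smul]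
    · rw [S.ho, smul_zero]
      rw [hd']; norm_cast; omega
  · intro h0
    have : q.degree < (n : ℕ) := by
      rw [ha, Finset.sum_range_succ, h0, zero_smul, add_zero,
        Polynomial.degree_lt_iff_coeff_zero]
      intro i hi
      rw [Polynomial.finsetSum_coeff]
      apply Finset.sum_eq_zero
      intro j hj
      have := Finset.mem_range.1 hj
      rw [Polynomial.coeff_smul, Polynomial.coeff_eq_zero_of_degree_lt, smul_zero]
      rw [S.hp]
      norm_cast
      omega
    rw [hd] at this
    exact lt_irrefl _ this
  · intro i
    rw [← hfi i, ha, map_sum, LinearMap.sum_apply]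
    simp

lemma DsoSetup.det_ne (S : DsoSetup m B J F f p)
    (hex : ∀ n : ℕ, m ≤ n → ∃ q : ℝ[X], q.degree = (n : ℕ) ∧
        (∀ r : ℝ[X], r.degree < (n : ℕ) → B q r = 0) ∧ B q q ≠ 0)
    (n0 : ℕ) (hn0 : m ≤ n0) :
    Matrix.det (Matrix.of fun i j : Fin m => B (p (n0 - ((j : ℕ) + 1))) (f i)) ≠ 0 := by
  intro hdet
  obtain ⟨c, hc0, hc⟩ := Matrix.exists_vecMul_eq_zero_iff.2 hdet
  set g : ℝ[X] := ∑ i, c i • f i with hg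
  have hg0 : g ≠ 0 := by
    intro h
    apply hc0
    funext i
    exact Fintype.linearIndependent_iff.1 S.hf c h i
  have hBg : ∀ q, B q g = ∑ i, c i * B q (f i) := by
    intro q; rw [hg, map_sum]; simp
  have hrec : ∀ k : ℕ, ∃ a : ℕ → ℝ, a 0 ≠ 0 ∧ a m ≠ 0 ∧
      ∑ j ∈ Finset.range (m + 1), a j * B (p (k + j)) g = 0 := by
    intro k
    obtain ⟨q, h1, h2, h3⟩ := hex (k + m) (Nat.le_add_left _ _)
    obtain ⟨a, ha0, ham, ha⟩ := S.recur (k + m) (Nat.le_add_left _ _) q h1 h2 h3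
    refine ⟨a, ha0, ham, ?_⟩
    simp only [Nat.add_sub_cancel] at ha
    simp only [hBg, Finset.mul_sum]
    rw [Finset.sum_comm]
    apply Finset.sum_eq_zero
    intro i _
    have := congrArg (fun x => c i * x) (ha i)
    simp only [mul_zero, Finset.mul_sum] at this
    rw [← this]
    apply Finset.sum_congr rfl
    intros; ring
  let Q : ℕ → Prop := fun k => ∀ j < m, B (p (k + j)) g = 0
  have hup : ∀ k, Q k → Q (k + 1) := by
    intro k hk j hj
    by_cases h : j + 1 < m
    · have := hk (j + 1) h
      rwa [add_assoc, add_comm 1 j]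
    · have hjm : j + 1 = m := by omega
      obtain ⟨a, ha0, ham, ha⟩ := hrec k
      rw [Finset.sum_range_succ, Finset.sum_eq_zero, zero_add] at ha
      · rw [add_assoc, add_comm 1 j, hjm]
        exact (mul_eq_zero.1 ha).resolve_left ham
      · intro i hi
        rw [hk i (Finset.mem_range.1 hi), mul_zero]
  have hdown : ∀ k, Q (k + 1) → Q k := by
    intro k hk j hj
    rcases Nat.eq_zero_or_pos j with h | h
    · subst h
      obtain ⟨a, ha0, ham, ha⟩ := hrec k
      rw [Finset.sum_range_succ', Finset.sum_eq_zero, zero_add] at ha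
      · exact (mul_eq_zero.1 ha).resolve_left ha0
      · intro i hi
        have := hk i (Finset.mem_range.1 hi)
        rw [add_comm i 1, ← add_assoc, this, mul_zero]
    · have := hk (j - 1) (by omega)
      have e : k + 1 + (j - 1) = k + j := by omega
      rwa [e] at this
  have hstart : Q (n0 - m) := by
    intro j hj
    have h := congrFun hc ⟨m - 1 - j, by omega⟩
    simp only [Matrix.vecMul, dotProduct, Matrix.of_apply, Pi.zero_apply] at h
    have e : n0 - (m - 1 - j + 1) = n0 - m + j := by omega
    rw [e] at h
    rw [hBg, h]
  have hz : ∀ k, Q k → Q 0 := by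
    intro k
    induction k with
    | zero => exact id
    | succ k ih => exact fun h => ih (hdown k h)
  have hall : ∀ k, Q k := by
    intro k
    induction k with
    | zero => exact hz _ hstart
    | succ k ih => exact hup k ih
  have hpk : ∀ k, B (p k) g = 0 := fun k => hall k 0 S.hm
  have hq : ∀ q, B q g = 0 := by
    intro q
    obtain ⟨a, ha⟩ := dso_expand p S.hp J S.ho S.hn 0 (q.natDegree + 1) q
      (by
        refine Polynomial.degree_le_natDegree.trans_lt ?_
        norm_cast
        omega)
      (by
        intro s hs
        have : s = 0 := by
          rw [← Polynomial.degree_eq_bot]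
          simpa [Nat.WithBot.lt_zero_iff] using hs
        simp [this])
    clear_value g
    rw [ha, map_sum, LinearMap.sum_apply]
    simp [hpk]
  have h1 := hq (F * p g.natDegree)
  rw [S.hBl] at h1
  exact dso_pair_ne p S.hp J S.ho S.hn _ g (Polynomial.degree_eq_natDegree hg0) h1

/-- the determinant polynomials are orthogonal -/
lemma DsoSetup.qdet (S : DsoSetup m B J F f p) (R : ℕ → ℕ → ℝ)
    (hR : ∀ (i : Fin m) n, R ((i : ℕ) + 1) n = B (p n) (f i))
    (pz : ℤ → ℝ[X]) (hpz : ∀ k : ℕ, pz k = p k)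
    (hdet : ∀ n : ℕ, m ≤ n →
        Matrix.det (Matrix.of fun i j : Fin m => R ((i : ℕ) + 1) (n - ((j : ℕ) + 1))) ≠ 0)
    (n : ℕ) (hmn : m ≤ n) (q : ℝ[X])
    (hq : q = Matrix.det (Matrix.of fun i j : Fin (m + 1) =>
        if (i : ℕ) = 0 then pz ((n : ℤ) - (j : ℤ))
        else Polynomial.C (R (i : ℕ) (n - (j : ℕ))))) :
    q.degree = (n : ℕ) ∧ (∀ r : ℝ[X], r.degree < (n : ℕ) → B q r = 0) ∧ B q q ≠ 0 := by
  let A : Fin (m + 1) → Matrix (Fin m) (Fin m) ℝ := fun j =>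
    Matrix.of fun i k => R ((i : ℕ) + 1) (n - ((j.succAbove k : Fin (m + 1)) : ℕ))
  let a : Fin (m + 1) → ℝ := fun j => (-1) ^ (j : ℕ) * (A j).det
  have hqa : q = ∑ j : Fin (m + 1), a j • p (n - j) := by
    rw [hq, Matrix.det_succ_row_zero]
    apply Finset.sum_congr rfl
    intro j _
    have hj : (n : ℤ) - ((j : ℕ) : ℤ) = ((n - (j : ℕ) : ℕ) : ℤ) := by
      have := j.is_lt; omega
    have hs : ((Matrix.of fun i j : Fin (m + 1) =>
        if (i : ℕ) = 0 then pz ((n : ℤ) - (j : ℤ))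
        else Polynomial.C (R (i : ℕ) (n - (j : ℕ)))).submatrix Fin.succ j.succAbove)
        = (Polynomial.C : ℝ →+* ℝ[X]).mapMatrix (A j) := by
      ext1 i k
      simp [A]
    rw [hs, ← RingHom.map_det]
    simp only [Matrix.of_apply, Fin.val_zero, if_true, hj, hpz, a, Polynomial.smul_eq_C_mul,
      map_mul, map_pow, map_neg, map_one]
    ring
  rw [hqa]
  apply S.good n hmn a
  · have := hdet n hmn
    simpa [a, A] using this
  · have := hdet (n + 1) (by omega)
    simpa [a, A] using this
  · intro i
    have h0 : Matrix.det (Matrix.of fun k j : Fin (m + 1) =>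
        if (k : ℕ) = 0 then R ((i : ℕ) + 1) (n - (j : ℕ)) else R (k : ℕ) (n - (j : ℕ))) = 0 := by
      apply Matrix.det_zero_of_row_eq (i := 0) (j := i.succ) (Fin.succ_ne_zero i).symm
      funext j
      simp
    rw [Matrix.det_succ_row_zero] at h0
    rw [← h0]
    apply Finset.sum_congr rfl
    intro j _
    rw [← hR]
    have hs : ((Matrix.of fun k j : Fin (m + 1) =>
        if (k : ℕ) = 0 then R ((i : ℕ) + 1) (n - (j : ℕ)) else R (k : ℕ) (n - (j : ℕ))).submatrix
          Fin.succ j.succAbove) = A j := by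
      ext1 i k
      simp [A]
    rw [hs]
    simp only [Matrix.of_apply, Fin.val_zero, if_true, a]
    ring

end AbstractPart
section ConcretePart

/-- integration of polynomials as a linear functional -/
noncomputable def dsoI (ν : SignedMeasure ℝ)
    (hInt : ∀ p : Polynomial ℝ,
      Integrable (fun x => p.eval x) ν.toJordanDecomposition.posPart ∧
      Integrable (fun x => p.eval x) ν.toJordanDecomposition.negPart) : ℝ[X] →ₗ[ℝ] ℝ where
  toFun q := signedIntegral ν (fun x => q.eval x)
  map_add' q r := by
    simp only [signedIntegral, Polynomial.eval_add]
    rw [integral_add (hInt q).1 (hInt r).1, integral_add (hInt q).2 (hInt r).2]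
    ring
  map_smul' c q := by
    simp only [signedIntegral, Polynomial.eval_smul, smul_eq_mul, RingHom.id_apply]
    rw [integral_const_mul, integral_const_mul]
    ring

/-- `Tform` as a bilinear map -/
noncomputable def dsoT (k : ℕ) (a : ℝ) (A : ℕ → ℕ → ℝ) : ℝ[X] →ₗ[ℝ] ℝ[X] →ₗ[ℝ] ℝ :=
  LinearMap.mk₂ ℝ (Tform k a A)
    (by
      intro x y z
      simp only [Tform, iterate_map_add, Polynomial.eval_add, add_mul,
        Finset.sum_add_distrib])
    (by
      intro c x y
      simp only [Tform, Polynomial.iterate_derivative_smul, Polynomial.eval_smul, smul_eq_mul,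
        Finset.mul_sum, mul_assoc])
    (by
      intro x y z
      simp only [Tform, iterate_map_add, Polynomial.eval_add, mul_add,
        Finset.sum_add_distrib])
    (by
      intro c x y
      simp only [Tform, Polynomial.iterate_derivative_smul, Polynomial.eval_smul, smul_eq_mul,
        Finset.mul_sum]
      refine Finset.sum_congr rfl fun i _ => Finset.sum_congr rfl fun j _ => ?_
      ring)

lemma dsoT_apply (k : ℕ) (a : ℝ) (A : ℕ → ℕ → ℝ) (q s : ℝ[X]) :
    dsoT k a A q s = Tform k a A q s := rfl

lemma dso_der (a : ℝ) (q : ℝ[X]) (j : ℕ) :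
    ((⇑Polynomial.derivative)^[j] q).eval a
      = (Nat.factorial j : ℝ) * (Polynomial.taylor a q).coeff j := by
  rw [Polynomial.taylor_coeff, ← Polynomial.factorial_smul_hasseDeriv]
  simp

lemma dso_der_zero (a : ℝ) (k j : ℕ) (hj : j < k) (s : ℝ[X]) :
    ((⇑Polynomial.derivative)^[j] ((X - C a) ^ k * s)).eval a = 0 := by
  rw [dso_der, Polynomial.taylor_mul, Polynomial.taylor_pow, map_sub, Polynomial.taylor_X,
    Polynomial.taylor_C, add_sub_cancel_right, Polynomial.coeff_X_pow_mul', if_neg (by omega),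
    mul_zero]

lemma dsoT_zero_right (k : ℕ) (a : ℝ) (A : ℕ → ℕ → ℝ) (q s : ℝ[X]) :
    Tform k a A q ((X - C a) ^ k * s) = 0 := by
  refine Finset.sum_eq_zero fun i _ => Finset.sum_eq_zero fun j hj => ?_
  rw [dso_der_zero a k j (Finset.mem_range.1 hj), mul_zero]

lemma dsoT_zero_left (k : ℕ) (a : ℝ) (A : ℕ → ℕ → ℝ) (q s : ℝ[X]) :
    Tform k a A ((X - C a) ^ k * q) s = 0 := by
  refine Finset.sum_eq_zero fun i hi => Finset.sum_eq_zero fun j _ => ?_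
  rw [dso_der_zero a k i (Finset.mem_range.1 hi), zero_mul, zero_mul]

lemma dso_reindex (k lo hi : ℕ) (hlo : 1 ≤ lo) (h g : ℕ → ℝ)
    (hz : ∀ j < k, ¬ (lo ≤ j + 1 ∧ j + 1 ≤ hi) → h j = 0)
    (he : ∀ j < k, lo ≤ j + 1 → j + 1 ≤ hi → h j = g (j + 1)) :
    ∑ j ∈ Finset.range k, h j = ∑ j ∈ Finset.Icc lo (min hi k), g j := by
  rw [← Finset.sum_filter_of_ne (p := fun j => lo ≤ j + 1 ∧ j + 1 ≤ hi)]
  · refine Finset.sum_nbij' (fun j => j + 1) (fun j => j - 1) ?_ ?_ ?_ ?_ ?_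
    · intro j hj
      simp only [Finset.mem_filter, Finset.mem_range, Finset.mem_Icc] at hj ⊢
      omega
    · intro j hj
      simp only [Finset.mem_filter, Finset.mem_range, Finset.mem_Icc] at hj ⊢
      omega
    · intro j hj
      simp
    · intro j hj
      simp only [Finset.mem_Icc] at hj
      omega
    · intro j hj
      simp only [Finset.mem_filter, Finset.mem_range] at hj
      exact he j hj.1 hj.2.1 hj.2.2
  · intro j hj hne
    by_contra hcon
    exact hne (hz j (Finset.mem_range.1 hj) hcon)

lemma dsoT_expand (k : ℕ) (a : ℝ) (A : ℕ → ℕ → ℝ) (q s : ℝ[X]) :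
    Tform k a A q s = ∑ i ∈ Finset.range k,
      (∑ j ∈ Finset.range k, (Nat.factorial j : ℝ) * (Polynomial.taylor a s).coeff j * A i j) *
        ((⇑Polynomial.derivative)^[i] q).eval a := by
  unfold Tform
  refine Finset.sum_congr rfl fun i _ => ?_
  rw [Finset.sum_mul]
  refine Finset.sum_congr rfl fun j _ => ?_
  rw [dso_der a s j]
  ring

lemma dsoT_first (m1 m2 : ℕ) (lam mu : ℝ) (hlm : lam ≠ mu) (M : ℕ → ℕ → ℝ) (q : ℝ[X])
    (i0 l : ℕ) (hl : l = i0 + 1) :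
    Tform m1 lam M q ((X - C lam) ^ i0 * (C mu - X) ^ m2) =
      ∑ i ∈ Finset.range m1,
            (∑ j ∈ Finset.Icc l (min (l + m2) m1),
                (Nat.factorial (j - 1) : ℝ) * (Nat.choose m2 (j - l) : ℝ) * M i (j - 1) /
                  ((-1 : ℝ) ^ m2 * (lam - mu) ^ ((j : ℤ) - (l : ℤ) - (m2 : ℤ)))) *
              ((⇑Polynomial.derivative)^[i] q).eval lam := by
  subst hl
  have hd : lam - mu ≠ 0 := sub_ne_zero.2 hlm
  have hc : ∀ j, (Polynomial.taylor lam ((X - C lam) ^ i0 * (C mu - X) ^ m2)).coeff j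
      = if i0 ≤ j then (-1) ^ m2 * ((lam - mu) ^ (m2 - (j - i0)) * (m2.choose (j - i0) : ℝ))
        else 0 := by
    intro j
    have h1 : Polynomial.taylor lam (C mu - X) = C (-1) * (X + C (lam - mu)) := by
      rw [map_sub, Polynomial.taylor_X, Polynomial.taylor_C]
      simp only [map_neg, map_one, map_sub]
      ring
    rw [Polynomial.taylor_mul, Polynomial.taylor_pow, Polynomial.taylor_pow, h1, map_sub,
      Polynomial.taylor_X, Polynomial.taylor_C, add_sub_cancel_right, Polynomial.coeff_X_pow_mul',
      mul_pow, ← C_pow, Polynomial.coeff_C_mul, Polynomial.coeff_X_add_C_pow]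
  rw [dsoT_expand]
  refine Finset.sum_congr rfl fun i _ => ?_
  congr 1
  apply dso_reindex m1 (i0 + 1) (i0 + 1 + m2) (by omega)
  · intro j _ hj
    rw [hc]
    split_ifs with h
    · rw [Nat.choose_eq_zero_of_lt (by omega)]; simp
    · simp
  · intro j _ h1 h2
    rw [hc, if_pos (by omega)]
    have e1 : j + 1 - (i0 + 1) = j - i0 := by omega
    have e2 : (((j + 1 : ℕ) : ℤ) - ((i0 + 1 : ℕ) : ℤ) - (m2 : ℤ)) = -((m2 - (j - i0) : ℕ) : ℤ) := by
      omega
    rw [e1, e2, zpow_neg, zpow_natCast, Nat.add_sub_cancel]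
    have h3 : ((-1 : ℝ) ^ m2) * (-1) ^ m2 = 1 := by rw [← mul_pow]; simp
    have h4 : (lam - mu) ^ (m2 - (j - i0)) ≠ 0 := pow_ne_zero _ hd
    rw [eq_div_iff (mul_ne_zero (by positivity) (inv_ne_zero h4))]
    field_simp
    linear_combination (Nat.choose m2 (j - i0) : ℝ) * M i j * h3

lemma dsoT_second (m1 m2 : ℕ) (lam mu : ℝ) (hlm : lam ≠ mu) (N : ℕ → ℕ → ℝ) (q : ℝ[X])
    (k l : ℕ) (hl : l = m1 + k + 1) :
    Tform m2 mu N q ((X - C lam) ^ m1 * (C mu - X) ^ k) =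
      ∑ i ∈ Finset.range m2,
            (∑ j ∈ Finset.Icc (l - m1) (min l m2),
                (Nat.factorial (j - 1) : ℝ) * (Nat.choose m1 (l - j) : ℝ) * N i (j - 1) /
                  ((-1 : ℝ) ^ (l - m1 - 1) * (mu - lam) ^ ((j : ℤ) - (l : ℤ)))) *
              ((⇑Polynomial.derivative)^[i] q).eval mu := by
  subst hl
  have hd : mu - lam ≠ 0 := sub_ne_zero.2 hlm.symm
  have hc : ∀ j, (Polynomial.taylor mu ((X - C lam) ^ m1 * (C mu - X) ^ k)).coeff j
      = if k ≤ j then (-1) ^ k * ((mu - lam) ^ (m1 - (j - k)) * (m1.choose (j - k) : ℝ))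
        else 0 := by
    intro j
    have h1 : Polynomial.taylor mu ((X - C lam) ^ m1 * (C mu - X) ^ k)
        = X ^ k * (C ((-1) ^ k) * (X + C (mu - lam)) ^ m1) := by
      rw [Polynomial.taylor_mul, Polynomial.taylor_pow, Polynomial.taylor_pow, map_sub, map_sub,
        Polynomial.taylor_X, Polynomial.taylor_C, Polynomial.taylor_C]
      have e1 : (C mu - (X + C mu) : ℝ[X]) = (-1) * X := by ring
      have e2 : (X + C mu - C lam : ℝ[X]) = X + C (mu - lam) := by rw [map_sub]; ring
      rw [e1, e2, mul_pow, map_pow, map_neg, map_one]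
      ring
    rw [h1, Polynomial.coeff_X_pow_mul', Polynomial.coeff_C_mul, Polynomial.coeff_X_add_C_pow]
  rw [dsoT_expand]
  refine Finset.sum_congr rfl fun i _ => ?_
  congr 1
  apply dso_reindex m2 (m1 + k + 1 - m1) (m1 + k + 1) (by omega)
  · intro j _ hj
    rw [hc]
    split_ifs with h
    · rw [Nat.choose_eq_zero_of_lt (by omega)]; simp
    · simp
  · intro j _ h1 h2
    rw [hc, if_pos (by omega)]
    have e1 : m1 + k + 1 - (j + 1) = m1 - (j - k) := by omega
    have e0 : m1 + k + 1 - m1 - 1 = k := by omega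
    have e2 : (((j + 1 : ℕ) : ℤ) - ((m1 + k + 1 : ℕ) : ℤ)) = -((m1 - (j - k) : ℕ) : ℤ) := by
      omega
    rw [e0, e1, e2, zpow_neg, zpow_natCast, Nat.add_sub_cancel, Nat.choose_symm (by omega)]
    have h3 : ((-1 : ℝ) ^ k) * (-1) ^ k = 1 := by rw [← mul_pow]; simp
    have h4 : (mu - lam) ^ (m1 - (j - k)) ≠ 0 := pow_ne_zero _ hd
    rw [eq_div_iff (mul_ne_zero (by positivity) (inv_ne_zero h4))]
    field_simp
    linear_combination (Nat.choose m1 (j - k) : ℝ) * N i j * h3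

lemma dso_pow_indep (g h : ℝ[X]) (hgh : g.comp h = X) (k : ℕ) (c : Fin k → ℝ)
    (hs : ∑ i : Fin k, c i • g ^ (i : ℕ) = 0) (i : Fin k) : c i = 0 := by
  have h1 := congrArg (fun q => (q.comp h).coeff i) hs
  simp only [Polynomial.sum_comp, Polynomial.smul_comp, Polynomial.pow_comp, hgh,
    Polynomial.finsetSum_coeff, Polynomial.coeff_smul, Polynomial.coeff_X_pow,
    Polynomial.zero_comp, Polynomial.coeff_zero, smul_eq_mul, mul_ite, mul_one, mul_zero,
    Fin.val_inj] at h1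
  simpa using h1

lemma dso_degree_aux (mu : ℝ) : (C mu - X : ℝ[X]).degree = 1 := by
  rw [← neg_sub, Polynomial.degree_neg, Polynomial.degree_X_sub_C]

/-- the test polynomials -/
noncomputable def dsof (m1 m2 : ℕ) (lam mu : ℝ) (i : Fin (m1 + m2)) : ℝ[X] :=
  if (i : ℕ) < m1 then (X - C lam) ^ (i : ℕ) * (C mu - X) ^ m2
  else (X - C lam) ^ m1 * (C mu - X) ^ ((i : ℕ) - m1)

lemma dsof_degree (m1 m2 : ℕ) (lam mu : ℝ) (i : Fin (m1 + m2)) :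
    (dsof m1 m2 lam mu i).degree < ((m1 + m2 : ℕ) : WithBot ℕ) := by
  unfold dsof
  have := i.is_lt
  split_ifs with h <;>
  · rw [Polynomial.degree_mul, Polynomial.degree_pow, Polynomial.degree_pow, dso_degree_aux,
      Polynomial.degree_X_sub_C, nsmul_one, nsmul_one]
    norm_cast
    omega

lemma dsof_indep (m1 m2 : ℕ) (lam mu : ℝ) (hlm : lam ≠ mu) :
    LinearIndependent ℝ (dsof m1 m2 lam mu) := by
  rw [Fintype.linearIndependent_iff]
  intro c hc
  rw [Fin.sum_univ_add] at hc
  set a : Fin m1 → ℝ := fun i => c (Fin.castAdd m2 i) with ha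
  set b : Fin m2 → ℝ := fun i => c (Fin.natAdd m1 i) with hb
  have hc' : (∑ i, a i • (X - C lam) ^ (i : ℕ)) * (C mu - X) ^ m2
      + (X - C lam) ^ m1 * (∑ i, b i • (C mu - X) ^ (i : ℕ)) = 0 := by
    rw [← hc, Finset.sum_mul, Finset.mul_sum]
    congr 1
    · refine Finset.sum_congr rfl fun i _ => ?_
      simp [dsof, a]
    · refine Finset.sum_congr rfl fun i _ => ?_
      simp [dsof, b]
  have hcop : IsCoprime ((X - C lam : ℝ[X]) ^ m1) ((C mu - X) ^ m2) := by
    apply IsCoprime.pow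
    rw [← neg_sub X (C mu), IsCoprime.neg_right_iff]
    exact Polynomial.isCoprime_X_sub_C_of_isUnit_sub (sub_ne_zero.2 hlm).isUnit
  have hA : (∑ i, a i • (X - C lam) ^ (i : ℕ)) = 0 := by
    apply Polynomial.eq_zero_of_dvd_of_degree_lt (p := (X - C lam) ^ m1)
    · apply hcop.dvd_of_dvd_mul_right
      exact ⟨-(∑ i, b i • (C mu - X) ^ (i : ℕ)), by linear_combination hc'⟩
    · rw [Polynomial.degree_pow, Polynomial.degree_X_sub_C, nsmul_one]
      rw [← Polynomial.mem_degreeLT]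
      refine Submodule.sum_mem _ fun i _ => Submodule.smul_mem _ _ ?_
      rw [Polynomial.mem_degreeLT, Polynomial.degree_pow, Polynomial.degree_X_sub_C, nsmul_one]
      exact_mod_cast i.is_lt
  have hB : (∑ i, b i • (C mu - X) ^ (i : ℕ)) = 0 := by
    rw [hA, zero_mul, zero_add] at hc'
    exact (mul_eq_zero.1 hc').resolve_left (pow_ne_zero _ (Polynomial.X_sub_C_ne_zero lam))
  intro i
  refine Fin.addCases (fun j => ?_) (fun j => ?_) i
  · exact dso_pow_indep (X - C lam) (X + C lam) (by simp) m1 a hA j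
  · exact dso_pow_indep (C mu - X) (C mu - X) (by simp) m2 b hB j

end ConcretePart

/-- **Lemma 2.1 (LemJacSob).** Construction of left orthogonal polynomials for a discrete
Sobolev bilinear form with two nodes via Casorati determinants of the sequences `R_l`. -/
theorem discreteSobolev_ortho_iff_casorati
    (ν : MeasureTheory.SignedMeasure ℝ) (lam mu : ℝ) (hlm : lam ≠ mu)
    (m1 m2 : ℕ) (hm : 1 ≤ m1 + m2) (M N : ℕ → ℕ → ℝ)
    (hInt : ∀ p : Polynomial ℝ,
      Integrable (fun x => p.eval x) ν.toJordanDecomposition.posPart ∧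
      Integrable (fun x => p.eval x) ν.toJordanDecomposition.negPart)
    (p : ℕ → Polynomial ℝ) (hpdeg : ∀ n : ℕ, (p n).degree = (n : ℕ))
    -- `(p_n)` is orthogonal with respect to `ν' = (x-λ)^{m1} (μ-x)^{m2} dν`
    (hporth : ∀ n : ℕ, ∀ r : Polynomial ℝ, r.degree < (n : ℕ) →
      signedIntegral ν
        (fun x => (p n).eval x * r.eval x * (x - lam) ^ m1 * (mu - x) ^ m2) = 0)
    (hpnorm : ∀ n : ℕ,
      signedIntegral ν
        (fun x => (p n).eval x * (p n).eval x * (x - lam) ^ m1 * (mu - x) ^ m2) ≠ 0) :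
    -- the bilinear form, the moments `w¹, w²` and the sequences `R_l`
    let m := m1 + m2
    let B : Polynomial ℝ → Polynomial ℝ → ℝ := fun r s =>
      signedIntegral ν (fun x => r.eval x * s.eval x) + Tform m1 lam M r s + Tform m2 mu N r s
    let w1 : ℕ → ℕ → ℝ := fun n i =>
      signedIntegral ν (fun x => (x - lam) ^ i * (mu - x) ^ m2 * (p n).eval x)
    let w2 : ℕ → ℕ → ℝ := fun n j =>
      signedIntegral ν (fun x => (x - lam) ^ m1 * (mu - x) ^ j * (p n).eval x)
    let R : ℕ → ℕ → ℝ := fun l n =>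
      if l ≤ m1 then
        w1 n (l - 1) +
          ∑ i ∈ Finset.range m1,
            (∑ j ∈ Finset.Icc l (min (l + m2) m1),
                (Nat.factorial (j - 1) : ℝ) * (Nat.choose m2 (j - l) : ℝ) * M i (j - 1) /
                  ((-1 : ℝ) ^ m2 * (lam - mu) ^ ((j : ℤ) - (l : ℤ) - (m2 : ℤ)))) *
              ((⇑Polynomial.derivative)^[i] (p n)).eval lam
      else
        w2 n (l - m1 - 1) +
          ∑ i ∈ Finset.range m2,
            (∑ j ∈ Finset.Icc (l - m1) (min l m2),
                (Nat.factorial (j - 1) : ℝ) * (Nat.choose m1 (l - j) : ℝ) * N i (j - 1) /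
                  ((-1 : ℝ) ^ (l - m1 - 1) * (mu - lam) ^ ((j : ℤ) - (l : ℤ)))) *
              ((⇑Polynomial.derivative)^[i] (p n)).eval mu
    let pz : ℤ → Polynomial ℝ := fun k => if k < 0 then 0 else p k.toNat
    let qdet : ℕ → Polynomial ℝ := fun n =>
      Matrix.det (Matrix.of fun i j : Fin (m + 1) =>
        if (i : ℕ) = 0 then pz ((n : ℤ) - (j : ℤ))
        else Polynomial.C (R (i : ℕ) (n - (j : ℕ))))
    -- the equivalence and the `moreover` part
    ((∀ n : ℕ, m ≤ n → ∃ q : Polynomial ℝ, q.degree = (n : ℕ) ∧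
        (∀ r : Polynomial ℝ, r.degree < (n : ℕ) → B q r = 0) ∧ B q q ≠ 0) ↔
      (∀ n : ℕ, m ≤ n →
        Matrix.det (Matrix.of fun i j : Fin m => R ((i : ℕ) + 1) (n - ((j : ℕ) + 1))) ≠ 0)) ∧
    ((∀ n : ℕ, m ≤ n →
        Matrix.det (Matrix.of fun i j : Fin m => R ((i : ℕ) + 1) (n - ((j : ℕ) + 1))) ≠ 0) →
      ∀ n : ℕ, m ≤ n → (qdet n).degree = (n : ℕ) ∧
        (∀ r : Polynomial ℝ, r.degree < (n : ℕ) → B (qdet n) r = 0) ∧ B (qdet n) (qdet n) ≠ 0) := by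
  intro m B w1 w2 R pz qdet
  let F : ℝ[X] := (X - C lam) ^ m1 * (C mu - X) ^ m2
  have hFmu : F = (X - C mu) ^ m2 * (C ((-1) ^ m2) * (X - C lam) ^ m1) := by
    have : (C mu - X : ℝ[X]) = C (-1) * (X - C mu) := by
      rw [map_neg, map_one]; ring
    simp only [F, this, mul_pow, map_pow]
    ring
  let I := dsoI ν hInt
  have hI : ∀ q, I q = signedIntegral ν (fun x => q.eval x) := fun _ => rfl
  let J : ℝ[X] →ₗ[ℝ] ℝ := I ∘ₗ LinearMap.mulLeft ℝ F
  have hJ : ∀ q, J q = I (F * q) := fun _ => rfl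
  let BL : ℝ[X] →ₗ[ℝ] ℝ[X] →ₗ[ℝ] ℝ :=
    (LinearMap.mul ℝ ℝ[X]).compr₂ I + dsoT m1 lam M + dsoT m2 mu N
  have hBI : ∀ q s, BL q s = I (q * s) + Tform m1 lam M q s + Tform m2 mu N q s :=
    fun _ _ => rfl
  have hBL : ∀ q s, B q s = BL q s := by
    intro q s
    rw [hBI, hI]
    simp only [B, Polynomial.eval_mul]
  have S : DsoSetup m BL J F (dsof m1 m2 lam mu) p := by
    refine ⟨hm, hpdeg, ?_, ?_, ?_, dsof_indep m1 m2 lam mu hlm, dsof_degree m1 m2 lam mu, ?_, ?_⟩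
    · intro n r hr
      rw [← hporth n r hr, hJ, hI]
      congr 1
      funext x
      simp only [F, Polynomial.eval_mul, Polynomial.eval_pow, Polynomial.eval_sub,
        Polynomial.eval_X, Polynomial.eval_C]
      ring
    · intro n
      convert hpnorm n using 1
      rw [hJ, hI]
      congr 1
      funext x
      simp only [F, Polynomial.eval_mul, Polynomial.eval_pow, Polynomial.eval_sub,
        Polynomial.eval_X, Polynomial.eval_C]
      ring
    · simp only [F, m]
      rw [Polynomial.degree_mul, Polynomial.degree_pow, Polynomial.degree_pow, dso_degree_aux,
        Polynomial.degree_X_sub_C, nsmul_one, nsmul_one]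
      norm_cast
    · intro q s
      have h1 : Tform m1 lam M q (F * s) = 0 := by
        simp only [F, mul_assoc]
        exact dsoT_zero_right _ _ _ _ _
      have h2 : Tform m2 mu N q (F * s) = 0 := by
        rw [hFmu, mul_assoc]
        exact dsoT_zero_right _ _ _ _ _
      rw [hBI, h1, h2, add_zero, add_zero, hJ]
      congr 1
      ring
    · intro q s
      have h1 : Tform m1 lam M (F * q) s = 0 := by
        simp only [F, mul_assoc]
        exact dsoT_zero_left _ _ _ _ _
      have h2 : Tform m2 mu N (F * q) s = 0 := by
        rw [hFmu, mul_assoc]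
        exact dsoT_zero_left _ _ _ _ _
      rw [hBI, h1, h2, add_zero, add_zero, hJ]
      congr 1
      ring
  have hR : ∀ (i : Fin m) n, R ((i : ℕ) + 1) n = BL (p n) (dsof m1 m2 lam mu i) := by
    intro i n
    rw [hBI, hI]
    by_cases h : (i : ℕ) < m1
    · have h2 : Tform m2 mu N (p n) ((X - C lam) ^ (i : ℕ) * (C mu - X) ^ m2) = 0 := by
        have : ((X - C lam) ^ (i : ℕ) * (C mu - X) ^ m2 : ℝ[X])
            = (X - C mu) ^ m2 * (C ((-1) ^ m2) * (X - C lam) ^ (i : ℕ)) := by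
          have : (C mu - X : ℝ[X]) = C (-1) * (X - C mu) := by
            rw [map_neg, map_one]; ring
          simp only [this, mul_pow, map_pow]
          ring
        rw [this]
        exact dsoT_zero_right _ _ _ _ _
      have hf : dsof m1 m2 lam mu i = (X - C lam) ^ (i : ℕ) * (C mu - X) ^ m2 := by
        simp only [dsof, if_pos h]
      rw [hf, h2, add_zero, dsoT_first m1 m2 lam mu hlm M (p n) i _ rfl]
      simp only [R]
      rw [if_pos (by omega)]
      congr 1
      simp only [w1]
      congr 1
      funext x
      simp only [Polynomial.eval_mul, Polynomial.eval_pow, Polynomial.eval_sub,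
        Polynomial.eval_X, Polynomial.eval_C, Nat.add_sub_cancel]
      ring
    · have hf : dsof m1 m2 lam mu i = (X - C lam) ^ m1 * (C mu - X) ^ ((i : ℕ) - m1) := by
        simp only [dsof, if_neg h]
      rw [hf, dsoT_zero_right, add_zero,
        dsoT_second m1 m2 lam mu hlm N (p n) ((i : ℕ) - m1) ((i : ℕ) + 1) (by omega)]
      simp only [R]
      rw [if_neg (by omega)]
      congr 1
      simp only [w2]
      congr 1
      funext x
      have e : (i : ℕ) + 1 - m1 - 1 = i - m1 := by omega
      simp only [Polynomial.eval_mul, Polynomial.eval_pow, Polynomial.eval_sub,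
        Polynomial.eval_X, Polynomial.eval_C, e]
      ring
  have hpz : ∀ k : ℕ, pz k = p k := by
    intro k
    simp only [pz]
    rw [if_neg (by omega), Int.toNat_natCast]
  simp only [hBL]
  have hmore : (∀ n : ℕ, m ≤ n →
        Matrix.det (Matrix.of fun i j : Fin m => R ((i : ℕ) + 1) (n - ((j : ℕ) + 1))) ≠ 0) →
      ∀ n : ℕ, m ≤ n → (qdet n).degree = (n : ℕ) ∧
        (∀ r : Polynomial ℝ, r.degree < (n : ℕ) → BL (qdet n) r = 0) ∧
          BL (qdet n) (qdet n) ≠ 0 := by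
    intro hdet n hn
    exact S.qdet R hR pz hpz hdet n hn (qdet n) rfl
  refine ⟨⟨?_, fun h n hn => ⟨qdet n, hmore h n hn⟩⟩, hmore⟩
  intro hex n hn
  have := S.det_ne hex n hn
  simpa only [hR] using this
end

section
/- Let (p_n)_{n≥0} be real polynomials with deg p_n = n, let A be a subalgebra of the ℝ-algebra of ℝ-linear endomorphisms of ℝ[x], let D_p ∈ A and real numbers θ_n satisfy D_p(p_n) = θ_n p_n for all n ≥ 0, and let θ be a real rational function with θ(n) = θ_n for all n ∈ ℕ. Let m ≥ 1 and, for h = 1,…,m, let ε^h and σ^h be real rational functions without poles at the integer points used below, and let D_h : ℝ[x] → ℝ[x] be the linear map determined on the basis (p_n) by D_h(p_n) = −(1/2)σ^h(n+1) p_n + Σ_{j=1}^{n} (−1)^{j+1} σ^h(n−j+1) ε^h(n)ε^h(n−1)⋯ε^h(n−j+1) p_{n−j}; assume D_h ∈ A for each h. Set ξ^h_{x,i} = Π_{j=0}^{i−1} ε^h(x−j) for i ≥ 1 and ξ^h_{x,0} = 1. Let Y_1, …, Y_m be real polynomials such that Ω(n) ≠ 0 for all integers n ≥ 0, where Ω(x)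 = det( ξ^l_{x−j, m−j} Y_l(θ(x−j)) )_{l,j=1}^{m}, and define q_n(x) as the (m+1)×(m+1) determinant whose first row is (p_n(x), −p_{n−1}(x), …, (−1)^m p_{n−m}(x)) (with p_k = 0 for k < 0) and whose (h+1)-th row, h = 1,…,m, is (ξ^h_{n,m} Y_h(θ(n)), ξ^h_{n−1,m−1} Y_h(θ(n−1)), …, Y_h(θ(n−m))). Let S be a real rational function and define M_h(x) = Σ_{j=1}^{m} (−1)^{h+j} ξ^h_{x, m−j} S(x+j) det( ξ^l_{x+j−r, m−r} Y_l(θ(x+j−r)) )_{l ∈ {1,…,m}∖{h}, r ∈ {1,…,m}∖{j}}. Assume: (ass0) S(x)Ω(x) is a polynomial in x; (ass1) there exist polynomials M̃_1,…,M̃_m with M_h(x) = σ^h(x+1)·M̃_h(θ(x)) for all x; (ass2) there exist polynomials λ and P_S with λ(x) − λ(x−1) = S(x)Ω(x) and P_S(θ(x)) = 2λ(x) + Σ_{h=1}^m Y_h(θ(x)) M_h(x) for all x. Then the operator D_{q,S} = (1/2)P_S(D_p) + Σ_{h=1}^{m} M̃_h(D_p) ∘ D_h ∘ Y_h(D_p)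 belongs to A and satisfies D_{q,S}(q_n) = λ(n)·q_n for every n ≥ 0. -/
open Polynomial

/-- A real function which is a rational function (quotient of two polynomials). -/
def IsRatFunc (f : ℝ → ℝ) : Prop :=
  ∃ u v : Polynomial ℝ, v ≠ 0 ∧ ∀ x : ℝ, v.eval x ≠ 0 → f x = u.eval x / v.eval x

/-- For `h ∈ {1,…,m}` and `j ∈ {1,…,m}`, the `j`-th element of `{1,…,m} \ {h}` in
increasing order (viewed on `{0,…,m-2}`). -/
def skipIdx (h k : ℕ) : ℕ := if k + 1 < h then k + 1 else k + 2

def xiP (ε : ℝ → ℝ) (x : ℝ) (i : ℕ) : ℝ := ∏ t ∈ Finset.range i, ε (x - (t : ℝ))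

lemma xiP_add (ε : ℝ → ℝ) (x : ℝ) (a b : ℕ) :
    xiP ε x (a + b) = xiP ε x a * xiP ε (x - a) b := by
  unfold xiP
  rw [Finset.prod_range_add]
  congr 1
  apply Finset.prod_congr rfl
  intro t _
  push_cast
  congr 1
  ring

def casM (m : ℕ) (ε y : Fin m → ℝ → ℝ) (x : ℝ) : Matrix (Fin m) (Fin m) ℝ :=
  Matrix.of fun l j => xiP (ε l) (x - ((j : ℕ) + 1)) (m - ((j : ℕ) + 1)) *
    y l (x - ((j : ℕ) + 1))

lemma key_F (m : ℕ) (ε y : Fin m → ℝ → ℝ) (x : ℝ) (k : ℕ) (r : Fin m) (j : ℕ)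
    (h1 : k < j + (r + 1)) (h2 : j + (r + 1) ≤ k + m) :
    ∑ h, (casM m ε y (x - k + (r + 1))).adjugate r h *
      (y h (x - j) * xiP (ε h) (x - j) (m + k - (r + 1) - j)) =
    if j = k then (casM m ε y (x - k + (r + 1))).det else 0 := by
  set Cm := casM m ε y (x - k + (r + 1)) with hC
  obtain ⟨t, ht⟩ : ∃ t : ℕ, j + (r + 1) = k + (t + 1) :=
    ⟨j + (r + 1) - k - 1, by omega⟩
  have htm : t < m := by omega
  have hh := congrFun (congrFun (Matrix.adjugate_mul Cm) r) ⟨t, htm⟩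
  rw [Matrix.mul_apply] at hh
  have hx : x - k + (r + 1) - ((t : ℝ) + 1) = x - j := by
    have : (j : ℝ) + (r + 1) = k + (t + 1) := by exact_mod_cast ht
    linarith
  have hn : m + k - (r + 1) - j = m - (t + 1) := by omega
  rw [hn]
  have e : ∀ h, Cm h ⟨t, htm⟩ = y h (x - j) * xiP (ε h) (x - j) (m - (t + 1)) := by
    intro h
    rw [hC, casM]
    simp only [Matrix.of_apply]
    rw [hx, mul_comm]
  simp only [e] at hh
  rw [hh]
  simp only [Matrix.smul_apply, Matrix.one_apply, smul_eq_mul]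
  have : (r = ⟨t, htm⟩) ↔ j = k := by
    rw [Fin.ext_iff]; simp only; omega
  by_cases hjk : j = k
  · rw [if_pos (this.2 hjk), if_pos hjk, mul_one]
  · rw [if_neg (fun hc => hjk (this.1 hc)), if_neg hjk, mul_zero]

lemma key_T (m : ℕ) (ε y : Fin m → ℝ → ℝ) (x : ℝ) (β : ℕ → ℝ)
    (hβ : ∀ h, ∑ j ∈ Finset.range (m + 1),
      (-1 : ℝ) ^ j * β j * (xiP (ε h) (x - j) (m - j) * y h (x - j)) = 0)
    (k : ℕ) (hkm : k ≤ m) (r : Fin m) :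
    ∑ j ∈ Finset.range k, (-1 : ℝ) ^ j * β j *
      ∑ h, (casM m ε y (x - k + (r + 1))).adjugate r h *
        (y h (x - j) * xiP (ε h) (x - j) (m + k - (r + 1) - j)) =
    if (r : ℕ) + 1 ≤ k then - ((-1) ^ k * β k * (casM m ε y (x - k + (r + 1))).det) else 0 := by
  split_ifs with hr
  · have hz : ∑ j ∈ Finset.range (m + 1), (-1 : ℝ) ^ j * β j *
      ∑ h, (casM m ε y (x - k + (r + 1))).adjugate r h *
        (y h (x - j) * xiP (ε h) (x - j) (m + k - (r + 1) - j)) = 0 := by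
      simp only [Finset.mul_sum]
      rw [Finset.sum_comm]
      apply Finset.sum_eq_zero
      intro h _
      have := congrArg (fun z => (casM m ε y (x - k + (r + 1))).adjugate r h *
        xiP (ε h) (x - m) (k - (r + 1)) * z) (hβ h)
      simp only [mul_zero, Finset.mul_sum] at this
      rw [← this]
      apply Finset.sum_congr rfl
      intro j hj
      have hj' : j ≤ m := by simpa [Nat.lt_succ_iff] using hj
      have e : m + k - (r + 1) - j = (m - j) + (k - (r + 1)) := by omega
      rw [e, xiP_add]
      have : x - (j : ℝ) - ((m - j : ℕ) : ℝ) = x - m := by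
        rw [Nat.cast_sub hj']; ring
      rw [this]; ring
    rw [← Finset.sum_range_add_sum_Ico _ (show k ≤ m + 1 by omega)] at hz
    rw [Finset.sum_eq_single_of_mem (s := Finset.Ico k (m + 1)) k
      (by simp; omega)] at hz
    · rw [key_F m ε y x k r k (by omega) (by omega), if_pos rfl] at hz
      linarith
    · intro j hj hne
      rw [Finset.mem_Ico] at hj
      rw [key_F m ε y x k r j (by omega) (by omega), if_neg hne, mul_zero]
  · apply Finset.sum_eq_zero
    intro j hj
    rw [Finset.mem_range] at hj
    rw [key_F m ε y x k r j (by omega) (by omega), if_neg (by omega), mul_zero]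

lemma key (m : ℕ) (ε y : Fin m → ℝ → ℝ) (x : ℝ) (β : ℕ → ℝ)
    (hβ : ∀ h, ∑ j ∈ Finset.range (m + 1),
      (-1 : ℝ) ^ j * β j * (xiP (ε h) (x - j) (m - j) * y h (x - j)) = 0)
    (S lam : ℝ → ℝ) (M : Fin m → ℝ → ℝ)
    (hM : ∀ h x, M h x = ∑ j : Fin m, xiP (ε h) x (m - (j + 1)) * S (x + (j + 1)) *
      (casM m ε y (x + (j + 1))).adjugate j h)
    (hlam : ∀ x, lam x - lam (x - 1) = S x * (casM m ε y x).det) (k : ℕ) :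
    ∑ j ∈ Finset.range (m + 1), (if j < k then
      β j * ∑ h, (-1 : ℝ) ^ (k - j + 1) * y h (x - j) * M h (x - k) * xiP (ε h) (x - j) (k - j)
      else 0) = if k ≤ m then (lam x - lam (x - k)) * β k else 0 := by
  have hsgn : ∀ j, j ≤ k → (-1 : ℝ) ^ (k - j + 1) = - ((-1) ^ k * (-1) ^ j) := by
    intro j hj
    obtain ⟨d, rfl⟩ := Nat.exists_eq_add_of_le hj
    have : ((-1 : ℝ) ^ j) * (-1) ^ j = 1 := by rw [← mul_pow]; simp
    rw [Nat.add_sub_cancel_left, pow_succ, pow_add]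
    linear_combination (-(-1 : ℝ) ^ d) * (-this)
  split_ifs with hkm
  · have hs : (Finset.range (m + 1)).filter (fun j => j < k) = Finset.range k := by
      ext j; simp; omega
    rw [← Finset.sum_filter, hs]
    have step : ∑ j ∈ Finset.range k, β j * ∑ h, (-1 : ℝ) ^ (k - j + 1) * y h (x - j) *
          M h (x - k) * xiP (ε h) (x - j) (k - j) =
        ∑ r : Fin m, (-(-1 : ℝ) ^ k * S (x - k + (r + 1))) *
          ∑ j ∈ Finset.range k, (-1 : ℝ) ^ j * β j *
      ∑ h, (casM m ε y (x - k + (r + 1))).adjugate r h *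
        (y h (x - j) * xiP (ε h) (x - j) (m + k - (r + 1) - j)) := by
      simp only [hM, Finset.mul_sum, Finset.sum_mul]
      rw [Finset.sum_comm (s := (Finset.univ : Finset (Fin m))) (t := Finset.range k)]
      apply Finset.sum_congr rfl
      intro j hj
      rw [Finset.mem_range] at hj
      rw [Finset.sum_comm]
      apply Finset.sum_congr rfl
      intro r _
      apply Finset.sum_congr rfl
      intro h _
      have e : m + k - (r + 1) - j = (k - j) + (m - (r + 1)) := by omega
      rw [e, xiP_add, hsgn j hj.le]
      have : x - (j : ℝ) - ((k - j : ℕ) : ℝ) = x - k := by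
        rw [Nat.cast_sub hj.le]; ring
      rw [this]; ring
    rw [step]
    simp only [key_T m ε y x β hβ k hkm]
    have tel : lam x - lam (x - k) = ∑ r ∈ Finset.range k, S (x - k + (r + 1)) *
        (casM m ε y (x - k + (r + 1))).det := by
      have := Finset.sum_range_sub (fun r : ℕ => lam (x - k + r)) k
      simp only [sub_add_cancel, Nat.cast_zero, add_zero] at this
      rw [← this]
      apply Finset.sum_congr rfl
      intro r _
      rw [← hlam]
      push_cast
      congr 2
      ring
    rw [tel, ← hs.symm.symm, Finset.sum_mul]
    rw [Finset.sum_congr rfl (g := fun r : Fin m => (fun r : ℕ => if r + 1 ≤ k then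
      S (x - k + (r + 1)) * (casM m ε y (x - k + (r + 1))).det * β k else 0) (r : ℕ))]
    · rw [← Finset.sum_range (fun r : ℕ => if r + 1 ≤ k then
        S (x - k + (r + 1)) * (casM m ε y (x - k + (r + 1))).det * β k else 0),
        ← Finset.sum_filter]
      apply Finset.sum_congr
      · ext j; simp; omega
      · intros; rfl
    · intro r _
      simp only
      split_ifs
      · have : ((-1 : ℝ) ^ k) * (-1) ^ k = 1 := by rw [← mul_pow]; simp
        linear_combination (S (x - k + (r + 1)) * β k * (casM m ε y (x - k + (r + 1))).det) * this
      · simp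
  · have : ∀ j ∈ Finset.range (m + 1), (if j < k then
      β j * ∑ h, (-1 : ℝ) ^ (k - j + 1) * y h (x - j) * M h (x - k) * xiP (ε h) (x - j) (k - j)
      else 0) = ∑ h, (-(-1 : ℝ) ^ k * M h (x - k) * xiP (ε h) (x - m) (k - m)) *
        ((-1 : ℝ) ^ j * β j * (xiP (ε h) (x - j) (m - j) * y h (x - j))) := by
      intro j hj
      have hj' : j ≤ m := by simpa [Nat.lt_succ_iff] using hj
      rw [if_pos (by omega), Finset.mul_sum]
      apply Finset.sum_congr rfl
      intro h _
      have e : k - j = (m - j) + (k - m) := by omega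
      rw [hsgn j (by omega), e, xiP_add]
      have : x - (j : ℝ) - ((m - j : ℕ) : ℝ) = x - m := by
        rw [Nat.cast_sub hj']; ring
      rw [this]; ring
    rw [Finset.sum_congr rfl this, Finset.sum_comm]
    apply Finset.sum_eq_zero
    intro h _
    rw [← Finset.mul_sum, hβ, mul_zero]

lemma sum_Icc_fin {M : Type*} [AddCommMonoid M] (m : ℕ) (f : ℕ → M) :
    ∑ h ∈ Finset.Icc 1 m, f h = ∑ h : Fin m, f ((h : ℕ) + 1) := by
  rw [← Finset.sum_range (fun h => f (h + 1)), Finset.range_eq_Ico, Finset.sum_Ico_add' f 0 m 1]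
  apply Finset.sum_congr _ (fun _ _ => rfl)
  ext; simp

lemma skipIdx_eq {m : ℕ} (h : Fin (m + 1)) (l : Fin m) :
    skipIdx ((h : ℕ) + 1) (l : ℕ) = ((h.succAbove l : Fin (m + 1)) : ℕ) + 1 := by
  unfold skipIdx Fin.succAbove
  simp only [Fin.lt_def, Fin.val_castSucc]
  split_ifs <;> first | omega | simp

lemma aeval_eig (Dp : Module.End ℝ (Polynomial ℝ)) (v : Polynomial ℝ) (c : ℝ)
    (h : Dp v = c • v) (P : Polynomial ℝ) : (Polynomial.aeval Dp P) v = P.eval c • v := by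
  induction P using Polynomial.induction_on' with
  | add a b ha hb => simp [ha, hb, add_smul]
  | monomial n a =>
    have : ∀ n : ℕ, (Dp ^ n) v = c ^ n • v := by
      intro n
      induction n with
      | zero => simp
      | succ n ih => rw [pow_succ', Module.End.mul_apply, ih, map_smul, h, smul_smul, pow_succ]
    simp [Polynomial.aeval_monomial, this, smul_smul, Algebra.algebraMap_eq_smul_one]

lemma minors (m : ℕ) (a : Fin m → Fin (m + 1) → ℝ) :
    ∃ β : ℕ → ℝ, (∀ h, ∑ j : Fin (m + 1), (-1 : ℝ) ^ (j : ℕ) * β j * a h j = 0) ∧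
      ∀ v : Fin (m + 1) → Polynomial ℝ,
        Matrix.det (Matrix.of (Fin.cons (fun j => ((-1 : ℝ) ^ (j : ℕ)) • v j)
          (fun h j => Polynomial.C (a h j)) : Fin (m + 1) → Fin (m + 1) → Polynomial ℝ)) =
        ∑ j : Fin (m + 1), β j • v j := by
  refine ⟨fun j => if hj : j < m + 1 then
    Matrix.det (Matrix.of fun h k : Fin m => a h ((⟨j, hj⟩ : Fin (m + 1)).succAbove k)) else 0,
    ?_, ?_⟩
  · intro h
    have := Matrix.det_zero_of_row_eq (M := (Matrix.of (Fin.cons (a h) a :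
      Fin (m + 1) → Fin (m + 1) → ℝ))) (i := 0) (j := h.succ) (Fin.succ_ne_zero h).symm (by
        ext j; simp)
    rw [Matrix.det_succ_row_zero] at this
    rw [← this]
    apply Finset.sum_congr rfl
    intro j _
    simp only [Fin.is_lt, dif_pos]
    simp only [Fin.eta, Matrix.of_apply, Fin.cons_zero]
    have : (Matrix.of (Fin.cons (a h) a : Fin (m + 1) → Fin (m + 1) → ℝ)).submatrix
        Fin.succ j.succAbove = Matrix.of fun h k : Fin m => a h (j.succAbove k) := by
      ext; simp
    rw [this]; ring
  · intro v
    rw [Matrix.det_succ_row_zero]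
    apply Finset.sum_congr rfl
    intro j _
    simp only [Fin.is_lt, dif_pos]
    simp only [Fin.eta, Matrix.of_apply, Fin.cons_zero]
    have : (Matrix.of (Fin.cons (fun j => ((-1 : ℝ) ^ (j : ℕ)) • v j)
          (fun h j => Polynomial.C (a h j)) : Fin (m + 1) → Fin (m + 1) → Polynomial ℝ)).submatrix
        Fin.succ j.succAbove =
        (Polynomial.C : ℝ →+* Polynomial ℝ).mapMatrix
          (Matrix.of fun h k : Fin m => a h (j.succAbove k)) := by
      ext; simp
    rw [this, ← RingHom.map_det]
    rw [Polynomial.smul_eq_C_mul, Polynomial.smul_eq_C_mul]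
    have h1 : ((-1 : Polynomial ℝ) ^ (j : ℕ)) * Polynomial.C ((-1 : ℝ) ^ (j : ℕ)) = 1 := by
      simp [← mul_pow]
    linear_combination (Polynomial.C (Matrix.of fun h k : Fin m => a h (j.succAbove k)).det * v j) * h1

/-- **Theorem 3.1 (Teor1).** The `D`-operator machinery: the Casorati-determinant
polynomials `q_n` are eigenfunctions of the operator
`D_{q,S} = (1/2) P_S(D_p) + Σ_h M̃_h(D_p) ∘ D_h ∘ Y_h(D_p)`, which lies in `A`. -/
theorem Doperator_eigenfunctions
    (p : ℕ → Polynomial ℝ) (hpdeg : ∀ n : ℕ, (p n).degree = (n : ℕ))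
    (A : Subalgebra ℝ (Module.End ℝ (Polynomial ℝ)))
    (Dp : Module.End ℝ (Polynomial ℝ)) (hDp : Dp ∈ A)
    (θ : ℝ → ℝ) (hθ : IsRatFunc θ)
    (hDpp : ∀ n : ℕ, Dp (p n) = θ (n : ℝ) • p n)
    (m : ℕ) (hm : 1 ≤ m)
    (ε σ : ℕ → ℝ → ℝ)
    (hε : ∀ h ∈ Finset.Icc 1 m, IsRatFunc (ε h))
    (hσ : ∀ h ∈ Finset.Icc 1 m, IsRatFunc (σ h))
    (D : ℕ → Module.End ℝ (Polynomial ℝ))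
    (hDA : ∀ h ∈ Finset.Icc 1 m, D h ∈ A)
    (hD : ∀ h ∈ Finset.Icc 1 m, ∀ n : ℕ,
      D h (p n) = (-(1 / 2) * σ h ((n : ℝ) + 1)) • p n +
        ∑ j ∈ Finset.Icc 1 n,
          ((-1 : ℝ) ^ (j + 1) * σ h ((n : ℝ) - (j : ℝ) + 1) *
              ∏ t ∈ Finset.range j, ε h ((n : ℝ) - (t : ℝ))) • p (n - j))
    (Y : ℕ → Polynomial ℝ)
    -- the auxiliary functions `ξ^h_{x,i}`, the Casorati determinant `Ω` and `M_h`
    (ξ : ℕ → ℝ → ℕ → ℝ) (hξ : ∀ h x i, ξ h x i = ∏ t ∈ Finset.range i, ε h (x - (t : ℝ)))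
    (Ω : ℝ → ℝ)
    (hΩdef : ∀ x : ℝ, Ω x = Matrix.det (Matrix.of fun l j : Fin m =>
      ξ ((l : ℕ) + 1) (x - ((j : ℕ) + 1)) (m - ((j : ℕ) + 1)) *
        (Y ((l : ℕ) + 1)).eval (θ (x - ((j : ℕ) + 1)))))
    (hΩ : ∀ n : ℕ, Ω (n : ℝ) ≠ 0)
    (S : ℝ → ℝ) (hS : IsRatFunc S)
    (Mf : ℕ → ℝ → ℝ)
    (hMf : ∀ h ∈ Finset.Icc 1 m, ∀ x : ℝ,
      Mf h x = ∑ j ∈ Finset.Icc 1 m,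
        (-1 : ℝ) ^ (h + j) * ξ h x (m - j) * S (x + (j : ℝ)) *
          Matrix.det (Matrix.of fun l r : Fin (m - 1) =>
            ξ (skipIdx h (l : ℕ)) (x + (j : ℝ) - (skipIdx j (r : ℕ) : ℝ))
                (m - skipIdx j (r : ℕ)) *
              (Y (skipIdx h (l : ℕ))).eval (θ (x + (j : ℝ) - (skipIdx j (r : ℕ) : ℝ)))))
    -- assumption (ass0): `S(x)Ω(x)` is a polynomial in `x`
    (hass0 : ∃ P : Polynomial ℝ, ∀ x : ℝ, S x * Ω x = P.eval x)
    -- assumption (ass1): polynomials `M̃_h` with `M_h(x) = σ^h(x+1) M̃_h(θ(x))`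
    (Mt : ℕ → Polynomial ℝ)
    (hass1 : ∀ h ∈ Finset.Icc 1 m, ∀ x : ℝ, Mf h x = σ h (x + 1) * (Mt h).eval (θ x))
    -- assumption (ass2): polynomials `λ` and `P_S`
    (lam PS : Polynomial ℝ)
    (hlam : ∀ x : ℝ, lam.eval x - lam.eval (x - 1) = S x * Ω x)
    (hass2 : ∀ x : ℝ,
      PS.eval (θ x) = 2 * lam.eval x + ∑ h ∈ Finset.Icc 1 m, (Y h).eval (θ x) * Mf h x) :
    -- the polynomials `q_n` (with `p_k = 0` for `k < 0`)
    let pz : ℤ → Polynomial ℝ := fun k => if k < 0 then 0 else p k.toNat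
    let q : ℕ → Polynomial ℝ := fun n =>
      Matrix.det (Matrix.of fun i j : Fin (m + 1) =>
        if (i : ℕ) = 0 then ((-1 : ℝ) ^ (j : ℕ)) • pz ((n : ℤ) - (j : ℤ))
        else Polynomial.C (ξ (i : ℕ) ((n : ℝ) - (j : ℝ)) (m - (j : ℕ)) *
          (Y (i : ℕ)).eval (θ ((n : ℝ) - (j : ℝ)))))
    let Dq : Module.End ℝ (Polynomial ℝ) :=
      (1 / 2 : ℝ) • (Polynomial.aeval Dp PS) +
        ∑ h ∈ Finset.Icc 1 m,
          (Polynomial.aeval Dp (Mt h)) * D h * (Polynomial.aeval Dp (Y h))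
    Dq ∈ A ∧ ∀ n : ℕ, Dq (q n) = lam.eval (n : ℝ) • q n := by
  intro pz q Dq
  refine ⟨?_, ?_⟩
  · have hae : ∀ P : Polynomial ℝ, Polynomial.aeval Dp P ∈ A := fun P =>
      Algebra.adjoin_le (by simpa using hDp) (Polynomial.aeval_mem_adjoin_singleton ℝ Dp (p := P))
    exact A.add_mem (A.smul_mem (hae _) _) (A.sum_mem fun h hh =>
      A.mul_mem (A.mul_mem (hae _) (hDA h hh)) (hae _))
  intro n
  have hξ' : ∀ h x i, ξ h x i = xiP (ε h) x i := hξ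
  -- action on the basis
  have hDqp : ∀ N : ℕ, Dq (p N) = lam.eval (N : ℝ) • p N +
      ∑ i ∈ Finset.Icc 1 N, (∑ h ∈ Finset.Icc 1 m, (-1 : ℝ) ^ (i + 1) *
        (Y h).eval (θ N) * Mf h ((N : ℝ) - i) * ξ h N i) • p (N - i) := by
    intro N
    have hterm : ∀ h ∈ Finset.Icc 1 m,
        ((Polynomial.aeval Dp (Mt h)) * D h * (Polynomial.aeval Dp (Y h))) (p N) =
        (-(1 / 2) * ((Y h).eval (θ N) * Mf h N)) • p N +
        ∑ i ∈ Finset.Icc 1 N, ((-1 : ℝ) ^ (i + 1) *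
        (Y h).eval (θ N) * Mf h ((N : ℝ) - i) * ξ h N i) • p (N - i) := by
      intro h hh
      rw [Module.End.mul_apply, Module.End.mul_apply, aeval_eig Dp _ _ (hDpp N), map_smul,
        map_smul, hD h hh, map_add, map_smul, aeval_eig Dp _ _ (hDpp N), map_sum, smul_add,
        smul_smul, smul_smul, Finset.smul_sum]
      congr 1
      · rw [hass1 h hh]; congr 1; ring
      · apply Finset.sum_congr rfl
        intro i hi
        rw [Finset.mem_Icc] at hi
        rw [map_smul, aeval_eig Dp _ _ (hDpp (N - i)), smul_smul, smul_smul, hass1 h hh,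
          Nat.cast_sub hi.2, hξ]
        congr 1; ring
    simp only [Dq, LinearMap.add_apply, LinearMap.smul_apply, LinearMap.sum_apply]
    rw [Finset.sum_congr rfl hterm, Finset.sum_add_distrib, aeval_eig Dp _ _ (hDpp N), hass2,
      ← Finset.sum_smul, Finset.sum_comm, ← add_assoc, smul_smul, ← add_smul, ← Finset.mul_sum]
    simp only [← Finset.sum_smul]
    congr 2
    ring
  have hDqz : ∀ j : ℕ, Dq (pz ((n : ℤ) - j)) = lam.eval ((n : ℝ) - j) • pz ((n : ℤ) - j) +
      ∑ k ∈ Finset.range (n + 1), (if j < k then ∑ h ∈ Finset.Icc 1 m, (-1 : ℝ) ^ (k - j + 1) *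
        (Y h).eval (θ ((n : ℝ) - j)) * Mf h ((n : ℝ) - k) * ξ h ((n : ℝ) - j) (k - j) else 0) •
          p (n - k) := by
    intro j
    by_cases hj : n < j
    · have : pz ((n : ℤ) - j) = 0 := by
        simp only [pz]; rw [if_pos (by omega)]
      rw [this, map_zero, smul_zero, zero_add]
      symm
      apply Finset.sum_eq_zero
      intro k hk
      rw [Finset.mem_range] at hk
      rw [if_neg (by omega), zero_smul]
    · push Not at hj
      have : pz ((n : ℤ) - j) = p (n - j) := by
        simp only [pz]; rw [if_neg (by omega)]; congr 1; omega
      rw [this, hDqp, Nat.cast_sub hj]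
      congr 1
      simp only [ite_smul, zero_smul]
      rw [← Finset.sum_filter]
      apply Finset.sum_nbij' (fun i => i + j) (fun k => k - j)
      · intro i hi; simp at hi ⊢; omega
      · intro i hi; simp at hi ⊢; omega
      · intro i hi; simp
      · intro i hi; simp at hi ⊢; omega
      · intro i hi
        rw [Finset.mem_Icc] at hi
        have e1 : n - j - i = n - (i + j) := by omega
        have e2 : (n : ℝ) - j - i = n - ((i + j : ℕ) : ℝ) := by push_cast; ring
        rw [e1, e2, Nat.add_sub_cancel]
  obtain ⟨m', rfl⟩ : ∃ m', m = m' + 1 := ⟨m - 1, by omega⟩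
  set m := m' + 1 with hmdef
  let ε' : Fin m → ℝ → ℝ := fun h => ε ((h : ℕ) + 1)
  let y' : Fin m → ℝ → ℝ := fun h x => (Y ((h : ℕ) + 1)).eval (θ x)
  obtain ⟨β, hβ0, hβ⟩ := minors m (fun h j => xiP (ε' h) ((n : ℝ) - (j : ℕ)) (m - (j : ℕ)) *
    y' h ((n : ℝ) - (j : ℕ)))
  have hq : q n = ∑ j ∈ Finset.range (m + 1), β j • pz ((n : ℤ) - j) := by
    rw [Finset.sum_range (fun j : ℕ => β j • pz ((n : ℤ) - j)), ← hβ]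
    simp only [q]
    congr 1
    ext1 i j
    refine Fin.cases ?_ (fun i => ?_) i
    · simp
    · simp only [Matrix.of_apply, Fin.cons_succ, Fin.val_succ, hξ']
      rw [if_neg (by omega)]
  have hMk : ∀ (h : Fin m) (x : ℝ), Mf ((h : ℕ) + 1) x =
      ∑ j : Fin m, xiP (ε' h) x (m - (j + 1)) * S (x + (j + 1)) *
      (casM m ε' y' (x + (j + 1))).adjugate j h := by
    intro h x
    rw [hMf _ (by simp), sum_Icc_fin]
    apply Finset.sum_congr rfl
    intro j _
    rw [Matrix.adjugate_fin_succ_eq_det_submatrix]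
    have e : (casM m ε' y' (x + (j + 1))).submatrix h.succAbove j.succAbove =
        Matrix.of fun l r : Fin (m - 1) =>
            ξ (skipIdx (h + 1) (l : ℕ)) (x + ((j + 1 : ℕ) : ℝ) - (skipIdx (j + 1) (r : ℕ) : ℝ))
                (m - skipIdx (j + 1) (r : ℕ)) *
              (Y (skipIdx (h + 1) (l : ℕ))).eval
                (θ (x + ((j + 1 : ℕ) : ℝ) - (skipIdx (j + 1) (r : ℕ) : ℝ))) := by
      ext l r
      have e1 := skipIdx_eq h l
      have e2 := skipIdx_eq j r
      simp only [Matrix.submatrix_apply, Matrix.of_apply, casM, hξ']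
      rw [e1, e2]
      simp only [ε', y']
      push_cast
      rfl
    rw [e, hξ']
    have e3 : (-1 : ℝ) ^ ((h : ℕ) + 1 + (j + 1)) = (-1) ^ ((h : ℕ) + j) := by
      rw [show (h : ℕ) + 1 + (j + 1) = (h + j) + 2 by ring, pow_add]; simp
    rw [e3]
    push_cast
    ring
  have hΩk : ∀ x, Ω x = (casM m ε' y' x).det := by
    intro x
    rw [hΩdef]
    simp only [casM, hξ', ε', y']
  have hkey := key m ε' y' n β (by
    intro h
    have := hβ0 h
    rwa [← Finset.sum_range (fun j : ℕ => (-1 : ℝ) ^ j * β j *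
      (xiP (ε' h) ((n : ℝ) - j) (m - j) * y' h ((n : ℝ) - j)))] at this)
    S (fun x => lam.eval x) (fun h x => Mf ((h : ℕ) + 1) x) hMk
    (fun x => by rw [← hΩk]; exact hlam x)
  have hz : ∀ k, k ∈ Finset.range (n + 1) → p (n - k) = pz ((n : ℤ) - k) := by
    intro k hk
    rw [Finset.mem_range] at hk
    simp only [pz]; rw [if_neg (by omega)]; congr 1; omega
  have hz0 : ∀ k, n < k → pz ((n : ℤ) - k) = 0 := by
    intro k hk
    simp only [pz]; rw [if_pos (by omega)]
  have hsecond : ∑ j ∈ Finset.range (m + 1), β j •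
      ∑ k ∈ Finset.range (n + 1), (if j < k then ∑ h ∈ Finset.Icc 1 m, (-1 : ℝ) ^ (k - j + 1) *
        (Y h).eval (θ ((n : ℝ) - j)) * Mf h ((n : ℝ) - k) * ξ h ((n : ℝ) - j) (k - j) else 0) •
          p (n - k) =
      ∑ k ∈ Finset.range (m + 1),
        ((lam.eval (n : ℝ) - lam.eval ((n : ℝ) - k)) * β k) • pz ((n : ℤ) - k) := by
    simp only [Finset.smul_sum, smul_smul]
    rw [Finset.sum_comm]
    have : ∀ k ∈ Finset.range (n + 1), ∑ j ∈ Finset.range (m + 1), (β j *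
        (if j < k then ∑ h ∈ Finset.Icc 1 m, (-1 : ℝ) ^ (k - j + 1) *
        (Y h).eval (θ ((n : ℝ) - j)) * Mf h ((n : ℝ) - k) * ξ h ((n : ℝ) - j) (k - j) else 0)) •
          p (n - k) = if k ≤ m then
          ((lam.eval (n : ℝ) - lam.eval ((n : ℝ) - k)) * β k) • pz ((n : ℤ) - k) else 0 := by
      intro k hk
      rw [← Finset.sum_smul, hz k hk]
      have h2 := hkey k
      rw [← ite_zero_smul, ← h2]
      congr 1
      apply Finset.sum_congr rfl
      intro j _
      rw [mul_ite, mul_zero, sum_Icc_fin]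
      simp only [hξ', ε', y']
    rw [Finset.sum_congr rfl this, ← Finset.sum_filter]
    apply Finset.sum_subset
    · intro k hk; simp at hk ⊢; omega
    · intro k hk hk'
      simp at hk hk'
      rw [hz0 k (by omega), smul_zero]
  rw [hq, map_sum]
  simp only [map_smul, hDqz, smul_add]
  rw [Finset.sum_add_distrib, hsecond, ← Finset.sum_add_distrib, Finset.smul_sum]
  apply Finset.sum_congr rfl
  intro k _
  rw [smul_smul, smul_smul, ← add_smul]
  congr 1
  ring
end

section
/- Let α, β be real numbers and m1, m2 ≥ 0 integers with m = m1+m2 ≥ 1, and let Y_1, …, Y_m be arbitrary real polynomials. Let Ξ be a real polynomial satisfying Ξ(−(x+α+β−m)) = Ξ(x), and define the rational function S(x) = σ_{x−(m−1)/2}·Ξ(x)·((x−m+β+1)_{m−1})^{m1} / ( p(x) q(x) ), the function Ω(x) = det( ξ^{l}_{x−j, m−j} Y_l(θ_{x−j}) )_{l,j=1}^{m}, and, for h = 1,…,m, M_h(x) = Σ_{j=1}^{m} (−1)^{h+j} ξ^{h}_{x, m−j} S(x+j) det( ξ^{l}_{x+j−r, m−r} Y_l(θ_{x+j−r}) )_{l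 ∈ {1,…,m}∖{h}, r ∈ {1,…,m}∖{j}}. Then: (i) S(x)Ω(x) is a polynomial in x; (ii) for each h = 1,…,m there exists a real polynomial M̃_h with M_h(x) = σ^h_{x+1}·M̃_h(θ_x) for all x, where σ^h_x = σ_x for h = 1,…,m1 and σ^h_x = −σ_x for h = m1+1,…,m; (iii) for any polynomial λ satisfying λ(x) − λ(x−1) = S(x)Ω(x) (such λ exists by (i)), there exists a real polynomial P_S with P_S(θ_x) = 2λ(x) + Σ_{h=1}^{m} Y_h(θ_x) M_h(x) for all x. -/
open Polynomial Filter

/-- Pochhammer symbol `(a)_k = a (a+1) ⋯ (a+k-1)`. -/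
noncomputable def poch (a : ℝ) (k : ℕ) : ℝ := ∏ i ∈ Finset.range k, (a + i)

namespace JacobiDop

variable (m1 m2 : ℕ) (α β : ℝ)

/-- Eigenvalues `θ_x = x(x+α+β+1)` of the Jacobi operator. -/
noncomputable def θf (x : ℝ) : ℝ := x * (x + α + β + 1)

/-- `σ_x = 2x+α+β-1`. -/
noncomputable def σf (x : ℝ) : ℝ := 2 * x + α + β - 1

/-- `ξ^h_{x,j}` for the two Jacobi `D`-operators. -/
noncomputable def ξf (h : ℕ) (x : ℝ) (j : ℕ) : ℝ :=
  if h ≤ m1 then (-1 : ℝ) ^ j * poch (x - j + α + 1) j / poch (x - j + β + 1) j else 1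

/-- The polynomial `p(x)` of the paper. -/
noncomputable def pfun (x : ℝ) : ℝ :=
  ∏ i ∈ Finset.Icc 1 (m1 - 1),
    (-1 : ℝ) ^ (m1 - i) * poch (x + α - ((m1 + m2 : ℕ) : ℝ) + 1) (m1 - i) *
      poch (x + β - (m1 : ℝ) + (i : ℝ)) (m1 - i)

/-- The polynomial `q(x)` of the paper. -/
noncomputable def qfun (x : ℝ) : ℝ :=
  (-1 : ℝ) ^ ((m1 + m2) * (m1 + m2 - 1) / 2) *
    ∏ h ∈ Finset.Icc 1 (m1 + m2 - 1), ∏ i ∈ Finset.Icc 1 h,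
      (2 * (x - ((m1 + m2 : ℕ) : ℝ)) + α + β + (i : ℝ) + (h : ℝ))

/-- The rational function `S` built from an invariant polynomial `Ξ`. -/
noncomputable def Sfun (Ξ : Polynomial ℝ) (x : ℝ) : ℝ :=
  σf α β (x - (((m1 + m2 : ℕ) : ℝ) - 1) / 2) * Ξ.eval x *
      (poch (x - ((m1 + m2 : ℕ) : ℝ) + β + 1) (m1 + m2 - 1)) ^ m1 /
    (pfun m1 m2 α β x * qfun m1 m2 α β x)

/-- The Casorati determinant `Ω(x)` built from polynomials `Y_1, …, Y_m`. -/
noncomputable def Ωf (Y : ℕ → Polynomial ℝ) (x : ℝ) : ℝ :=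
  Matrix.det (Matrix.of fun l j : Fin (m1 + m2) =>
    ξf m1 α β ((l : ℕ) + 1) (x - ((j : ℕ) + 1)) ((m1 + m2) - ((j : ℕ) + 1)) *
      (Y ((l : ℕ) + 1)).eval (θf α β (x - ((j : ℕ) + 1))))

/-- The functions `M_h(x)`. -/
noncomputable def Mfun (Y : ℕ → Polynomial ℝ) (Ξ : Polynomial ℝ) (h : ℕ) (x : ℝ) : ℝ :=
  ∑ j ∈ Finset.Icc 1 (m1 + m2),
    (-1 : ℝ) ^ (h + j) * ξf m1 α β h x ((m1 + m2) - j) * Sfun m1 m2 α β Ξ (x + (j : ℝ)) *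
      Matrix.det (Matrix.of fun l r : Fin (m1 + m2 - 1) =>
        ξf m1 α β (skipIdx h (l : ℕ)) (x + (j : ℝ) - (skipIdx j (r : ℕ) : ℝ))
            ((m1 + m2) - skipIdx j (r : ℕ)) *
          (Y (skipIdx h (l : ℕ))).eval (θf α β (x + (j : ℝ) - (skipIdx j (r : ℕ) : ℝ))))

end JacobiDop

open JacobiDop

namespace JD

section generic
variable {R : Type*} [CommRing R]

/-- rising product `(a-m+1)_n` -/
def apr (m : ℕ) (a : R) (n : ℕ) : R := ∏ i ∈ Finset.range n, (a - (m : R) + 1 + (i : R))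
/-- falling product `(b-1)(b-2)...(b-n)` -/
def bpr (b : R) (n : ℕ) : R := ∏ i ∈ Finset.range n, (b - 1 - (i : R))
/-- weights -/
def wt (m : ℕ) (a b : R) (c : ℕ) : R := (-1) ^ (m - 1 - c) * apr m a (m - 1 - c) * bpr b c
/-- normalised `p` -/
def pp (m m1 : ℕ) (a b : R) : R := ∏ k ∈ Finset.range m1, (apr m a k * bpr b k)
/-- weighted matrix -/
def WM (m m1 : ℕ) (a b : R) (Z : Matrix (Fin m) (Fin m) R) : Matrix (Fin m) (Fin m) R :=
  Matrix.of fun l c => (if (l : ℕ) < m1 then wt m a b c else 1) * Z l c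

lemma apr_map {S : Type*} [CommRing S] (f : R →+* S) (m : ℕ) (a : R) (n : ℕ) :
    f (apr m a n) = apr m (f a) n := by simp [apr, map_prod]
lemma bpr_map {S : Type*} [CommRing S] (f : R →+* S) (a : R) (n : ℕ) :
    f (bpr a n) = bpr (f a) n := by simp [bpr, map_prod]
lemma wt_map {S : Type*} [CommRing S] (f : R →+* S) (m : ℕ) (a b : R) (n : ℕ) :
    f (wt m a b n) = wt m (f a) (f b) n := by simp [wt, apr_map, bpr_map]
lemma pp_map {S : Type*} [CommRing S] (f : R →+* S) (m m1 : ℕ) (a b : R) :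
    f (pp m m1 a b) = pp m m1 (f a) (f b) := by simp [pp, apr_map, bpr_map, map_prod]
lemma WM_det_map {S : Type*} [CommRing S] (f : R →+* S) (m m1 : ℕ) (a b : R)
    (Z : Matrix (Fin m) (Fin m) R) :
    f ((WM m m1 a b Z).det) = (WM m m1 (f a) (f b) (Z.map f)).det := by
  rw [RingHom.map_det]
  congr 1
  ext l c
  simp only [WM, RingHom.mapMatrix_apply, Matrix.map_apply, Matrix.of_apply, map_mul]
  split_ifs <;> simp [wt_map]

lemma chain_dvd (F : ℕ → R) (hF : ∀ i j, i ≤ j → F i ∣ F j) (S : Finset ℕ) :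
    ∏ k ∈ Finset.range S.card, F k ∣ ∏ k ∈ S, F k := by
  induction S using Finset.induction_on_max with
  | empty => simp
  | insert a s hs ih =>
    have ha : a ∉ s := fun h => lt_irrefl _ (hs a h)
    rw [Finset.card_insert_of_notMem ha, Finset.prod_range_succ, Finset.prod_insert ha, mul_comm]
    refine mul_dvd_mul (hF _ _ ?_) ih
    have : s ⊆ Finset.range a := fun x hx => Finset.mem_range.2 (hs x hx)
    simpa using Finset.card_le_card this

lemma prod_range_dvd (f : ℕ → R) (i j : ℕ) (h : i ≤ j) :
    ∏ k ∈ Finset.range i, f k ∣ ∏ k ∈ Finset.range j, f k :=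
  Finset.prod_dvd_prod_of_subset _ _ _ (Finset.range_mono h)

lemma pp_dvd (m m1 : ℕ) (h1 : m1 ≤ m) (a b : R) (Z : Matrix (Fin m) (Fin m) R) :
    pp m m1 a b ∣ (WM m m1 a b Z).det := by
  rw [Matrix.det_apply']
  refine Finset.dvd_sum fun σ _ => Dvd.dvd.mul_left ?_ _
  simp only [WM, Matrix.of_apply]
  rw [Finset.prod_mul_distrib]
  refine Dvd.dvd.mul_right ?_ _
  rw [← Finset.prod_filter]
  set T : Finset (Fin m) := Finset.univ.filter fun i => ((σ i : Fin m) : ℕ) < m1 with hT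
  have hc : T.card = m1 := by
    have : T = (Finset.univ.filter fun i : Fin m => (i : ℕ) < m1).map σ.symm.toEmbedding := by
      ext i
      simp [hT]
    rw [this, Finset.card_map]
    have := Fin.card_filter_val_lt (n := m) (m := m1)
    simpa [h1] using this
  have e1 : ∏ i ∈ T, wt m a b (i : ℕ) = (∏ i ∈ T, (-1) ^ (m - 1 - (i : ℕ))) *
      ((∏ i ∈ T, apr m a (m - 1 - (i : ℕ))) * ∏ i ∈ T, bpr b (i : ℕ)) := by
    rw [← Finset.prod_mul_distrib, ← Finset.prod_mul_distrib]
    exact Finset.prod_congr rfl fun i _ => by simp [wt, mul_assoc]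
  rw [e1]
  refine Dvd.dvd.mul_left ?_ _
  rw [pp, Finset.prod_mul_distrib]
  refine mul_dvd_mul ?_ ?_
  · have i1 : Set.InjOn (fun i : Fin m => m - 1 - (i : ℕ)) T := by
      intro x _ y _ h
      have := x.2; have := y.2
      simp only at h
      ext; omega
    have := chain_dvd (apr m a) (fun i j h => prod_range_dvd _ i j h)
      (T.image fun i : Fin m => m - 1 - (i : ℕ))
    rwa [Finset.card_image_of_injOn i1, hc, Finset.prod_image i1] at this
  · have i1 : Set.InjOn (fun i : Fin m => (i : ℕ)) T := by
      intro x _ y _ h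
      exact Fin.ext h
    have := chain_dvd (bpr b) (fun i j h => prod_range_dvd _ i j h)
      (T.image fun i : Fin m => (i : ℕ))
    rwa [Finset.card_image_of_injOn i1, hc, Finset.prod_image i1] at this

lemma wt_eq (m c c' : ℕ) (h : c ≤ c') (hc : c' < m) (a b : R) (hab : a + b = c + c' + 1) :
    wt m a b c = wt m a b c' := by
  obtain ⟨n, rfl⟩ := Nat.exists_eq_add_of_le h
  obtain ⟨t, rfl⟩ := Nat.exists_eq_add_of_lt hc
  have e1 : c + n + t + 1 - 1 - c = t + n := by omega
  have e2 : c + n + t + 1 - 1 - (c + n) = t := by omega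
  rw [wt, wt, e1, e2, apr, bpr, bpr, Finset.prod_range_add, Finset.prod_range_add, ← apr, ← bpr,
    pow_add]
  have : ∏ x ∈ Finset.range n, (b - 1 - ((c + x : ℕ) : R)) = (-1) ^ n *
      ∏ x ∈ Finset.range n, (a - ((c + n + t + 1 : ℕ) : R) + 1 + ((t + x : ℕ) : R)) := by
    rw [← Finset.card_range n, ← Finset.prod_const, Finset.card_range, ← Finset.prod_mul_distrib]
    refine Finset.prod_congr rfl fun x _ => ?_
    have hb : b = c + (c + n : ℕ) + 1 - a := by rw [← hab]; ring
    rw [hb]; push_cast; ring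
  rw [this]; ring

lemma wt_dvd (m : ℕ) (c c' : Fin m) (h : c ≤ c') (a b : R) :
    a + b - (c + c' + 1) ∣ wt m a b c - wt m a b c' := by
  rw [← Ideal.mem_span_singleton, ← Ideal.Quotient.eq, wt_map, wt_map]
  refine wt_eq m c c' h c'.2 _ _ ?_
  have : Ideal.Quotient.mk (Ideal.span {a + b - ((c : ℕ) + (c' : ℕ) + 1)}) (a + b)
    = Ideal.Quotient.mk _ ((c : ℕ) + (c' : ℕ) + 1 : R) := by
    rw [Ideal.Quotient.eq, Ideal.mem_span_singleton]
  simpa using this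

lemma col_dvd {n : Type*} [Fintype n] [DecidableEq n] (M : Matrix n n R) (L : R) (P : Finset n)
    (τ : n → n) (hτ : ∀ r ∈ P, τ r ∉ P) (hL : ∀ r ∈ P, ∀ l, L ∣ M l r - M l (τ r)) :
    L ^ P.card ∣ M.det := by
  have key : ∀ Q : Finset n, Q ⊆ P →
      (Matrix.of fun l c => if c ∈ Q then M l c - M l (τ c) else M l c).det = M.det := by
    intro Q
    induction Q using Finset.induction_on with
    | empty => intro _; simp; rfl
    | insert r Q hr ih =>
      intro hQ
      have hQP : Q ⊆ P := fun x hx => hQ (Finset.mem_insert_of_mem hx)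
      rw [← ih hQP]
      have hrP : r ∈ P := hQ (Finset.mem_insert_self _ _)
      have hne : r ≠ τ r := fun h => hτ r hrP (h ▸ hrP)
      have hnQ : τ r ∉ Q := fun h => hτ r hrP (hQP h)
      rw [← Matrix.det_updateCol_add_smul_self
        (Matrix.of fun l c => if c ∈ Q then M l c - M l (τ c) else M l c) hne (-1)]
      congr 1
      ext l c
      by_cases hc : c = r
      · subst hc
        simp [hr, hnQ, sub_eq_add_neg]
      · simp [hc]
  rw [← key P subset_rfl]
  choose! B hB using hL
  have : (Matrix.of fun l c => if c ∈ P then M l c - M l (τ c) else M l c) =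
      Matrix.of fun l c => (if c ∈ P then L else 1) * (Matrix.of fun l c => if c ∈ P then B c l else M l c) l c := by
    ext l c
    by_cases hc : c ∈ P
    · simp [hc, hB c hc l]
    · simp [hc]
  rw [this, Matrix.det_mul_row]
  refine Dvd.dvd.mul_right ?_ _
  simp

end generic

end JD


namespace JD

/-- `2X + γ - (s+1)` -/
noncomputable def Lp (γ : ℝ) (s : ℕ) : ℝ[X] := 2 * X + C γ - ((s : ℝ[X]) + 1)

lemma Lp_eval (γ : ℝ) (s : ℕ) (y : ℝ) : (Lp γ s).eval y = 2 * y + γ - (s + 1) := by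
  simp [Lp]

lemma Lp_eq_of_root (γ : ℝ) (s : ℕ) (y : ℝ) (h : (Lp γ s).eval y = 0) :
    Lp γ s = 2 * (X - C y) := by
  rw [Lp_eval] at h
  have : γ = (s + 1) - 2 * y := by linarith
  rw [Lp, this]
  simp only [map_sub, map_add, map_mul, map_natCast, map_one, map_ofNat]
  ring

lemma Lp_ne_zero (γ : ℝ) (s : ℕ) : Lp γ s ≠ 0 := by
  intro h
  have h1 := congrArg (eval ((s + 2 - γ) / 2)) h
  rw [Lp_eval] at h1
  simp at h1
  linarith

lemma Lp_coprime (γ : ℝ) (s t : ℕ) (h : s ≠ t) : IsCoprime (Lp γ s) (Lp γ t) := by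
  have h0 : ((t : ℝ) - s) ≠ 0 := by
    rw [sub_ne_zero]; exact_mod_cast h.symm
  refine ⟨C (((t : ℝ) - s)⁻¹), -C (((t : ℝ) - s)⁻¹), ?_⟩
  have : C (((t : ℝ) - s)⁻¹) * Lp γ s + -C (((t : ℝ) - s)⁻¹) * Lp γ t =
      C (((t : ℝ) - s)⁻¹ * ((t : ℝ) - s)) := by
    simp only [Lp, map_sub, map_mul, map_natCast]
    ring
  rw [this, inv_mul_cancel₀ h0, C_1]

lemma relprime_C (p : ℝ[X][X]) (hp : IsUnit (p.coeff 1)) (q : ℝ[X]) (hq : q ≠ 0) :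
    IsRelPrime p (C q) := by
  intro d hd hq'
  have h0 : d.natDegree = 0 := by
    have := natDegree_le_of_dvd hq' (by simpa using hq)
    simpa using this
  rw [eq_C_of_natDegree_eq_zero h0] at hd ⊢
  rw [C_dvd_iff_dvd_coeff] at hd
  exact (isUnit_of_dvd_unit (hd 1) hp).map C

lemma relprime_prod {ι : Type*} (s : Finset ι) (f : ι → ℝ[X][X]) (q : ℝ[X][X])
    (h : ∀ i ∈ s, IsRelPrime (f i) q) : IsRelPrime (∏ i ∈ s, f i) q := by
  classical
  induction s using Finset.induction_on with
  | empty => simpa using isRelPrime_one_left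
  | insert a s ha ih =>
    rw [Finset.prod_insert ha]
    exact (h a (by simp)).mul_left (ih fun i hi => h i (by simp [hi]))

lemma main_dvd (m m1 : ℕ) (h1 : m1 ≤ m) (α β : ℝ) (Z : Matrix (Fin m) (Fin m) ℝ[X])
    (K : Finset (Fin m × Fin m)) (hK : ∀ p ∈ K, p.1 < p.2)
    (hZ : ∀ p ∈ K, ∀ l, Lp (α + β) ((p.1 : ℕ) + p.2) ∣ Z l p.1 - Z l p.2) :
    pp m m1 (X + C α) (X + C β) * ∏ p ∈ K, Lp (α + β) ((p.1 : ℕ) + p.2) ∣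
      (WM m m1 (X + C α) (X + C β) Z).det := by
  set γ := α + β with hγ
  set a : ℝ[X][X] := X with ha
  set b : ℝ[X][X] := C (2 * X + C γ) - X with hb
  have key : pp m m1 a b * C (∏ p ∈ K, Lp γ ((p.1 : ℕ) + p.2)) ∣
      (WM m m1 a b (Z.map C)).det := by
    refine IsRelPrime.mul_dvd ?_ (pp_dvd m m1 h1 a b _) ?_
    · refine relprime_prod _ _ _ fun k _ => IsRelPrime.mul_left ?_ ?_
      · refine relprime_prod _ _ _ fun i _ => relprime_C _ ?_ _ ?_
        · have : a - (m : ℝ[X][X]) + 1 + (i : ℝ[X][X]) = X + C (- (m : ℝ[X]) + 1 + i) := by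
            simp [ha]; ring
          rw [this]; simp [-map_add, -map_neg]
        · exact Finset.prod_ne_zero_iff.2 fun p _ => Lp_ne_zero _ _
      · refine relprime_prod _ _ _ fun i _ => relprime_C _ ?_ _ ?_
        · have : b - 1 - (i : ℝ[X][X]) = - X + C (2 * X + C γ - 1 - (i : ℝ[X])) := by
            simp [hb]; ring
          rw [this]; simp [-map_add, -map_sub, -map_neg]
        · exact Finset.prod_ne_zero_iff.2 fun p _ => Lp_ne_zero _ _
    · rw [Finset.prod_comp (fun s => Lp γ s) (fun p : Fin m × Fin m => (p.1 : ℕ) + p.2), map_prod]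
      refine Finset.prod_dvd_of_coprime ?_ ?_
      · intro s _ t _ hst
        exact ((Lp_coprime γ s t hst).pow).map C
      · intro s _
        rw [map_pow]
        set Ks := K.filter fun p => (p.1 : ℕ) + p.2 = s with hKs
        have hinj : Set.InjOn Prod.fst (Ks : Set (Fin m × Fin m)) := by
          rintro ⟨x, y⟩ hx ⟨z, w⟩ hz hxz
          simp only [hKs, Finset.coe_filter, Set.mem_ofPred_eq] at hx hz hxz
          subst hxz
          have : y = w := by ext; omega
          rw [this]
        rw [← Finset.card_image_of_injOn hinj]
        refine col_dvd _ _ _ (fun r => if h : s - (r : ℕ) < m then ⟨s - r, h⟩ else r) ?_ ?_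
        · intro r hr hr'
          simp only [hKs, Finset.mem_image, Finset.mem_filter, Prod.exists, exists_and_right,
            exists_eq_right] at hr hr'
          obtain ⟨y, hy, hys⟩ := hr
          obtain ⟨z, hz, hzs⟩ := hr'
          have h1 := hK _ hy
          have h2 := hK _ hz
          have h3 : s - (r : ℕ) < m := by have := y.2; omega
          simp only [h3, dif_pos] at hz hzs h2
          simp only [Fin.lt_def] at h1 h2
          omega
        · intro r hr l
          simp only [hKs, Finset.mem_image, Finset.mem_filter, Prod.exists, exists_and_right,
            exists_eq_right] at hr
          obtain ⟨y, hy, hys⟩ := hr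
          have h3 : s - (r : ℕ) < m := by have := y.2; omega
          have h4 : (⟨s - (r : ℕ), h3⟩ : Fin m) = y := by ext; simp; omega
          simp only [h3, dif_pos, h4]
          have hd1 : C (Lp γ s) ∣ Z.map C l r - Z.map C l y := by
            have := map_dvd (C : ℝ[X] →+* ℝ[X][X]) (hZ _ hy l)
            simpa [hys] using this
          have hd2 : C (Lp γ s) ∣ wt m a b r - wt m a b y := by
            have := wt_dvd m r y (hK _ hy).le a b
            convert this using 1
            rw [← hys]
            simp only [Lp, ha, hb, map_sub, map_add, map_natCast, map_one]
            push_cast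
            ring
          simp only [WM, Matrix.of_apply]
          split_ifs
          · have : wt m a b r * Z.map C l r - wt m a b y * Z.map C l y =
              wt m a b r * (Z.map C l r - Z.map C l y) + (wt m a b r - wt m a b y) * Z.map C l y := by
              ring
            rw [this]
            exact dvd_add (hd1.mul_left _) (hd2.mul_right _)
          · simpa using hd1
  have := map_dvd (evalRingHom (X + C α : ℝ[X])) key
  rw [map_mul, pp_map, WM_det_map] at this
  have ea : evalRingHom (X + C α : ℝ[X]) a = X + C α := by simp [ha]
  have eb : evalRingHom (X + C α : ℝ[X]) b = X + C β := by
    simp [hb, hγ]; ring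
  have ez : (Z.map C).map (evalRingHom (X + C α : ℝ[X])) = Z := by
    ext1; simp
  rw [ea, eb, ez] at this
  simpa using this

end JD


namespace JD
open Topology

lemma ev_ne (p : ℝ[X]) (hp : p ≠ 0) : ∀ᶠ x in cofinite, p.eval x ≠ 0 := by
  have : {x | ¬ p.eval x ≠ 0}.Finite := by
    refine (p.roots.toFinset.finite_toSet).subset ?_
    intro x hx
    have hx' : p.eval x = 0 := by simpa using hx
    simp [hp, hx']
  exact this

lemma poly_eq_of_ev (p q : ℝ[X]) (h : ∀ᶠ x in cofinite, p.eval x = q.eval x) : p = q := by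
  by_contra hne
  have h1 := ev_ne (p - q) (sub_ne_zero.2 hne)
  obtain ⟨x, hx, hx'⟩ := (h.and h1).exists
  simp [hx] at hx'

lemma ev_affine {p : ℝ → Prop} (h : ∀ᶠ x in cofinite, p x) (f : ℝ → ℝ) (hf : Function.Injective f) :
    ∀ᶠ x in cofinite, p (f x) := hf.tendsto_cofinite.eventually h

lemma ev_nhds {p : ℝ → Prop} (h : ∀ᶠ x in cofinite, p x) (a : ℝ) : ∀ᶠ x in 𝓝[≠] a, p x :=
  h.filter_mono (by
    rw [le_cofinite_iff_compl_singleton_mem]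
    intro x
    by_cases hx : x = a
    · subst hx; exact self_mem_nhdsWithin
    · exact mem_nhdsWithin_of_mem_nhds (isOpen_compl_singleton.mem_nhds (Ne.symm hx)))

lemma poly_tendsto (p : ℝ[X]) (a : ℝ) : Tendsto (fun x => p.eval x) (𝓝[≠] a) (𝓝 (p.eval a)) :=
  p.continuous.continuousAt.tendsto.mono_left nhdsWithin_le_nhds

lemma poly_of_reg (f : ℝ → ℝ) (hf : ∀ a, Tendsto (fun x => (x - a) * f x) (𝓝[≠] a) (𝓝 0)) :
    ∀ (n : ℕ) (D N : ℝ[X]), D.natDegree = n → D ≠ 0 → D.Splits →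
    (∀ᶠ x in cofinite, f x * D.eval x = N.eval x) → ∃ P : ℝ[X], ∀ᶠ x in cofinite, f x = P.eval x := by
  intro n
  induction n with
  | zero =>
    intro D N hD h0 _ h
    obtain ⟨d, rfl⟩ := natDegree_eq_zero.1 hD
    have hd : d ≠ 0 := by simpa using h0
    refine ⟨C d⁻¹ * N, ?_⟩
    filter_upwards [h] with x hx
    rw [eval_mul, ← hx]
    simp; field_simp
  | succ n ih =>
    intro D N hD h0 hs h
    obtain ⟨a, ha⟩ := hs.exists_eval_eq_zero (degree_ne_of_natDegree_ne (n := 0) (by omega))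
    obtain ⟨D', rfl⟩ := dvd_iff_isRoot.2 ha
    have hD0 : D' ≠ 0 := right_ne_zero_of_mul h0
    have hNa : N.eval a = 0 := by
      have h1 : Tendsto (fun x => N.eval x) (𝓝[≠] a) (𝓝 (0 * D'.eval a)) := by
        refine ((hf a).mul (poly_tendsto D' a)).congr' ?_
        filter_upwards [ev_nhds h a] with x hx
        rw [← hx]; simp; ring
      have := tendsto_nhds_unique h1 (poly_tendsto N a)
      simpa using this.symm
    obtain ⟨N', rfl⟩ := dvd_iff_isRoot.2 hNa
    refine ih D' N' ?_ hD0 ((splits_mul_iff_right (X_sub_C_ne_zero a) (Splits.X_sub_C a)).1 hs) ?_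
    · rw [natDegree_mul (X_sub_C_ne_zero a) hD0, natDegree_X_sub_C] at hD; omega
    · filter_upwards [h, ev_ne _ (X_sub_C_ne_zero a)] with x hx hxa
      simp only [eval_mul] at hx
      apply mul_left_cancel₀ hxa
      linarith

lemma even_poly (R : ℝ[X]) (h : ∀ x, R.eval (-x) = R.eval x) : ∃ Q : ℝ[X], R = Q.comp (X ^ 2) := by
  have h1 : R.comp (C (-1) * X) = R := by
    apply Polynomial.funext; intro x; simpa using h x
  refine ⟨contract 2 R, ?_⟩
  rw [← expand_eq_comp_X_pow]
  ext n
  rw [coeff_expand (by norm_num), coeff_contract (by norm_num)]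
  split_ifs with hn
  · rw [Nat.div_mul_cancel hn]
  · have h2 := congrArg (fun p => coeff p n) h1
    simp only [comp_C_mul_X_coeff] at h2
    have : Odd n := by rwa [← Nat.not_even_iff_odd, even_iff_two_dvd]
    rw [this.neg_one_pow] at h2
    linarith

lemma sym_poly (P : ℝ[X]) (g : ℝ) (h : ∀ x, P.eval (-x - g) = P.eval x) :
    ∃ Q : ℝ[X], ∀ x, P.eval x = Q.eval (x * (x + g)) := by
  obtain ⟨Q, hQ⟩ := even_poly (P.comp (X - C (g / 2))) (by
    intro x
    simp only [eval_comp, eval_sub, eval_X, eval_C]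
    rw [← h]; congr 1; ring)
  refine ⟨Q.comp (X + C (g ^ 2 / 4)), fun x => ?_⟩
  have := congrArg (eval (x + g / 2)) hQ
  simp only [eval_comp, eval_sub, eval_X, eval_C, eval_pow, eval_add, add_sub_cancel_right] at this ⊢
  rw [this]; congr 1; ring

lemma antisym_poly (P : ℝ[X]) (g : ℝ) (h : ∀ x, P.eval (-x - g) = - P.eval x) :
    ∃ Q : ℝ[X], ∀ x, P.eval x = (2 * x + g) * Q.eval (x * (x + g)) := by
  have h0 : P.IsRoot (-(g / 2)) := by
    have := h (-(g / 2))
    have e : -(-(g / 2)) - g = -(g / 2) := by ring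
    rw [e] at this
    rw [IsRoot.def]; linarith
  obtain ⟨P', hP'⟩ := dvd_iff_isRoot.2 h0
  have hs : P'.comp (-X - C g) = P' := by
    refine poly_eq_of_ev _ _ ?_
    filter_upwards [ev_ne _ (X_sub_C_ne_zero (-(g / 2)))] with x hx
    have := h x
    rw [hP'] at this
    simp only [eval_mul, eval_comp, eval_sub, eval_X, eval_C, eval_neg] at this hx ⊢
    apply mul_left_cancel₀ hx
    linarith
  obtain ⟨Q, hQ⟩ := sym_poly P' g (fun x => by
    have := congrArg (eval x) hs
    simpa using this)
  refine ⟨C (1 / 2) * Q, fun x => ?_⟩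
  rw [hP', eval_mul, hQ]
  simp; ring

end JD


namespace JD
open Topology

section T
variable (m m1 : ℕ) (α β : ℝ) (Ξ : ℝ[X])

/-- `p` as polynomial -/
noncomputable def pP : ℝ[X] := pp m m1 (X + C α) (X + C β)
/-- `q` as polynomial -/
noncomputable def qP : ℝ[X] :=
  ∏ p ∈ (Finset.univ : Finset (Fin m × Fin m)).filter (fun p => p.1 < p.2),
    Lp (α + β) ((p.1 : ℕ) + p.2)
/-- numerator -/
noncomputable def nP : ℝ[X] := (2 * X - C (m : ℝ) + C (α + β)) * Ξ
/-- determinant as polynomial -/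
noncomputable def dP (Z : Matrix (Fin m) (Fin m) ℝ[X]) : ℝ[X] :=
  (WM m m1 (X + C α) (X + C β) Z).det
/-- the rational function -/
noncomputable def T (Z : Matrix (Fin m) (Fin m) ℝ[X]) (y : ℝ) : ℝ :=
  (nP m α β Ξ).eval y * (dP m m1 α β Z).eval y / ((pP m m1 α β).eval y * (qP m α β).eval y)

lemma pP_good : pP m m1 α β ≠ 0 ∧ (pP m m1 α β).Splits := by
  have ha : ∀ i : ℕ, (X + C α : ℝ[X]) - (m : ℝ[X]) + 1 + (i : ℝ[X]) = X + C (α - m + 1 + i) := by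
    intro i; simp; ring
  have hb : ∀ i : ℕ, (X + C β : ℝ[X]) - 1 - (i : ℝ[X]) = X + C (β - 1 - i) := by
    intro i; simp; ring
  unfold pP pp
  constructor
  · refine Finset.prod_ne_zero_iff.2 fun k _ => mul_ne_zero ?_ ?_
    · refine Finset.prod_ne_zero_iff.2 fun i _ => ?_
      rw [ha]; exact X_add_C_ne_zero _
    · refine Finset.prod_ne_zero_iff.2 fun i _ => ?_
      rw [hb]; exact X_add_C_ne_zero _
  · refine Splits.prod fun k _ => Splits.mul ?_ ?_
    · refine Splits.prod fun i _ => ?_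
      rw [ha]; exact Splits.X_add_C _
    · refine Splits.prod fun i _ => ?_
      rw [hb]; exact Splits.X_add_C _

lemma qP_good : qP m α β ≠ 0 ∧ (qP m α β).Splits := by
  constructor
  · exact Finset.prod_ne_zero_iff.2 fun p _ => Lp_ne_zero _ _
  · refine Splits.prod fun p _ => Splits.of_natDegree_le_one ?_
    have : Lp (α + β) ((p.1 : ℕ) + p.2) = C 2 * X + C (α + β - (((p.1 : ℕ) + p.2 : ℕ) + 1)) := by
      simp only [Lp, map_sub, map_add, map_natCast, map_one, map_ofNat]; ring
    rw [this]
    exact natDegree_linear_le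

/-- rational functions with split denominator -/
def RS (f : ℝ → ℝ) : Prop :=
  ∃ D N : ℝ[X], D ≠ 0 ∧ D.Splits ∧ ∀ᶠ x in cofinite, f x * D.eval x = N.eval x

lemma RS_T (Z : Matrix (Fin m) (Fin m) ℝ[X]) : RS (T m m1 α β Ξ Z) := by
  obtain ⟨p0, ps⟩ := pP_good m m1 α β
  obtain ⟨q0, qs⟩ := qP_good m α β
  refine ⟨pP m m1 α β * qP m α β, nP m α β Ξ * dP m m1 α β Z, mul_ne_zero p0 q0, ps.mul qs, ?_⟩
  filter_upwards [ev_ne _ p0, ev_ne _ q0] with x h1 h2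
  simp only [T, eval_mul]
  field_simp

lemma RS_add {f g : ℝ → ℝ} (hf : RS f) (hg : RS g) : RS (fun x => f x + g x) := by
  obtain ⟨D, N, h0, hs, h⟩ := hf
  obtain ⟨D', N', h0', hs', h'⟩ := hg
  refine ⟨D * D', N * D' + N' * D, mul_ne_zero h0 h0', hs.mul hs', ?_⟩
  filter_upwards [h, h'] with x h1 h2
  simp only [eval_mul, eval_add, ← h1, ← h2]; ring

lemma RS_sum {ι : Type*} (s : Finset ι) (f : ι → ℝ → ℝ) (hf : ∀ i ∈ s, RS (f i)) :
    RS (fun x => ∑ i ∈ s, f i x) := by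
  classical
  induction s using Finset.induction_on with
  | empty => exact ⟨1, 0, one_ne_zero, Splits.one, by simp⟩
  | insert a s ha ih =>
    simp only [Finset.sum_insert ha]
    exact RS_add (hf a (by simp)) (ih fun i hi => hf i (by simp [hi]))

lemma RS_shift {f : ℝ → ℝ} (hf : RS f) (a : ℝ) : RS (fun x => f (x + a)) := by
  obtain ⟨D, N, h0, hs, h⟩ := hf
  refine ⟨D.comp (X + C a), N.comp (X + C a), ?_, hs.comp_X_add_C a, ?_⟩
  · intro h
    apply h0
    have := congrArg (fun p => p.comp (X - C a)) h
    simpa [comp_assoc] using this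
  · filter_upwards [ev_affine h (fun x => x + a) (add_left_injective a)] with x hx
    simpa using hx

lemma T_reg (h1 : m1 ≤ m) (Z : Matrix (Fin m) (Fin m) ℝ[X]) (y0 : ℝ)
    (hZ : ∀ c c' : Fin m, c < c' → (Lp (α + β) ((c : ℕ) + c')).eval y0 = 0 → ∀ l,
      Lp (α + β) ((c : ℕ) + c') ∣ Z l c - Z l c') :
    ∃ ℓ, Tendsto (T m m1 α β Ξ Z) (𝓝[≠] y0) (𝓝 ℓ) := by
  classical
  set A := (Finset.univ : Finset (Fin m × Fin m)).filter (fun p => p.1 < p.2) with hA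
  set K := A.filter (fun p => (Lp (α + β) ((p.1 : ℕ) + p.2)).eval y0 = 0) with hK
  set K' := A.filter (fun p => ¬ (Lp (α + β) ((p.1 : ℕ) + p.2)).eval y0 = 0) with hK'
  obtain ⟨F, hF⟩ := main_dvd m m1 h1 α β Z K
    (fun p hp => by simp [hK, hA] at hp; exact hp.1)
    (fun p hp l => by simp only [hK, hA, Finset.mem_filter] at hp; exact hZ _ _ hp.1.2 hp.2 l)
  set qK := ∏ p ∈ K, Lp (α + β) ((p.1 : ℕ) + p.2) with hqK
  set qR := ∏ p ∈ K', Lp (α + β) ((p.1 : ℕ) + p.2) with hqR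
  have hq : qP m α β = qK * qR := (Finset.prod_filter_mul_prod_filter_not _ _ _).symm
  have hq0 : qK ≠ 0 := Finset.prod_ne_zero_iff.2 fun p _ => Lp_ne_zero _ _
  have hqR0 : qR.eval y0 ≠ 0 := by
    rw [hqR, eval_prod]
    refine Finset.prod_ne_zero_iff.2 fun p hp => ?_
    simp only [hK', Finset.mem_filter] at hp
    exact hp.2
  have hd : dP m m1 α β Z = pP m m1 α β * qK * F := hF
  refine ⟨_, (((poly_tendsto (nP m α β Ξ) y0).mul (poly_tendsto F y0)).div
    (poly_tendsto qR y0) hqR0).congr' ?_⟩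
  filter_upwards [ev_nhds (ev_ne _ hq0) y0, ev_nhds (ev_ne _ (pP_good m m1 α β).1) y0] with x h2 h3
  rw [T, hd, hq]
  simp only [eval_mul, Pi.div_apply]
  by_cases h4 : qR.eval x = 0
  · simp [h4]
  · field_simp

lemma apr_refl (b : ℝ) (n : ℕ) : apr m ((m : ℝ) - b) n = (-1) ^ n * bpr b n := by
  rw [apr, bpr, ← Finset.card_range n, ← Finset.prod_const, Finset.card_range,
    ← Finset.prod_mul_distrib]
  exact Finset.prod_congr rfl fun x _ => by ring

lemma bpr_refl (a : ℝ) (n : ℕ) : bpr ((m : ℝ) - a) n = (-1) ^ n * apr m a n := by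
  rw [apr, bpr, ← Finset.card_range n, ← Finset.prod_const, Finset.card_range,
    ← Finset.prod_mul_distrib]
  exact Finset.prod_congr rfl fun x _ => by ring

lemma sq_sign (n : ℕ) : ((-1 : ℝ) ^ n) * (-1) ^ n = 1 := by
  rw [← mul_pow]; simp

lemma wt_refl (a b : ℝ) (c : ℕ) (hc : c < m) :
    wt m ((m : ℝ) - b) ((m : ℝ) - a) c = wt m a b (m - (c + 1)) := by
  have e1 : m - 1 - (m - (c + 1)) = c := by omega
  have e2 : m - 1 - c = m - (c + 1) := by omega
  rw [wt, wt, e1, e2, apr_refl, bpr_refl]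
  linear_combination ((-1) ^ c * bpr b (m - (c + 1)) * apr m a c) * sq_sign (m - (c + 1))

lemma pp_refl (a b : ℝ) : pp m m1 ((m : ℝ) - b) ((m : ℝ) - a) = pp m m1 a b := by
  rw [pp, pp]
  refine Finset.prod_congr rfl fun k _ => ?_
  rw [apr_refl, bpr_refl]
  linear_combination (bpr b k * apr m a k) * sq_sign k

lemma dP_eval (Z : Matrix (Fin m) (Fin m) ℝ[X]) (y : ℝ) :
    (dP m m1 α β Z).eval y = (WM m m1 (y + α) (y + β) (Z.map (evalRingHom y))).det := by
  have := WM_det_map (evalRingHom y) m m1 (X + C α) (X + C β) Z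
  simpa [dP] using this

lemma pP_eval (y : ℝ) : (pP m m1 α β).eval y = pp m m1 (y + α) (y + β) := by
  have := pp_map (evalRingHom y) m m1 (X + C α) (X + C β)
  simpa [pP] using this

lemma dP_refl (Z Z' : Matrix (Fin m) (Fin m) ℝ[X]) (y : ℝ)
    (hZ : ∀ l c, (Z' l c).eval (m - (α + β) - y) = (Z l (Fin.rev c)).eval y) :
    (dP m m1 α β Z').eval (m - (α + β) - y) =
      (Equiv.Perm.sign (Fin.revPerm : Equiv.Perm (Fin m)) : ℤ) * (dP m m1 α β Z).eval y := by
  rw [dP_eval, dP_eval, ← Matrix.det_permute']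
  congr 1
  ext l c
  have ea : (m : ℝ) - (α + β) - y + α = m - (y + β) := by ring
  have eb : (m : ℝ) - (α + β) - y + β = m - (y + α) := by ring
  simp only [WM, Matrix.of_apply, Matrix.submatrix_apply, Matrix.map_apply, id, coe_evalRingHom,
    hZ, ea, eb, Fin.revPerm_apply, Fin.val_rev]
  rw [wt_refl _ _ _ _ c.2]

lemma qP_iter : (qP m α β) = ∏ i : Fin m, ∏ j ∈ Finset.Ioi i, Lp (α + β) ((i : ℕ) + j) := by
  rw [qP, Finset.prod_sigma']
  refine Finset.prod_bij' (fun p _ => ⟨p.1, p.2⟩) (fun s _ => (s.1, s.2)) ?_ ?_ ?_ ?_ ?_ <;> simp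

lemma qP_refl (y : ℝ) : (qP m α β).eval (m - (α + β) - y) =
      (Equiv.Perm.sign (Fin.revPerm : Equiv.Perm (Fin m)) : ℤ) * (qP m α β).eval y := by
  set v : ℝ → Fin m → ℝ := fun y c => (y - c - 1) * (y - c - 1 + (α + β) + 1) with hv
  have h1 : ∀ y, (Matrix.vandermonde (v y)).det =
      (∏ i : Fin m, ∏ j ∈ Finset.Ioi i, ((i : ℝ) - j)) * (qP m α β).eval y := by
    intro y
    rw [Matrix.det_vandermonde, qP_iter]
    simp only [eval_prod, ← Finset.prod_mul_distrib, Lp_eval, hv]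
    refine Finset.prod_congr rfl fun i _ => Finset.prod_congr rfl fun j _ => ?_
    push_cast; ring
  have h2 : (∏ i : Fin m, ∏ j ∈ Finset.Ioi i, ((i : ℝ) - j)) ≠ 0 := by
    refine Finset.prod_ne_zero_iff.2 fun i _ => Finset.prod_ne_zero_iff.2 fun j hj => ?_
    have : i < j := by simpa using hj
    rw [sub_ne_zero]
    intro h
    have : (i : ℕ) = j := by exact_mod_cast h
    omega
  have h3 : Matrix.vandermonde (v (m - (α + β) - y)) =
      (Matrix.vandermonde (v y)).submatrix Fin.revPerm id := by
    ext i j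
    simp only [Matrix.vandermonde_apply, Matrix.submatrix_apply, id, hv, Fin.revPerm_apply]
    congr 1
    have : ((Fin.rev i : Fin m) : ℝ) = m - 1 - i := by
      rw [Fin.val_rev, Nat.cast_sub (by omega)]; push_cast; ring
    rw [this]; ring
  have h4 := h1 (m - (α + β) - y)
  rw [h3, Matrix.det_permute, h1 y] at h4
  apply mul_left_cancel₀ h2
  rw [← h4]; ring

lemma T_refl (hΞ : ∀ x : ℝ, Ξ.eval (m - (α + β) - x) = Ξ.eval x)
    (Z Z' : Matrix (Fin m) (Fin m) ℝ[X]) (y : ℝ)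
    (hZ : ∀ l c, (Z' l c).eval (m - (α + β) - y) = (Z l (Fin.rev c)).eval y) :
    T m m1 α β Ξ Z' (m - (α + β) - y) = - T m m1 α β Ξ Z y := by
  rw [T, T, dP_refl m m1 α β Z Z' y hZ, qP_refl]
  have hp : (pP m m1 α β).eval (m - (α + β) - y) = (pP m m1 α β).eval y := by
    rw [pP_eval, pP_eval, ← pp_refl]; congr 1 <;> ring
  have hn : (nP m α β Ξ).eval (m - (α + β) - y) = - (nP m α β Ξ).eval y := by
    simp only [nP, eval_mul, hΞ]; simp; ring
  rw [hp, hn]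
  rcases Int.units_eq_one_or (Equiv.Perm.sign (Fin.revPerm : Equiv.Perm (Fin m))) with h | h <;>
    rw [h] <;> simp [neg_div, div_neg]

end T
end JD


namespace JD
open Topology

section M
variable (m m1 : ℕ) (α β : ℝ) (Ξ : ℝ[X])

lemma WM_updateRow {R : Type*} [CommRing R] (a b : R) (Z : Matrix (Fin m) (Fin m) R) (h : Fin m)
    (f : Fin m → R) : WM m m1 a b (Z.updateRow h f) =
      (WM m m1 a b Z).updateRow h (fun c => (if (h : ℕ) < m1 then wt m a b c else 1) * f c) := by
  ext l c
  by_cases hl : l = h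
  · subst hl; simp [WM]
  · simp [WM, Matrix.updateRow_ne hl]

lemma T_add (Z : Matrix (Fin m) (Fin m) ℝ[X]) (h : Fin m) (f g : Fin m → ℝ[X]) (y : ℝ) :
    T m m1 α β Ξ (Z.updateRow h (f + g)) y =
      T m m1 α β Ξ (Z.updateRow h f) y + T m m1 α β Ξ (Z.updateRow h g) y := by
  have : dP m m1 α β (Z.updateRow h (f + g)) =
      dP m m1 α β (Z.updateRow h f) + dP m m1 α β (Z.updateRow h g) := by
    simp only [dP, WM_updateRow]
    rw [← Matrix.det_updateRow_add]
    congr 2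
    funext c
    simp [mul_add]
  rw [T, T, T, this, eval_add]; ring

lemma T_smul (Z : Matrix (Fin m) (Fin m) ℝ[X]) (h : Fin m) (p : ℝ[X]) (f : Fin m → ℝ[X]) (y : ℝ) :
    T m m1 α β Ξ (Z.updateRow h (p • f)) y =
      p.eval y * T m m1 α β Ξ (Z.updateRow h f) y := by
  have : dP m m1 α β (Z.updateRow h (p • f)) = p * dP m m1 α β (Z.updateRow h f) := by
    simp only [dP, WM_updateRow]
    rw [← Matrix.det_updateRow_smul]
    congr 2
    funext c
    simp only [Pi.smul_apply, smul_eq_mul]; ring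
  rw [T, T, this, eval_mul]; ring

/-- the cofactor functions -/
noncomputable def Tc (Z : Matrix (Fin m) (Fin m) ℝ[X]) (h c : Fin m) : ℝ → ℝ :=
  T m m1 α β Ξ (Z.updateRow h (Pi.single c 1))

/-- `M_h` -/
noncomputable def MM (Z : Matrix (Fin m) (Fin m) ℝ[X]) (h : Fin m) (x : ℝ) : ℝ :=
  ∑ c : Fin m, Tc m m1 α β Ξ Z h c (x + ((c : ℝ) + 1))

lemma row_dvd (Z : Matrix (Fin m) (Fin m) ℝ[X]) (L : ℝ[X]) (c c' h : Fin m) (f : Fin m → ℝ[X])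
    (hZ : ∀ l, L ∣ Z l c - Z l c') (hf : L ∣ f c - f c') (l : Fin m) :
    L ∣ Z.updateRow h f l c - Z.updateRow h f l c' := by
  by_cases hl : l = h
  · subst hl; simpa using hf
  · simpa [Matrix.updateRow_ne hl] using hZ l

lemma MM_refl (hΞ : ∀ x : ℝ, Ξ.eval (m - (α + β) - x) = Ξ.eval x)
    (Z : Matrix (Fin m) (Fin m) ℝ[X])
    (hS : ∀ l c y, (Z l c).eval (m - (α + β) - y) = (Z l (Fin.rev c)).eval y)
    (h : Fin m) (x : ℝ) :
    MM m m1 α β Ξ Z h (-x - (α + β + 1)) = - MM m m1 α β Ξ Z h x := by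
  rw [MM, MM, ← Finset.sum_neg_distrib, ← Equiv.sum_comp Fin.revPerm]
  refine Finset.sum_congr rfl fun c _ => ?_
  have e : -x - (α + β + 1) + (((Fin.revPerm c : Fin m) : ℝ) + 1) =
      m - (α + β) - (x + ((c : ℝ) + 1)) := by
    rw [Fin.revPerm_apply, Fin.val_rev, Nat.cast_sub (by omega)]; push_cast; ring
  rw [e, Tc, Tc]
  apply T_refl m m1 α β Ξ hΞ
  intro l c'
  by_cases hl : l = h
  · subst hl
    simp only [Matrix.updateRow_self, Fin.revPerm_apply, Pi.single_apply, Fin.rev_eq_iff]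
    by_cases hc : c' = c.rev
    · simp [hc]
    · have : c' ≠ c.rev := hc
      simp [hc]
  · simp only [Matrix.updateRow_ne hl]
    exact hS l c' _

lemma MM_poly (h1 : m1 ≤ m) (hΞ : ∀ x : ℝ, Ξ.eval (m - (α + β) - x) = Ξ.eval x)
    (Z : Matrix (Fin m) (Fin m) ℝ[X])
    (hZ : ∀ l (c c' : Fin m), Lp (α + β) ((c : ℕ) + c') ∣ Z l c - Z l c')
    (hS : ∀ l c y, (Z l c).eval (m - (α + β) - y) = (Z l (Fin.rev c)).eval y)
    (h : Fin m) : ∃ P : ℝ[X], ∀ᶠ x in cofinite, MM m m1 α β Ξ Z h x = P.eval x := by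
  have hr : ∀ (c : Fin m) (y0 : ℝ), ∃ ℓ,
      Tendsto (fun y => (y - y0) * Tc m m1 α β Ξ Z h c y) (𝓝[≠] y0) (𝓝 ℓ) := by
    intro c y0
    obtain ⟨ℓ, hℓ⟩ := T_reg m m1 α β Ξ h1 (Z.updateRow h ((X - C y0) • Pi.single c 1)) y0 (by
      intro d d' _ hd l
      refine row_dvd m Z _ d d' h _ (fun l => hZ l d d') ?_ l
      rw [Lp_eq_of_root _ _ _ hd]
      simp only [Pi.smul_apply, smul_eq_mul, ← mul_sub]
      refine Dvd.dvd.mul_right ?_ _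
      refine ⟨C (1 / 2), ?_⟩
      rw [mul_right_comm, show (2 : ℝ[X]) = C 2 from rfl, ← C_mul]; norm_num)
    refine ⟨ℓ, hℓ.congr fun y => ?_⟩
    rw [T_smul, Tc]; simp
  choose ρ hρ using hr
  have ht0 : ∀ y0 : ℝ, Tendsto (fun y => y - y0) (𝓝[≠] y0) (𝓝 0) := by
    intro y0
    have := poly_tendsto (X - C y0) y0
    simpa using this
  have hρ0 : ∀ (c : Fin m) (y0 : ℝ), (∀ k : Fin m, k ≠ c → (Lp (α + β) ((c : ℕ) + k)).eval y0 ≠ 0) → ρ c y0 = 0 := by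
    intro c y0 hk
    obtain ⟨ℓ, hℓ⟩ := T_reg m m1 α β Ξ h1 (Z.updateRow h (Pi.single c 1)) y0 (by
      intro d d' hdd hd l
      refine row_dvd m Z _ d d' h _ (fun l => hZ l d d') ?_ l
      have n1 : d ≠ c := by
        rintro rfl; exact hk d' hdd.ne' hd
      have n2 : d' ≠ c := by
        rintro rfl; exact hk d hdd.ne (by rw [Nat.add_comm]; exact hd)
      simp [n1, n2])
    have h2 := (ht0 y0).mul hℓ
    rw [zero_mul] at h2
    exact tendsto_nhds_unique (hρ c y0) h2
  have hρ1 : ∀ (c k : Fin m) (y0 : ℝ), c ≠ k → (Lp (α + β) ((c : ℕ) + k)).eval y0 = 0 → ρ c y0 + ρ k y0 = 0 := by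
    intro c k y0 hck hL
    obtain ⟨ℓ, hℓ⟩ := T_reg m m1 α β Ξ h1
        (Z.updateRow h (Pi.single c 1 + Pi.single k 1)) y0 (by
      intro d d' hdd hd l
      refine row_dvd m Z _ d d' h _ (fun l => hZ l d d') ?_ l
      have hs : (c : ℕ) + k = d + d' := by
        rw [Lp_eval] at hd hL
        have : (((c : ℕ) + k : ℕ) : ℝ) = ((d + d' : ℕ) : ℝ) := by linarith
        exact_mod_cast this
      have hz : (Pi.single c 1 + Pi.single k 1 : Fin m → ℝ[X]) d -
          (Pi.single c 1 + Pi.single k 1 : Fin m → ℝ[X]) d' = 0 := by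
        have hck' : (c : ℕ) ≠ k := fun h => hck (Fin.ext h)
        by_cases e1 : d = c
        · have e2 : d' = k := by ext; rw [e1] at hs; omega
          subst e1 e2
          simp [Pi.single_apply, hck, hck.symm]
        · by_cases e3 : d = k
          · have e2 : d' = c := by ext; rw [e3] at hs; omega
            subst e3 e2
            simp [Pi.single_apply, hck, hck.symm]
          · have e4 : d' ≠ c := by
              rintro rfl; apply e3; ext; omega
            have e5 : d' ≠ k := by
              rintro rfl; apply e1; ext; omega
            simp [Pi.single_apply, e1, e3, e4, e5]
      rw [hz]; exact dvd_zero _)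
    have h2 := (ht0 y0).mul hℓ
    rw [zero_mul] at h2
    refine tendsto_nhds_unique ((hρ c y0).add (hρ k y0)) (h2.congr fun y => ?_)
    rw [T_add, Tc, Tc]; ring
  have hM : ∀ x0, Tendsto (fun x => (x - x0) * MM m m1 α β Ξ Z h x) (𝓝[≠] x0)
      (𝓝 (∑ c : Fin m, ρ c (x0 + ((c : ℝ) + 1)))) := by
    intro x0
    have : ∀ c : Fin m, Tendsto (fun x => (x - x0) * Tc m m1 α β Ξ Z h c (x + ((c : ℝ) + 1)))
        (𝓝[≠] x0) (𝓝 (ρ c (x0 + ((c : ℝ) + 1)))) := by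
      intro c
      have hs : Tendsto (fun x : ℝ => x + ((c : ℝ) + 1)) (𝓝[≠] x0) (𝓝[≠] (x0 + ((c : ℝ) + 1))) := by
        refine tendsto_nhdsWithin_iff.2 ⟨?_, ?_⟩
        · exact (Continuous.tendsto (by fun_prop) x0).mono_left nhdsWithin_le_nhds
        · filter_upwards [self_mem_nhdsWithin] with x hx
          simpa using hx
      refine ((hρ c _).comp hs).congr fun x => ?_
      simp only [Function.comp]
      ring
    refine (tendsto_finsetSum _ fun c _ => this c).congr fun x => ?_
    rw [MM, Finset.mul_sum]
  have hRs : ∀ x0, ∑ c : Fin m, ρ c (-x0 - (α + β + 1) + ((c : ℝ) + 1)) =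
      ∑ c : Fin m, ρ c (x0 + ((c : ℝ) + 1)) := by
    intro x0
    have hs : Tendsto (fun x : ℝ => -x - (α + β + 1)) (𝓝[≠] x0) (𝓝[≠] (-x0 - (α + β + 1))) := by
      refine tendsto_nhdsWithin_iff.2 ⟨?_, ?_⟩
      · exact (Continuous.tendsto (by fun_prop) x0).mono_left nhdsWithin_le_nhds
      · filter_upwards [self_mem_nhdsWithin] with x hx
        simpa using hx
    refine tendsto_nhds_unique ((hM (-x0 - (α + β + 1))).comp hs) ((hM x0).congr fun x => ?_)
    simp only [Function.comp]
    rw [MM_refl m m1 α β Ξ hΞ Z hS]; ring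
  have hR1 : ∀ x0, ∑ c : Fin m, ρ c (x0 + ((c : ℝ) + 1)) =
      ∑ c : Fin m, ∑ k : Fin m,
        if c ≠ k ∧ 2 * x0 + (α + β) + 1 + c - k = 0 then ρ c (x0 + ((c : ℝ) + 1)) else 0 := by
    intro x0
    refine Finset.sum_congr rfl fun c _ => ?_
    by_cases hk : ∃ k : Fin m, c ≠ k ∧ 2 * x0 + (α + β) + 1 + c - k = 0
    · obtain ⟨k, hk⟩ := hk
      rw [Finset.sum_eq_single k, if_pos hk]
      · intro b _ hb
        rw [if_neg]
        rintro ⟨_, h2⟩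
        apply hb
        have : (b : ℝ) = k := by linarith [hk.2]
        ext; exact_mod_cast this
      · simp
    · push Not at hk
      rw [Finset.sum_eq_zero]
      · apply hρ0
        intro k hkc hL
        apply hk k hkc.symm
        rw [Lp_eval] at hL
        push_cast at hL
        linarith
      · intro k _
        rw [if_neg]
        rintro ⟨h1, h2⟩
        exact hk k h1 h2
  have hR0 : ∀ x0, ∑ c : Fin m, ρ c (x0 + ((c : ℝ) + 1)) = 0 := by
    intro x0
    have e1 := hRs x0
    rw [hR1 (-x0 - (α + β + 1)), Finset.sum_comm] at e1
    have e2 := hR1 x0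
    have e3 : (∑ c : Fin m, ∑ k : Fin m,
        if c ≠ k ∧ 2 * x0 + (α + β) + 1 + c - k = 0 then ρ c (x0 + ((c : ℝ) + 1)) else 0) +
        (∑ c : Fin m, ∑ k : Fin m, if k ≠ c ∧ 2 * (-x0 - (α + β + 1)) + (α + β) + 1 + k - c = 0
          then ρ k (-x0 - (α + β + 1) + ((k : ℝ) + 1)) else 0) = 0 := by
      rw [← Finset.sum_add_distrib]
      refine Finset.sum_eq_zero fun c _ => ?_
      rw [← Finset.sum_add_distrib]
      refine Finset.sum_eq_zero fun k _ => ?_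
      by_cases hc : c ≠ k ∧ 2 * x0 + (α + β) + 1 + c - k = 0
      · rw [if_pos hc, if_pos ⟨hc.1.symm, by linarith [hc.2]⟩]
        have : -x0 - (α + β + 1) + ((k : ℝ) + 1) = x0 + ((c : ℝ) + 1) := by linarith [hc.2]
        rw [this]
        apply hρ1 _ _ _ hc.1
        rw [Lp_eval]; push_cast; linarith [hc.2]
      · rw [if_neg hc, if_neg, add_zero]
        rintro ⟨h1, h2⟩
        exact hc ⟨h1.symm, by linarith⟩
    rw [e1, ← e2] at e3
    linarith
  obtain ⟨D, N, hD0, hDs, hDN⟩ : RS (MM m m1 α β Ξ Z h) :=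
    RS_sum _ _ fun c _ => RS_shift (RS_T m m1 α β Ξ _) _
  refine poly_of_reg _ (fun a => ?_) _ D N rfl hD0 hDs hDN
  have := hM a
  rwa [hR0] at this

end M
end JD


namespace JD
open Topology

lemma poch_bpr (b : ℝ) (k : ℕ) : poch (b - k) k = bpr b k := by
  rw [poch, bpr, ← Finset.prod_range_reflect]
  refine Finset.prod_congr rfl fun i hi => ?_
  have : i + 1 ≤ k := Finset.mem_range.1 hi
  rw [show k - 1 - i = k - (i + 1) by omega, Nat.cast_sub this]
  push_cast; ring

lemma poch_apr (m : ℕ) (a : ℝ) (k : ℕ) : poch (a - m + 1) k = apr m a k := rfl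

lemma poch_add (a : ℝ) (n k : ℕ) : poch a (n + k) = poch a n * poch (a + n) k := by
  rw [poch, poch, poch, Finset.prod_range_add]
  congr 1
  refine Finset.prod_congr rfl fun i _ => ?_
  push_cast; ring

lemma pfun_eq (m1 m2 : ℕ) (α β x : ℝ) : pfun m1 m2 α β x =
    (∏ k ∈ Finset.range m1, (-1 : ℝ) ^ k) * (pP (m1 + m2) m1 α β).eval x := by
  rw [pP_eval, pp, ← Finset.prod_mul_distrib, pfun]
  cases m1 with
  | zero => simp
  | succ n =>
    rw [Finset.prod_range_succ']
    have h0 : ∀ a : ℝ, apr (n + 1 + m2) a 0 = 1 := fun a => by simp [apr]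
    have h0' : ∀ a : ℝ, bpr a 0 = 1 := fun a => by simp [bpr]
    rw [h0, h0', pow_zero, mul_one, mul_one, mul_one]
    refine Finset.prod_bij' (fun i _ => n - i) (fun k _ => n - k) ?_ ?_ ?_ ?_ ?_
    · intro i hi; simp only [Finset.mem_Icc, Finset.mem_range] at hi ⊢; omega
    · intro i hi; simp only [Finset.mem_Icc, Finset.mem_range] at hi ⊢; omega
    · intro i hi; simp only [Finset.mem_Icc] at hi ⊢; omega
    · intro i hi; simp only [Finset.mem_range] at hi ⊢; omega
    · intro i hi
      simp only [Finset.mem_Icc] at hi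
      have e : n + 1 - i = n - i + 1 := by omega
      rw [e, ← poch_apr, ← poch_bpr, mul_assoc]
      congr 3
      rw [← e, Nat.cast_sub (by omega)]; ring

lemma qfun_eq (m1 m2 : ℕ) (α β x : ℝ) : qfun m1 m2 α β x =
    (-1 : ℝ) ^ ((m1 + m2) * (m1 + m2 - 1) / 2) * (qP (m1 + m2) α β).eval x := by
  rw [qfun, qP, eval_prod]
  congr 1
  generalize m1 + m2 = m
  rw [Finset.prod_sigma']
  refine Finset.prod_bij' (fun s hs => (⟨m - s.1 - 1, ?_⟩, ⟨m - s.2, ?_⟩))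
    (fun p _ => ⟨m - p.1 - 1, m - p.2⟩) ?_ ?_ ?_ ?_ ?_
  · simp only [Finset.mem_sigma, Finset.mem_Icc] at hs; omega
  · simp only [Finset.mem_sigma, Finset.mem_Icc] at hs; omega
  · intro s hs
    simp only [Finset.mem_sigma, Finset.mem_Icc] at hs
    simp only [Finset.mem_filter, Finset.mem_univ, true_and, Fin.mk_lt_mk]; omega
  · rintro ⟨c, c'⟩ hs
    simp only [Finset.mem_filter, Finset.mem_univ, true_and] at hs
    simp only [Finset.mem_sigma, Finset.mem_Icc]
    have : (c : ℕ) < c' := hs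
    omega
  · rintro ⟨s, t⟩ hs
    simp only [Finset.mem_sigma, Finset.mem_Icc] at hs
    have e1 : m - (m - s - 1) - 1 = s := by omega
    have e2 : m - (m - t) = t := by omega
    simp only [e1, e2]
  · rintro ⟨c, c'⟩ hs
    simp only [Prod.mk.injEq, Fin.ext_iff]
    omega
  · rintro ⟨s, t⟩ hs
    simp only [Finset.mem_sigma, Finset.mem_Icc] at hs
    rw [Lp_eval]
    simp only
    have : ((m - s - 1 + (m - t) : ℕ) : ℝ) = 2 * m - s - 1 - t := by
      rw [Nat.sub_sub]
      rw [Nat.cast_add, Nat.cast_sub (by omega), Nat.cast_sub (by omega)]; push_cast; ring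
    rw [this]; ring

/-- normalising constant -/
noncomputable def kap (m1 m2 : ℕ) : ℝ :=
  (∏ k ∈ Finset.range m1, (-1 : ℝ) ^ k) * (-1 : ℝ) ^ ((m1 + m2) * (m1 + m2 - 1) / 2)

lemma kap_ne (m1 m2 : ℕ) : kap m1 m2 ≠ 0 := by
  refine mul_ne_zero (Finset.prod_ne_zero_iff.2 fun k _ => ?_) ?_ <;> exact pow_ne_zero _ (by norm_num)

lemma xi_eq (m m1 l c : ℕ) (hc : c < m) (α β x : ℝ) (hl : l < m1)
    (hB : poch (x - m + β + 1) (m - 1) ≠ 0) :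
    poch (x - m + β + 1) (m - 1) * ξf m1 α β (l + 1) (x - ((c : ℕ) + 1)) (m - (c + 1)) =
      wt m (x + α) (x + β) c := by
  have e : m - 1 = (m - (c + 1)) + c := by omega
  have hcast : ((m - (c + 1) : ℕ) : ℝ) = m - (c + 1) := by
    rw [Nat.cast_sub (by omega)]; push_cast; ring
  have hs : poch (x - m + β + 1) (m - 1) =
      poch (x - m + β + 1) (m - (c + 1)) * bpr (x + β) c := by
    rw [e, poch_add, hcast, ← poch_bpr]
    congr 2; ring
  rw [hs] at hB ⊢
  rw [ξf, if_pos (by omega), hcast, wt, ← poch_apr]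
  have e1 : x - (↑c + 1) - (↑m - (↑c + 1)) + α + 1 = x + α - m + 1 := by ring
  have e2 : x - (↑c + 1) - (↑m - (↑c + 1)) + β + 1 = x - m + β + 1 := by ring
  rw [e1, e2, show m - 1 - c = m - (c + 1) by omega]
  have h1 := left_ne_zero_of_mul hB
  field_simp

lemma T_S (m1 m2 : ℕ) (α β : ℝ) (Ξ : ℝ[X])
    (Z : Matrix (Fin (m1 + m2)) (Fin (m1 + m2)) ℝ[X]) (x : ℝ)
    (hB : poch (x - ((m1 + m2 : ℕ) : ℝ) + β + 1) (m1 + m2 - 1) ≠ 0) :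
    Sfun m1 m2 α β Ξ x * Matrix.det (Matrix.of fun l j : Fin (m1 + m2) =>
      ξf m1 α β ((l : ℕ) + 1) (x - ((j : ℕ) + 1)) ((m1 + m2) - ((j : ℕ) + 1)) * (Z l j).eval x) =
      (kap m1 m2)⁻¹ * T (m1 + m2) m1 α β Ξ Z x := by
  have hdet : (poch (x - ((m1 + m2 : ℕ) : ℝ) + β + 1) (m1 + m2 - 1)) ^ m1 *
      Matrix.det (Matrix.of fun l j : Fin (m1 + m2) =>
      ξf m1 α β ((l : ℕ) + 1) (x - ((j : ℕ) + 1)) ((m1 + m2) - ((j : ℕ) + 1)) * (Z l j).eval x) =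
      (dP (m1 + m2) m1 α β Z).eval x := by
    have hv : (poch (x - ((m1 + m2 : ℕ) : ℝ) + β + 1) (m1 + m2 - 1)) ^ m1 =
        ∏ l : Fin (m1 + m2), if (l : ℕ) < m1 then
          poch (x - ((m1 + m2 : ℕ) : ℝ) + β + 1) (m1 + m2 - 1) else 1 := by
      rw [Fin.prod_univ_add]; simp
    rw [hv, ← Matrix.det_mul_column, dP_eval]
    congr 1
    ext l c
    simp only [Matrix.of_apply, WM, Matrix.map_apply, coe_evalRingHom]
    by_cases hl : (l : ℕ) < m1
    · rw [if_pos hl, if_pos hl, ← xi_eq (m1 + m2) m1 l c c.2 α β x hl hB]; ring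
    · rw [if_neg hl, if_neg hl, ξf, if_neg (by omega)]; ring
  rw [T, ← hdet, Sfun, pfun_eq, qfun_eq, kap, nP, σf]
  simp only [eval_mul, eval_add, eval_sub, eval_ofNat, eval_X, eval_C]
  rw [inv_mul_eq_div, div_div, div_mul_eq_mul_div]
  congr 1 <;> ring

lemma B_ev (m : ℕ) (β : ℝ) : ∀ᶠ x : ℝ in cofinite, poch (x - m + β + 1) (m - 1) ≠ 0 := by
  have := ev_ne (∏ i ∈ Finset.range (m - 1), (X - C ((m : ℝ) - β - 1 - i)))
    (Finset.prod_ne_zero_iff.2 fun i _ => X_sub_C_ne_zero _)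
  filter_upwards [this] with x hx
  rw [eval_prod] at hx
  rw [poch]
  intro h0
  apply hx
  rw [← h0]
  refine Finset.prod_congr rfl fun i _ => ?_
  simp only [eval_sub, eval_X, eval_C]; ring

lemma minor_eq (m : ℕ) (F : ℕ → ℕ → ℝ) (a c : Fin m) :
    (-1 : ℝ) ^ (((a : ℕ) + 1) + ((c : ℕ) + 1)) * (Matrix.of fun l r : Fin (m - 1) =>
      F (skipIdx ((a : ℕ) + 1) l) (skipIdx ((c : ℕ) + 1) r)).det =
    ((Matrix.of fun l r : Fin m => F ((l : ℕ) + 1) ((r : ℕ) + 1)).updateRow a (Pi.single c 1)).det := by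
  cases m with
  | zero => exact a.elim0
  | succ n =>
    rw [← Matrix.adjugate_apply, Matrix.adjugate_fin_succ_eq_det_submatrix]
    have hsk : ∀ (a : Fin (n + 1)) (l : Fin n), skipIdx ((a : ℕ) + 1) l = (a.succAbove l : ℕ) + 1 := by
      intro a l
      rw [skipIdx, Fin.succAbove]
      simp only [Fin.lt_def, Fin.val_castSucc]
      split_ifs <;> first | omega | simp
    congr 1
    · rw [show (a : ℕ) + 1 + ((c : ℕ) + 1) = (a + c) + 2 by omega, pow_add]; norm_num
    · congr 1
      ext l r
      simp only [Matrix.of_apply, Matrix.submatrix_apply]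
      have h1 := hsk a l
      have h2 := hsk c r
      rw [← h1, ← h2]

end JD


namespace JD
open Topology

/-- the matrix of shifted polynomials -/
noncomputable def Z0 (m : ℕ) (α β : ℝ) (Y : ℕ → ℝ[X]) : Matrix (Fin m) (Fin m) ℝ[X] :=
  Matrix.of fun l c => (Y ((l : ℕ) + 1)).comp
    ((X - C ((c : ℝ) + 1)) * (X - C ((c : ℝ) + 1) + C α + C β + 1))

lemma Z0_eval (m : ℕ) (α β : ℝ) (Y : ℕ → ℝ[X]) (l c : Fin m) (x : ℝ) :
    (Z0 m α β Y l c).eval x = (Y ((l : ℕ) + 1)).eval (θf α β (x - ((c : ℕ) + 1))) := by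
  simp [Z0, θf]

lemma Z0_dvd (m : ℕ) (α β : ℝ) (Y : ℕ → ℝ[X]) (l c c' : Fin m) :
    Lp (α + β) ((c : ℕ) + c') ∣ Z0 m α β Y l c - Z0 m α β Y l c' := by
  simp only [Z0, Matrix.of_apply, comp_eq_aeval, aeval_def, eval₂_eq_eval_map]
  refine dvd_trans ⟨C ((c' : ℝ) - c), ?_⟩ (Polynomial.sub_dvd_eval_sub _ _ _)
  rw [Lp]
  simp only [map_sub, map_add, map_one, map_natCast, Nat.cast_add]
  ring

lemma Z0_refl (m : ℕ) (α β : ℝ) (Y : ℕ → ℝ[X]) (l c : Fin m) (y : ℝ) :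
    (Z0 m α β Y l c).eval (m - (α + β) - y) = (Z0 m α β Y l (Fin.rev c)).eval y := by
  rw [Z0_eval, Z0_eval]
  congr 1
  rw [θf, θf, Fin.val_rev, Nat.cast_sub (by omega)]
  push_cast; ring

lemma SΩ_eq (m1 m2 : ℕ) (α β : ℝ) (Ξ : ℝ[X]) (Y : ℕ → ℝ[X]) : ∀ᶠ x in cofinite,
    Sfun m1 m2 α β Ξ x * Ωf m1 m2 α β Y x =
      (kap m1 m2)⁻¹ * T (m1 + m2) m1 α β Ξ (Z0 (m1 + m2) α β Y) x := by
  filter_upwards [B_ev (m1 + m2) β] with x hx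
  rw [← T_S m1 m2 α β Ξ _ x hx, Ωf]
  simp only [Z0_eval]

lemma T_poly (m m1 : ℕ) (h1 : m1 ≤ m) (α β : ℝ) (Ξ : ℝ[X]) (Y : ℕ → ℝ[X]) :
    ∃ P : ℝ[X], ∀ᶠ x in cofinite, T m m1 α β Ξ (Z0 m α β Y) x = P.eval x := by
  obtain ⟨F, hF⟩ := main_dvd m m1 h1 α β (Z0 m α β Y)
    ((Finset.univ : Finset (Fin m × Fin m)).filter (fun p => p.1 < p.2))
    (fun p hp => (Finset.mem_filter.1 hp).2) (fun p _ l => Z0_dvd m α β Y l _ _)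
  refine ⟨nP m α β Ξ * F, ?_⟩
  filter_upwards [ev_ne _ (pP_good m m1 α β).1, ev_ne _ (qP_good m α β).1] with x hp hq
  have : dP m m1 α β (Z0 m α β Y) = pP m m1 α β * qP m α β * F := hF
  rw [T, this]
  simp only [eval_mul]
  field_simp

lemma sum_Icc_fin (m : ℕ) (f : ℕ → ℝ) :
    ∑ j ∈ Finset.Icc 1 m, f j = ∑ c : Fin m, f ((c : ℕ) + 1) := by
  rw [Fin.sum_univ_eq_sum_range (fun i => f (i + 1)), Finset.range_eq_Ico, Finset.sum_Ico_add' f 0 m 1]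
  rfl

lemma Mfun_eq (m1 m2 : ℕ) (α β : ℝ) (Ξ : ℝ[X]) (Y : ℕ → ℝ[X]) (a : Fin (m1 + m2)) :
    ∀ᶠ x in cofinite, Mfun m1 m2 α β Y Ξ ((a : ℕ) + 1) x =
      (kap m1 m2)⁻¹ * MM (m1 + m2) m1 α β Ξ (Z0 (m1 + m2) α β Y) a x := by
  have hB : ∀ᶠ x : ℝ in cofinite, ∀ c : Fin (m1 + m2),
      poch (x + ((c : ℝ) + 1) - ((m1 + m2 : ℕ) : ℝ) + β + 1) (m1 + m2 - 1) ≠ 0 := by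
    rw [eventually_all]
    intro c
    exact ev_affine (B_ev (m1 + m2) β) (fun x => x + ((c : ℝ) + 1)) (add_left_injective _)
  filter_upwards [hB] with x hx
  rw [Mfun, MM, Finset.mul_sum, sum_Icc_fin]
  refine Finset.sum_congr rfl fun c _ => ?_
  rw [Tc, ← T_S m1 m2 α β Ξ _ _ (hx c)]
  have hm := minor_eq (m1 + m2) (fun l r =>
    ξf m1 α β l (x + ((c : ℝ) + 1) - (r : ℝ)) ((m1 + m2) - r) *
      (Y l).eval (θf α β (x + ((c : ℝ) + 1) - (r : ℝ)))) a c
  have hd : Matrix.det (Matrix.of fun l j : Fin (m1 + m2) =>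
      ξf m1 α β ((l : ℕ) + 1) (x + ((c : ℝ) + 1) - ((j : ℕ) + 1)) ((m1 + m2) - ((j : ℕ) + 1)) *
        ((Z0 (m1 + m2) α β Y).updateRow a (Pi.single c 1) l j).eval (x + ((c : ℝ) + 1))) =
      ξf m1 α β ((a : ℕ) + 1) x ((m1 + m2) - ((c : ℕ) + 1)) *
      ((Matrix.of fun l r : Fin (m1 + m2) => (fun l r : ℕ =>
    ξf m1 α β l (x + ((c : ℝ) + 1) - (r : ℝ)) ((m1 + m2) - r) *
      (Y l).eval (θf α β (x + ((c : ℝ) + 1) - (r : ℝ)))) ((l : ℕ) + 1) ((r : ℕ) + 1)).updateRow a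
        (Pi.single c 1)).det := by
    rw [← Matrix.det_updateRow_smul]
    congr 1
    ext l j
    rw [Matrix.of_apply]
    by_cases hl : l = a
    · subst hl
      simp only [Matrix.updateRow_self, Pi.smul_apply, smul_eq_mul]
      by_cases hj : j = c
      · subst hj; simp
      · simp [Pi.single_apply, hj]
    · simp only [Matrix.updateRow_ne hl, Z0_eval, Matrix.of_apply]
      push_cast
      rfl
  rw [hd, ← hm]
  push_cast
  ring

end JD


namespace JD
open Topology

lemma col_exp (m m1 : ℕ) (α β : ℝ) (Ξ : ℝ[X]) (Z : Matrix (Fin m) (Fin m) ℝ[X]) (c : Fin m) (y : ℝ) :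
    ∑ h, (Z h c).eval y * Tc m m1 α β Ξ Z h c y = T m m1 α β Ξ Z y := by
  have key : ∑ h, Z h c * dP m m1 α β (Z.updateRow h (Pi.single c 1)) = dP m m1 α β Z := by
    have h1 := congrFun (congrFun (Matrix.adjugate_mul (WM m m1 (X + C α) (X + C β) Z)) c) c
    rw [Matrix.mul_apply, Matrix.smul_apply, Matrix.one_apply_eq, smul_eq_mul, mul_one] at h1
    rw [dP, ← h1]
    refine Finset.sum_congr rfl fun h _ => ?_
    rw [Matrix.adjugate_apply, dP, WM_updateRow]
    have : (fun c' : Fin m => (if (h : ℕ) < m1 then wt m (X + C α) (X + C β) c' else 1) *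
        (Pi.single c 1 : Fin m → ℝ[X]) c') =
        (if (h : ℕ) < m1 then wt m (X + C α) (X + C β) c else 1) • (Pi.single c 1 : Fin m → ℝ[X]) := by
      funext c'
      by_cases hc : c' = c
      · subst hc; simp
      · simp [hc]
    rw [this, Matrix.det_updateRow_smul]
    simp only [WM, Matrix.of_apply]
    ring
  rw [T, ← key, eval_finsetSum, Finset.mul_sum, Finset.sum_div]
  refine Finset.sum_congr rfl fun h _ => ?_
  rw [Tc, T, eval_mul]; ring

lemma per_const (μ : ℝ[X]) (h : ∀ x, μ.eval x = μ.eval (x - 1)) (x0 : ℝ) (h0 : μ.eval x0 = 0) :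
    μ = 0 := by
  have hn : ∀ n : ℕ, μ.eval (x0 + n) = 0 := by
    intro n
    induction n with
    | zero => simpa using h0
    | succ n ih =>
      rw [h, ← ih]; congr 1; push_cast; ring
  refine eq_zero_of_infinite_isRoot μ ?_
  refine Set.Infinite.mono ?_ (Set.infinite_range_of_injective (f := fun n : ℕ => x0 + n) ?_)
  · rintro _ ⟨n, rfl⟩; exact hn n
  · intro a b hab; simpa using hab

lemma T_anti (m m1 : ℕ) (α β : ℝ) (Ξ : ℝ[X]) (Y : ℕ → ℝ[X])
    (hΞ : ∀ x : ℝ, Ξ.eval (m - (α + β) - x) = Ξ.eval x) (P : ℝ[X])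
    (hP : ∀ᶠ x in cofinite, T m m1 α β Ξ (Z0 m α β Y) x = P.eval x) (y : ℝ) :
    P.eval (m - (α + β) - y) = - P.eval y := by
  have h2 := ev_affine hP (fun x => m - (α + β) - x) (sub_right_injective)
  have : P.comp (C (m - (α + β)) - X) = -P := by
    apply poly_eq_of_ev
    filter_upwards [hP, h2] with x h1 h2
    rw [T_refl m m1 α β Ξ hΞ _ _ x (fun l c => Z0_refl m α β Y l c x), h1] at h2
    simp only [eval_comp, eval_sub, eval_C, eval_X, eval_neg]
    exact h2.symm
  have h3 := congrArg (eval y) this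
  simpa using h3

lemma lam_refl (m : ℕ) (γ k : ℝ) (P lam : ℝ[X]) (hP : ∀ y, P.eval (m - γ - y) = - P.eval y)
    (hl : ∀ x, lam.eval x - lam.eval (x - 1) = k * P.eval x) (x : ℝ) :
    lam.eval (-x - (γ + 1)) = lam.eval (x + m) := by
  have : lam.comp (-X - C (γ + 1)) - lam.comp (X + C (m : ℝ)) = 0 := by
    refine per_const _ ?_ (-(m + γ + 1) / 2) ?_
    · intro x
      simp only [eval_sub, eval_comp, eval_neg, eval_X, eval_C, eval_add]
      have h1 := hl (-x - γ)
      have h2 := hl (x + m)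
      have h3 := hP (x + m)
      rw [show (m : ℝ) - γ - (x + m) = -x - γ by ring] at h3
      rw [show -(x - 1) - (γ + 1) = -x - γ by ring, show x - 1 + (m : ℝ) = x + m - 1 by ring]
      rw [show -x - γ - 1 = -x - (γ + 1) by ring] at h1
      rw [h3] at h1
      linarith
    · simp only [eval_sub, eval_comp, eval_neg, eval_X, eval_C, eval_add]
      rw [sub_eq_zero]; congr 1; ring
  have h3 := congrArg (eval x) this
  simp only [eval_sub, eval_comp, eval_neg, eval_X, eval_C, eval_add, eval_zero] at h3
  linarith

lemma part2 (m1 m2 : ℕ) (α β : ℝ) (Y : ℕ → ℝ[X]) (Ξ : ℝ[X])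
    (hΞ : ∀ x : ℝ, Ξ.eval (((m1 + m2 : ℕ) : ℝ) - (α + β) - x) = Ξ.eval x) (a : Fin (m1 + m2)) :
    ∃ Q : ℝ[X], ∀ᶠ x in cofinite,
      Mfun m1 m2 α β Y Ξ ((a : ℕ) + 1) x = σf α β (x + 1) * Q.eval (θf α β x) := by
  obtain ⟨P, hP⟩ := MM_poly (m1 + m2) m1 α β Ξ (by omega) hΞ (Z0 (m1 + m2) α β Y)
    (Z0_dvd _ α β Y) (Z0_refl _ α β Y) a
  have h2 := ev_affine hP (fun x => -x - (α + β + 1)) (fun x y h => by simpa using h)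
  have hPa : ∀ x, P.eval (-x - (α + β + 1)) = - P.eval x := by
    have : P.comp (-X - C (α + β + 1)) = -P := by
      apply poly_eq_of_ev
      filter_upwards [hP, h2] with x h1 h2
      rw [MM_refl _ m1 α β Ξ hΞ _ (Z0_refl _ α β Y), h1] at h2
      simp only [eval_comp, eval_sub, eval_C, eval_X, eval_neg]
      exact h2.symm
    intro x
    have h3 := congrArg (eval x) this
    simp only [eval_comp, eval_sub, eval_C, eval_X, eval_neg] at h3
    exact h3
  obtain ⟨Q, hQ⟩ := antisym_poly P _ hPa
  refine ⟨C (kap m1 m2)⁻¹ * Q, ?_⟩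
  filter_upwards [hP, Mfun_eq m1 m2 α β Ξ Y a] with x h1 h2
  rw [h2, h1, hQ, eval_mul, eval_C, σf, θf]
  rw [show x * (x + α + β + 1) = x * (x + (α + β + 1)) by ring]
  ring

lemma part3 (m1 m2 : ℕ) (α β : ℝ) (Y : ℕ → ℝ[X]) (Ξ : ℝ[X])
    (hΞ : ∀ x : ℝ, Ξ.eval (((m1 + m2 : ℕ) : ℝ) - (α + β) - x) = Ξ.eval x) (lam : ℝ[X])
    (hl : ∀ᶠ x in cofinite,
        lam.eval x - lam.eval (x - 1) = Sfun m1 m2 α β Ξ x * Ωf m1 m2 α β Y x) :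
      ∃ PS : Polynomial ℝ, ∀ᶠ x in Filter.cofinite,
        PS.eval (θf α β x) =
          2 * lam.eval x +
            ∑ h ∈ Finset.Icc 1 (m1 + m2), (Y h).eval (θf α β x) * Mfun m1 m2 α β Y Ξ h x := by
  obtain ⟨P, hP⟩ := T_poly (m1 + m2) m1 (by omega) α β Ξ Y
  have hPa := T_anti _ m1 α β Ξ Y hΞ P hP
  have hl' : ∀ x, lam.eval x - lam.eval (x - 1) = (kap m1 m2)⁻¹ * P.eval x := by
    have : lam - lam.comp (X - C 1) = C (kap m1 m2)⁻¹ * P := by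
      apply poly_eq_of_ev
      filter_upwards [hl, hP, SΩ_eq m1 m2 α β Ξ Y] with x h1 h2 h3
      rw [h3, h2] at h1
      simpa using h1
    intro x
    have h3 := congrArg (eval x) this
    simpa using h3
  have hr := lam_refl (m1 + m2) (α + β) _ P lam hPa hl'
  have hM : ∀ᶠ x in cofinite,
      ∑ h ∈ Finset.Icc 1 (m1 + m2), (Y h).eval (θf α β x) * Mfun m1 m2 α β Y Ξ h x =
        lam.eval (x + ((m1 + m2 : ℕ) : ℝ)) - lam.eval x := by
    have e1 : ∀ᶠ x in cofinite, ∀ a : Fin (m1 + m2), Mfun m1 m2 α β Y Ξ ((a : ℕ) + 1) x =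
      (kap m1 m2)⁻¹ * MM (m1 + m2) m1 α β Ξ (Z0 (m1 + m2) α β Y) a x :=
      eventually_all.2 (Mfun_eq m1 m2 α β Ξ Y)
    have e2 : ∀ᶠ x : ℝ in cofinite, ∀ c : Fin (m1 + m2),
        T (m1 + m2) m1 α β Ξ (Z0 (m1 + m2) α β Y) (x + ((c : ℝ) + 1)) =
          P.eval (x + ((c : ℝ) + 1)) := eventually_all.2 fun c =>
      ev_affine hP (fun x => x + ((c : ℝ) + 1)) (add_left_injective _)
    filter_upwards [e1, e2] with x h1 h2
    rw [sum_Icc_fin]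
    have e3 : ∀ a : Fin (m1 + m2), (Y ((a : ℕ) + 1)).eval (θf α β x) *
        Mfun m1 m2 α β Y Ξ ((a : ℕ) + 1) x = ∑ c : Fin (m1 + m2), (kap m1 m2)⁻¹ *
          ((Z0 (m1 + m2) α β Y a c).eval (x + ((c : ℝ) + 1)) *
            Tc (m1 + m2) m1 α β Ξ (Z0 (m1 + m2) α β Y) a c (x + ((c : ℝ) + 1))) := by
      intro a
      rw [h1, MM, Finset.mul_sum, Finset.mul_sum]
      refine Finset.sum_congr rfl fun c _ => ?_
      rw [Z0_eval, add_sub_cancel_right]; ring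
    rw [Finset.sum_congr rfl fun a _ => e3 a, Finset.sum_comm]
    have e4 : ∀ c : Fin (m1 + m2), ∑ a : Fin (m1 + m2), (kap m1 m2)⁻¹ *
          ((Z0 (m1 + m2) α β Y a c).eval (x + ((c : ℝ) + 1)) *
            Tc (m1 + m2) m1 α β Ξ (Z0 (m1 + m2) α β Y) a c (x + ((c : ℝ) + 1))) =
        (fun i : ℕ => lam.eval (x + ((i + 1 : ℕ) : ℝ)) - lam.eval (x + (i : ℝ))) c := by
      intro c
      rw [← Finset.mul_sum, col_exp, h2, ← hl']
      push_cast
      congr 2; ring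
    rw [Finset.sum_congr rfl fun a _ => e4 a, Fin.sum_univ_eq_sum_range
      (fun i : ℕ => lam.eval (x + ((i + 1 : ℕ) : ℝ)) - lam.eval (x + (i : ℝ))),
      Finset.sum_range_sub (fun i : ℕ => lam.eval (x + (i : ℝ)))]
    simp
  obtain ⟨Q, hQ⟩ := sym_poly (lam + lam.comp (X + C ((m1 + m2 : ℕ) : ℝ))) (α + β + 1) (by
    intro x
    simp only [eval_add, eval_comp, eval_X, eval_C]
    have h1 := hr x
    have h2 := hr (-x - (α + β + 1))
    rw [show -(-x - (α + β + 1)) - (α + β + 1) = x by ring] at h2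
    rw [h1, ← h2]; ring)
  refine ⟨Q, ?_⟩
  filter_upwards [hM] with x hx
  rw [hx, θf, show x * (x + α + β + 1) = x * (x + (α + β + 1)) by ring, ← hQ]
  simp only [eval_add, eval_comp, eval_X, eval_C]
  ring

end JD

/-- **Lemma 3.2 (l5.2).** For the Jacobi `D`-operators, the three assumptions of
Theorem 3.1 hold for the rational function `S` built from any polynomial `Ξ` invariant
under `I^{α+β-m-1}` and for arbitrary polynomials `Y_1, …, Y_m`; identities of rational
functions hold at all but finitely many real points, i.e. wherever they are defined. -/
theorem jacobi_Doperators_assumptions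
    (m1 m2 : ℕ) (hm : 1 ≤ m1 + m2) (α β : ℝ) (Y : ℕ → Polynomial ℝ)
    (Ξ : Polynomial ℝ)
    (hΞ : ∀ x : ℝ, Ξ.eval (-(x + α + β - ((m1 + m2 : ℕ) : ℝ))) = Ξ.eval x) :
    -- (ass0): `S(x)Ω(x)` is a polynomial in `x`
    (∃ P : Polynomial ℝ, ∀ᶠ x in Filter.cofinite,
      Sfun m1 m2 α β Ξ x * Ωf m1 m2 α β Y x = P.eval x) ∧
    -- (ass1): `M_h(x) = σ^h_{x+1} M̃_h(θ_x)` for a polynomial `M̃_h`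
    (∀ h ∈ Finset.Icc 1 (m1 + m2), ∃ Mt : Polynomial ℝ, ∀ᶠ x in Filter.cofinite,
      Mfun m1 m2 α β Y Ξ h x =
        (if h ≤ m1 then σf α β (x + 1) else -σf α β (x + 1)) * Mt.eval (θf α β x)) ∧
    -- (ass2): a polynomial `P_S` with `P_S(θ_x) = 2λ_x + Σ_h Y_h(θ_x) M_h(x)`
    (∀ lam : Polynomial ℝ,
      (∀ᶠ x in Filter.cofinite,
        lam.eval x - lam.eval (x - 1) = Sfun m1 m2 α β Ξ x * Ωf m1 m2 α β Y x) →
      ∃ PS : Polynomial ℝ, ∀ᶠ x in Filter.cofinite,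
        PS.eval (θf α β x) =
          2 * lam.eval x +
            ∑ h ∈ Finset.Icc 1 (m1 + m2), (Y h).eval (θf α β x) * Mfun m1 m2 α β Y Ξ h x) := by
  have hΞ' : ∀ x : ℝ, Ξ.eval (((m1 + m2 : ℕ) : ℝ) - (α + β) - x) = Ξ.eval x := by
    intro x
    rw [← hΞ x]; congr 1; ring
  refine ⟨?_, ?_, fun lam hl => JD.part3 m1 m2 α β Y Ξ hΞ' lam hl⟩
  · obtain ⟨P, hP⟩ := JD.T_poly (m1 + m2) m1 (by omega) α β Ξ Y
    refine ⟨C (JD.kap m1 m2)⁻¹ * P, ?_⟩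
    filter_upwards [hP, JD.SΩ_eq m1 m2 α β Ξ Y] with x h1 h2
    rw [h2, h1, eval_mul, eval_C]
  · intro h hh
    rw [Finset.mem_Icc] at hh
    obtain ⟨Q, hQ⟩ := JD.part2 m1 m2 α β Y Ξ hΞ' ⟨h - 1, by omega⟩
    have e : h - 1 + 1 = h := by omega
    simp only [e] at hQ
    by_cases h1 : h ≤ m1
    · refine ⟨Q, ?_⟩
      filter_upwards [hQ] with x hx
      rw [if_pos h1, hx]
    · refine ⟨-Q, ?_⟩
      filter_upwards [hQ] with x hx
      rw [if_neg h1, hx, eval_neg]; ring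
end

section
/- Let α, β be real numbers, let m1, m2 ≥ 0 be integers with m = m1+m2 ≥ 1, and let Y_1, …, Y_m be nonzero real polynomials with deg Y_i = u_i. Let D(x) be the determinant of the m×m matrix whose (i,j) entry, for j = 1,…,m, equals N1^{α;m−j}_{x−j}·N2^{β;j−1}_{x−1}·Y_i(θ_{x−j}) when i = 1,…,m1 and equals Y_i(θ_{x−j}) when i = m1+1,…,m. Then the polynomial p(x)q(x) divides D(x) in ℝ[x], and the quotient P(x) = D(x)/(p(x)q(x)) is a polynomial of degree at most d = 2(u_1 + ⋯ + u_m) − 2( m1(m1−1)/2 + m2(m2−1)/2 ). -/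
open Polynomial

/-- Pochhammer-type product `(a)_k` for a polynomial argument `a`. -/
noncomputable def pochPoly (a : Polynomial ℝ) (k : ℕ) : Polynomial ℝ :=
  ∏ i ∈ Finset.range k, (a + (i : Polynomial ℝ))

namespace lgp

variable (m1 m2 : ℕ) (α β : ℝ)

/-- `θ_x = x(x+α+β+1)` as a polynomial. -/
noncomputable def θpoly : Polynomial ℝ := X * (X + C (α + β + 1))

/-- The `(i,j)` entry (1-indexed) of the matrix in Lemma A.1:
`N1^{α;m-j}_{x-j} N2^{β;j-1}_{x-1} Y_i(θ_{x-j})` for `i ≤ m1` and `Y_i(θ_{x-j})` else. -/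
noncomputable def entry (Y : ℕ → Polynomial ℝ) (i j : ℕ) : Polynomial ℝ :=
  (if i ≤ m1 then
    C ((-1 : ℝ) ^ ((m1 + m2) - j)) *
      pochPoly (X + C (α - ((m1 + m2 : ℕ) : ℝ) + 1)) ((m1 + m2) - j) *
      pochPoly (X + C (β + 1 - (j : ℝ))) (j - 1)
  else 1) * (Y i).comp ((θpoly α β).comp (X - C (j : ℝ)))

/-- The determinant `D(x)` of Lemma A.1, as a polynomial. -/
noncomputable def Dpoly (Y : ℕ → Polynomial ℝ) : Polynomial ℝ :=
  Matrix.det (Matrix.of fun i j : Fin (m1 + m2) =>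
    entry m1 m2 α β Y ((i : ℕ) + 1) ((j : ℕ) + 1))

/-- The polynomial `p(x)` of the paper. -/
noncomputable def ppoly : Polynomial ℝ :=
  ∏ i ∈ Finset.Icc 1 (m1 - 1),
    C ((-1 : ℝ) ^ (m1 - i)) * pochPoly (X + C (α - ((m1 + m2 : ℕ) : ℝ) + 1)) (m1 - i) *
      pochPoly (X + C (β - (m1 : ℝ) + (i : ℝ))) (m1 - i)

/-- The polynomial `q(x)` of the paper. -/
noncomputable def qpoly : Polynomial ℝ :=
  C ((-1 : ℝ) ^ ((m1 + m2) * (m1 + m2 - 1) / 2)) *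
    ∏ h ∈ Finset.Icc 1 (m1 + m2 - 1), ∏ i ∈ Finset.Icc 1 h,
      (2 * (X - C ((m1 + m2 : ℕ) : ℝ)) + C (α + β + (i : ℝ) + (h : ℝ)))

end lgp

open lgp
namespace CQ

/-- Generic Pochhammer symbol. -/
def poch {S : Type*} [CommRing S] (a : S) (k : ℕ) : S := ∏ i ∈ Finset.range k, (a + (i : S))

section generic
variable {S : Type*} [CommRing S]

lemma poch_succ (a : S) (k : ℕ) : poch a (k + 1) = poch a k * (a + k) := by
  simp [poch, Finset.prod_range_succ]

lemma poch_back (B : S) (j : ℕ) :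
    poch (B - ((j + 1 : ℕ) : S)) (j + 1) = poch (B - (j : S)) j * (B - j - 1) := by
  unfold poch
  rw [Finset.prod_range_succ']
  congr 1
  · apply Finset.prod_congr rfl
    intro i _
    push_cast; ring
  · push_cast; ring

/-- Newton interpolation polynomial from a divided difference table. -/
noncomputable def newt (d : ℕ → ℕ → S) (t : ℕ → S) (r j : ℕ) : S[X] :=
  ∑ k ∈ Finset.range (r + 1), C (d k j) * ∏ l ∈ Finset.range k, (X - C (t (j + l)))

lemma newt_succ (d : ℕ → ℕ → S) (t : ℕ → S) (r j : ℕ) :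
    newt d t (r + 1) j = newt d t r j +
      C (d (r + 1) j) * ∏ l ∈ Finset.range (r + 1), (X - C (t (j + l))) := by
  rw [newt, Finset.sum_range_succ, newt]

lemma newt_diff (d : ℕ → ℕ → S) (t : ℕ → S) (n : ℕ)
    (h : ∀ r j, j + r + 1 ≤ n → (t (j + r + 1) - t j) * d (r + 1) j = d r (j + 1) - d r j)
    (r j : ℕ) (hj : j + r + 1 ≤ n) :
    newt d t r (j + 1) - newt d t r j =
      C (d (r + 1) j * (t (j + r + 1) - t j)) *
        ∏ l ∈ Finset.range r, (X - C (t (j + 1 + l))) := by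
  induction r with
  | zero =>
    have := h 0 j hj
    simp only [newt, zero_add, Finset.range_one, Finset.sum_singleton, Finset.range_zero,
      Finset.prod_empty, mul_one, ← C_sub]
    rw [← this]; congr 1; simp; ring
  | succ r ih =>
    have h1 := ih (by omega)
    have h2 := h (r + 1) j (by omega)
    rw [newt_succ, newt_succ, Finset.prod_range_succ, Finset.prod_range_succ' _ r]
    have e : ∏ l ∈ Finset.range r, (X - C (t (j + (l + 1)))) =
        ∏ l ∈ Finset.range r, (X - C (t (j + 1 + l))) :=
      Finset.prod_congr rfl fun l _ => by rw [show j + (l + 1) = j + 1 + l by ring]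
    rw [e, add_zero]
    have e2 : j + 1 + r = j + r + 1 := by ring
    have e3 : j + (r + 1) + 1 = j + r + 1 + 1 := by ring
    rw [e3] at h2 ⊢
    rw [e2, mul_comm (d (r + 1 + 1) j), h2]
    set Q := ∏ l ∈ Finset.range r, (X - C (t (j + 1 + l)))
    simp only [C_sub, C_mul] at *
    linear_combination h1

lemma newt_eval (d : ℕ → ℕ → S) (t : ℕ → S) (n : ℕ)
    (h : ∀ r j, j + r + 1 ≤ n → (t (j + r + 1) - t j) * d (r + 1) j = d r (j + 1) - d r j)
    (r j i : ℕ) (hj : j + r ≤ n) (hi : i ≤ r) :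
    (newt d t r j).eval (t (j + i)) = d 0 (j + i) := by
  induction r generalizing j i with
  | zero =>
    obtain rfl : i = 0 := by omega
    simp [newt]
  | succ r ih =>
    rw [newt_succ]
    rcases Nat.lt_or_ge r i with hlt | hle
    · obtain rfl : i = r + 1 := by omega
      have h1 := newt_diff d t n h r j (by omega)
      have h2 := ih (j + 1) r (by omega) le_rfl
      have h3 := congrArg (Polynomial.eval (t (j + (r + 1)))) h1
      have e : j + 1 + r = j + (r + 1) := by ring
      rw [e] at h2
      rw [Finset.prod_range_succ']
      have e' : ∏ l ∈ Finset.range r, (X - C (t (j + (l + 1)))) =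
          ∏ l ∈ Finset.range r, (X - C (t (j + 1 + l))) :=
        Finset.prod_congr rfl fun l _ => by rw [show j + (l + 1) = j + 1 + l by ring]
      rw [e', add_zero]
      have e2 : j + r + 1 = j + (r + 1) := by ring
      rw [e2] at h3
      simp only [eval_sub, eval_add, eval_mul, eval_C, eval_X, h2] at h3 ⊢
      linear_combination -h3
    · rw [eval_add, ih j i (by omega) hle, eval_mul, eval_prod,
        Finset.prod_eq_zero (i := i) (by simp; omega) (by simp)]
      simp

/-- the weight. -/
def wS (A B : S) (n j : ℕ) : S := (-1) ^ (n - j) * poch (A - n) (n - j) * poch (B - j) j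

lemma exists_interp [Algebra ℝ S] (A B : S) (n : ℕ) (t : ℕ → S)
    (ht : ∀ i j : ℕ, t j - t i = - ((j : S) - i) * (A + B - i - j - 1)) :
    ∃ W : S[X], ∀ i ≤ n, W.eval (t i) = wS A B n i := by
  let d : ℕ → ℕ → S := fun r j =>
    algebraMap ℝ S ((r.factorial : ℝ)⁻¹) * ((-1) ^ (n - j) * poch (A - n) (n - j - r) *
      poch (B - j) j)
  refine ⟨newt d t n 0, fun i hi => ?_⟩
  have := newt_eval d t n ?_ n 0 i (by omega) hi
  · simpa [d, wS] using this
  · intro r j hj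
    obtain ⟨k, rfl⟩ := Nat.exists_eq_add_of_le hj
    have e1 : j + r + 1 + k - j = k + r + 1 := by omega
    have e2 : k + r + 1 - (r + 1) = k := by omega
    have e3 : j + r + 1 + k - (j + 1) = k + r := by omega
    have e4 : k + r + 1 - r = k + 1 := by omega
    have e5 : k + r - r = k := by omega
    simp only [d, e1, e2, e3, e4, e5, ht, poch_back B j]
    rw [poch_succ _ k]
    have hf : algebraMap ℝ S ((r.factorial : ℝ)⁻¹) =
        ((r : S) + 1) * algebraMap ℝ S (((r + 1).factorial : ℝ)⁻¹) := by
      have : ((r : S) + 1) = algebraMap ℝ S ((r : ℝ) + 1) := by simp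
      rw [this, ← map_mul]
      congr 1
      rw [Nat.factorial_succ]; push_cast
      have : (r.factorial : ℝ) ≠ 0 := by positivity
      field_simp
    rw [hf, pow_succ]
    push_cast
    ring

lemma vandermonde_dvd [Nontrivial S] {m : ℕ} (F : Fin m → S[X]) (t : Fin m → S) :
    (Matrix.vandermonde t).det ∣ Matrix.det (Matrix.of fun i j => (F i).eval (t j)) := by
  let Q : S[X] := ∏ j, (X - C (t j))
  have hQ : Q.Monic := monic_prod_of_monic _ _ fun j _ => monic_X_sub_C _
  have hd : Q.natDegree = m := by
    simp only [Q]
    rw [natDegree_prod_of_monic _ _ fun j _ => monic_X_sub_C _]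
    simp
  have hz : ∀ j, Q.eval (t j) = 0 := fun j => by
    simp only [Q]
    rw [eval_prod, Finset.prod_eq_zero (Finset.mem_univ j)]
    simp
  have hE : (Matrix.of fun i j => (F i).eval (t j)) =
      (Matrix.of fun i (k : Fin m) => (F i %ₘ Q).coeff k) * (Matrix.vandermonde t).transpose := by
    ext i j
    rw [Matrix.mul_apply]
    simp only [Matrix.of_apply, Matrix.transpose_apply, Matrix.vandermonde_apply]
    have h1 : (F i).eval (t j) = (F i %ₘ Q).eval (t j) := by
      conv_lhs => rw [← modByMonic_add_div (F i) Q]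
      simp [hz]
    rcases Nat.eq_zero_or_pos m with rfl | hm
    · exact j.elim0
    rw [h1, eval_eq_sum_range' (n := m), Finset.sum_range]
    have := natDegree_modByMonic_lt (F i) hQ (by
      intro h; rw [h] at hd; simp at hd; omega)
    omega
  rw [hE, Matrix.det_mul, Matrix.det_transpose]
  exact dvd_mul_left _ _

lemma prod_range_dvd (f : ℕ → S) (hf : ∀ k, f k ∣ f (k + 1)) (s : Finset ℕ) :
    ∏ r ∈ Finset.range s.card, f r ∣ ∏ r ∈ s, f r := by
  have hmono : ∀ a b, a ≤ b → f a ∣ f b := by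
    intro a b hab
    induction b, hab using Nat.le_induction with
    | base => rfl
    | succ b _ ih => exact ih.trans (hf b)
  induction s using Finset.induction_on_max with
  | empty => simp
  | insert a s hs ih =>
    have ha : a ∉ s := fun h => lt_irrefl _ (hs a h)
    rw [Finset.card_insert_of_notMem ha, Finset.prod_insert ha, Finset.prod_range_succ, mul_comm]
    refine mul_dvd_mul (hmono _ _ ?_) ih
    calc s.card ≤ (Finset.range a).card :=
          Finset.card_le_card fun x hx => Finset.mem_range.2 (hs x hx)
      _ = a := by simp

lemma prod_range_dvd' {ι : Type*} (f : ℕ → S) (hf : ∀ k, f k ∣ f (k + 1)) (s : Finset ι)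
    (g : ι → ℕ) (hg : Set.InjOn g s) :
    ∏ r ∈ Finset.range s.card, f r ∣ ∏ i ∈ s, f (g i) := by
  classical
  have := prod_range_dvd f hf (s.image g)
  rwa [Finset.card_image_of_injOn hg, Finset.prod_image hg] at this

lemma choose_le_sum {ι : Type*} (s : Finset ι) (g : ι → ℕ) (hg : Set.InjOn g s) :
    s.card.choose 2 ≤ ∑ i ∈ s, g i := by
  have := prod_range_dvd' (S := ℤ) (fun r => 2 ^ r) (fun k => pow_dvd_pow _ (by omega)) s g hg
  rw [Finset.prod_pow_eq_pow_sum, Finset.prod_pow_eq_pow_sum, Finset.sum_range_id,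
    ← Nat.choose_two_right] at this
  have h2 : (2 : ℕ) ^ s.card.choose 2 ∣ 2 ^ ∑ i ∈ s, g i := by exact_mod_cast this
  exact (Nat.pow_dvd_pow_iff_le_right (by norm_num)).1 h2

/-- `p` over a general ring. -/
def pS (A B : S) (n m1 : ℕ) : S :=
  (∏ r ∈ Finset.range m1, poch (A - n) r) * ∏ r ∈ Finset.range m1, poch (B - r) r

lemma card_lt (m1 m2 : ℕ) : (Finset.univ.filter fun i : Fin (m1 + m2) => (i : ℕ) < m1).card = m1 := by
  rw [Fin.card_filter_val_lt]; omega

lemma card_ge (m1 m2 : ℕ) :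
    (Finset.univ.filter fun i : Fin (m1 + m2) => ¬ (i : ℕ) < m1).card = m2 := by
  have := Finset.card_filter_add_card_filter_not (s := (Finset.univ : Finset (Fin (m1 + m2))))
    (fun i => (i : ℕ) < m1)
  rw [card_lt] at this
  simp at this ⊢
  omega

lemma pS_dvd (A B : S) (m1 m2 n : ℕ) (hn : m1 + m2 = n + 1) (y : Fin (m1 + m2) → Fin (m1 + m2) → S) :
    pS A B n m1 ∣ Matrix.det (Matrix.of fun i j : Fin (m1 + m2) =>
      (if (i : ℕ) < m1 then wS A B n j else 1) * y i j) := by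
  rw [← Matrix.det_transpose, Matrix.det_apply]
  refine Finset.dvd_sum fun σ _ => ?_
  rw [Units.smul_def, zsmul_eq_mul]
  apply Dvd.dvd.mul_left
  simp only [Matrix.transpose_apply, Matrix.of_apply]
  rw [Finset.prod_mul_distrib]
  apply Dvd.dvd.mul_right
  rw [← Finset.prod_filter]
  simp only [wS]
  rw [Finset.prod_mul_distrib, Finset.prod_mul_distrib, pS]
  apply mul_dvd_mul
  · apply Dvd.dvd.mul_left
    have := prod_range_dvd' (fun r => poch (A - n) r) (fun k => by
      simp only [poch_succ]; exact dvd_mul_right _ _)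
      (Finset.univ.filter fun i : Fin (m1 + m2) => (i : ℕ) < m1) (fun i => n - (σ i : ℕ)) (by
        intro a _ b _ hab
        have ha := (σ a).2
        have hb := (σ b).2
        apply σ.injective
        apply Fin.ext
        simp only at hab
        omega)
    rwa [card_lt] at this
  · have := prod_range_dvd' (fun r : ℕ => poch (B - (r : S)) r) (fun k => by
      simp only [poch_back]; exact dvd_mul_right _ _)
      (Finset.univ.filter fun i : Fin (m1 + m2) => (i : ℕ) < m1) (fun i => (σ i : ℕ)) (by
        intro a _ b _ hab
        apply σ.injective
        exact Fin.ext hab)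
    rwa [card_lt] at this

end generic

lemma relPrime_C {f : ℝ[X][X]} (hf : IsUnit (f.coeff 1)) {q : ℝ[X]} (hq : q ≠ 0) :
    IsRelPrime f (C q) := by
  intro d hdf hdq
  have h0 : d.natDegree = 0 := by
    have := natDegree_le_of_dvd hdq (by simpa using hq)
    simpa using this
  rw [eq_C_of_natDegree_eq_zero h0] at hdf ⊢
  rw [C_dvd_iff_dvd_coeff] at hdf
  exact (isUnit_of_dvd_unit (hdf 1) hf).map C

/-- Abstract divisibility. -/
lemma main_dvd (a b : ℝ[X]) (m1 m2 n : ℕ) (hn : m1 + m2 = n + 1) (t : ℕ → ℝ[X])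
    (ht : ∀ i j : ℕ, t j - t i = - ((j : ℝ[X]) - i) * (a + b - i - j - 1))
    (hV : (Matrix.vandermonde fun j : Fin (m1 + m2) => t j).det ≠ 0)
    (Y : ℕ → ℝ[X]) :
    pS a b n m1 * (Matrix.vandermonde fun j : Fin (m1 + m2) => t j).det ∣
      Matrix.det (Matrix.of fun i j : Fin (m1 + m2) =>
        (if (i : ℕ) < m1 then wS a b n j else 1) * (Y i).comp (t j)) := by
  set V := (Matrix.vandermonde fun j : Fin (m1 + m2) => t j).det with hVdef
  let A : ℝ[X][X] := C a + X
  let B : ℝ[X][X] := C b - X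
  let D : ℝ[X][X] := Matrix.det (Matrix.of fun i j : Fin (m1 + m2) =>
        (if (i : ℕ) < m1 then wS A B n j else 1) * C ((Y i).comp (t j)))
  have h1 : pS A B n m1 ∣ D := pS_dvd A B m1 m2 n hn _
  have h2 : C V ∣ D := by
    obtain ⟨W, hW⟩ := exists_interp A B n (fun j => C (t j)) (by
      intro i j
      rw [← C_sub, ht]
      simp only [A, B, C_mul, C_neg, C_sub, C_add, C_1, map_natCast]
      ring)
    have := vandermonde_dvd (S := ℝ[X][X]) (m := m1 + m2)
      (fun i => (if (i : ℕ) < m1 then W else 1) * (Y i).map (C.comp C)) (fun j => C (t j))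
    have e1 : (Matrix.vandermonde fun j : Fin (m1 + m2) => (C (t j) : ℝ[X][X])).det = C V := by
      rw [hVdef, Matrix.det_vandermonde, Matrix.det_vandermonde]
      simp only [map_prod, C_sub]
    rw [e1] at this
    convert this using 3
    ext1 i; ext1 j
    rw [eval_mul]
    congr 1
    · split_ifs
      · exact (hW j (by have := j.2; omega)).symm
      · simp
    · rw [eval_map, ← hom_eval₂, comp]
  obtain ⟨E, hE⟩ := h2
  have h3 : IsRelPrime (pS A B n m1) (C V) := by
    unfold pS poch
    refine IsRelPrime.mul_left ?_ ?_ <;>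
    · refine IsRelPrime.prod_left fun r _ => IsRelPrime.prod_left fun l _ => relPrime_C ?_ hV
      have hz : ∀ k : ℕ, (k : ℝ[X][X]).coeff 1 = 0 := fun k => by
        rw [← map_natCast (C : ℝ[X] →+* ℝ[X][X])]; exact coeff_C_succ
      simp [A, B, hz, coeff_C_succ]
  have h4 : pS A B n m1 ∣ E := h3.dvd_of_dvd_mul_left (hE ▸ h1)
  have h5 : pS A B n m1 * C V ∣ D := by
    rw [hE, mul_comm]; exact mul_dvd_mul_left _ h4
  have h6 := map_dvd (evalRingHom (0 : ℝ[X])) h5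
  have ep : ∀ (c : ℝ[X][X]) k, evalRingHom (0 : ℝ[X]) (poch c k) =
      poch (evalRingHom (0 : ℝ[X]) c) k := fun c k => by
    simp only [poch, map_prod, map_add, map_natCast]
  have eA : evalRingHom (0 : ℝ[X]) A = a := by simp [A]
  have eB : evalRingHom (0 : ℝ[X]) B = b := by simp [B]
  have eV : evalRingHom (0 : ℝ[X]) (C V) = V := by simp
  have ew : ∀ j, evalRingHom (0 : ℝ[X]) (wS A B n j) = wS a b n j := fun j => by
    simp only [wS, map_mul, map_pow, map_neg, map_one, ep, map_sub, map_natCast, eA, eB]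
  rw [map_mul, eV] at h6
  have e7 : evalRingHom (0 : ℝ[X]) (pS A B n m1) = pS a b n m1 := by
    simp only [pS, map_mul, map_prod, ep, map_sub, map_natCast, eA, eB]
  rw [e7] at h6
  convert h6 using 1
  simp only [D]
  rw [RingHom.map_det]
  congr 1
  refine Matrix.ext fun i j => ?_
  simp only [Matrix.of_apply, RingHom.mapMatrix_apply, Matrix.map_apply, map_mul]
  congr 1
  · split_ifs
    · exact (ew j).symm
    · simp
  · simp


lemma taylor_exp (Y θ : ℝ[X]) (hθ : θ.natDegree ≤ 2) :
    ∃ c : ℕ → ℝ[X], (∀ b ≤ Y.natDegree, (c b).natDegree + 2 * b ≤ 2 * Y.natDegree) ∧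
      ∀ δ : ℝ[X], Y.comp (θ + δ) = ∑ b ∈ Finset.range (Y.natDegree + 1), c b * δ ^ b := by
  refine ⟨fun b => (hasseDeriv b Y).comp θ, fun b hb => ?_, fun δ => ?_⟩
  · have h1 := natDegree_hasseDeriv_le Y b
    have h2 : ((hasseDeriv b Y).comp θ).natDegree ≤ (Y.natDegree - b) * 2 :=
      natDegree_comp_le.trans (Nat.mul_le_mul h1 hθ)
    simp only
    omega
  · have hm : ∀ b, hasseDeriv b (Y.map C) = (hasseDeriv b Y).map C := by
      intro b; ext1 k
      simp [hasseDeriv_coeff]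
    have h1 : Y.comp (θ + δ) = (taylor θ (Y.map C)).eval δ := by
      rw [taylor_eval, eval_map, add_comm δ θ]; rfl
    rw [h1, eval_eq_sum_range' (n := Y.natDegree + 1)]
    · refine Finset.sum_congr rfl fun b _ => ?_
      rw [taylor_coeff, hm, eval_map]; rfl
    · rw [natDegree_taylor]
      exact Nat.lt_succ_of_le natDegree_map_le

lemma natDegree_det_le {m : ℕ} (M : Matrix (Fin m) (Fin m) ℝ[X]) (r : Fin m → ℕ)
    (h : ∀ i j, (M i j).natDegree ≤ r i) : M.det.natDegree ≤ ∑ i, r i := by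
  rw [← Matrix.det_transpose, Matrix.det_apply]
  refine natDegree_sum_le_of_forall_le _ _ fun σ _ => ?_
  refine (natDegree_smul_le _ _).trans ?_
  refine (natDegree_prod_le _ _).trans ?_
  exact Finset.sum_le_sum fun i _ => h _ _

lemma deg_bound (m1 m2 n : ℕ) (w t : ℕ → ℝ[X]) (θ : ℝ[X])
    (hw : ∀ j < m1 + m2, (w j).natDegree ≤ n) (hθ : θ.natDegree ≤ 2)
    (ht : ∀ j, (t j - θ).natDegree ≤ 1) (Y : ℕ → ℝ[X])
    (D : ℝ[X]) (hD : D = Matrix.det (Matrix.of fun i j : Fin (m1 + m2) =>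
        (if (i : ℕ) < m1 then w j else 1) * (Y i).comp (t j))) :
    D = 0 ∨ D.natDegree + (m1.choose 2 + m2.choose 2) ≤
      2 * ∑ i : Fin (m1 + m2), (Y i).natDegree + m1 * n := by
  choose c hc1 hc2 using fun i : Fin (m1 + m2) => taylor_exp (Y i) θ hθ
  let g : Fin (m1 + m2) → ℕ → Fin (m1 + m2) → ℝ[X] := fun i b j =>
    c i b * ((if (i : ℕ) < m1 then w j else 1) * (t j - θ) ^ b)
  have e1 : D = Matrix.detRowAlternating (R := ℝ[X]) (n := Fin (m1 + m2))
      (fun i => ∑ b ∈ Finset.range ((Y i).natDegree + 1), g i b) := by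
    rw [hD, Matrix.det]
    congr 1
    funext i j
    have := hc2 i (t j - θ)
    rw [add_sub_cancel] at this
    simp only [Matrix.of_apply, this, Finset.mul_sum, Finset.sum_apply, g]
    exact Finset.sum_congr rfl fun b _ => by ring
  have e2 := MultilinearMap.map_sum_finset
    (Matrix.detRowAlternating (R := ℝ[X]) (n := Fin (m1 + m2))).toMultilinearMap g
    (fun i => Finset.range ((Y i).natDegree + 1))
  rw [e1]
  erw [e2]
  refine Finset.sum_induction _ (fun f : ℝ[X] => f = 0 ∨
    f.natDegree + (m1.choose 2 + m2.choose 2) ≤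
      2 * ∑ i : Fin (m1 + m2), (Y i).natDegree + m1 * n) ?_ (Or.inl rfl) ?_
  · rintro a b (rfl | ha) (rfl | hb)
    · simp
    · simpa using Or.inr hb
    · simpa using Or.inr ha
    · right
      have := natDegree_add_le a b
      have := max_le_iff.1 (le_refl (max a.natDegree b.natDegree))
      rcases max_choice a.natDegree b.natDegree with h | h <;> omega
  · intro r hr
    rw [Fintype.mem_piFinset] at hr
    let M : Matrix (Fin (m1 + m2)) (Fin (m1 + m2)) ℝ[X] := fun i j =>
      (if (i : ℕ) < m1 then w j else 1) * (t j - θ) ^ (r i)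
    have e3 : (Matrix.detRowAlternating (R := ℝ[X]) (n := Fin (m1 + m2))).toMultilinearMap
        (fun i => g i (r i)) = (∏ i, c i (r i)) * M.det := by
      rw [← Matrix.det_mul_column]; rfl
    rw [e3]
    by_cases hM : M.det = 0
    · left; rw [hM, mul_zero]
    right
    have hinj : ∀ i i', r i = r i' → ((i : ℕ) < m1 ↔ (i' : ℕ) < m1) → i = i' := by
      intro i i' h1 h2
      by_contra hne
      refine hM (Matrix.det_zero_of_row_eq hne ?_)
      funext j
      simp only [M, h1, h2]
    have d1 : (∏ i, c i (r i)).natDegree ≤ ∑ i, (c i (r i)).natDegree := natDegree_prod_le _ _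
    have d2 : M.det.natDegree ≤ ∑ i : Fin (m1 + m2), ((if (i : ℕ) < m1 then n else 0) + r i) := by
      refine natDegree_det_le M _ fun i j => ?_
      refine natDegree_mul_le.trans (Nat.add_le_add ?_ ?_)
      · split_ifs
        · exact hw j j.2
        · simp
      · refine natDegree_pow_le.trans ?_
        calc r i * _ ≤ r i * 1 := Nat.mul_le_mul_left _ (ht j)
          _ = r i := mul_one _
    rw [Finset.sum_add_distrib, ← Finset.sum_filter, Finset.sum_const, card_lt, smul_eq_mul] at d2
    have d3 : ∑ i, (c i (r i)).natDegree + 2 * ∑ i, r i ≤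
        2 * ∑ i : Fin (m1 + m2), (Y i).natDegree := by
      rw [Finset.mul_sum, Finset.mul_sum, ← Finset.sum_add_distrib]
      refine Finset.sum_le_sum fun i _ => hc1 i _ ?_
      have := hr i
      rw [Finset.mem_range] at this
      omega
    have d4 : m1.choose 2 + m2.choose 2 ≤ ∑ i, r i := by
      rw [← Finset.sum_filter_add_sum_filter_not Finset.univ
        (fun i : Fin (m1 + m2) => (i : ℕ) < m1)]
      have k1 := choose_le_sum (Finset.univ.filter fun i : Fin (m1 + m2) => (i : ℕ) < m1) r (by
        intro a ha b hb hab
        simp only [Finset.coe_filter, Finset.mem_univ, true_and, Set.mem_ofPred_eq] at ha hb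
        exact hinj a b hab (by simp [ha, hb]))
      have k2 := choose_le_sum (Finset.univ.filter fun i : Fin (m1 + m2) => ¬ (i : ℕ) < m1) r (by
        intro a ha b hb hab
        simp only [Finset.coe_filter, Finset.mem_univ, true_and, Set.mem_ofPred_eq] at ha hb
        exact hinj a b hab (by simp [ha, hb]))
      rw [card_lt] at k1
      rw [card_ge] at k2
      exact Nat.add_le_add k1 k2
    have d5 := natDegree_mul_le (p := ∏ i, c i (r i)) (q := M.det)
    omega

lemma pochPoly_eq (a : ℝ[X]) (k : ℕ) : pochPoly a k = poch a k := rfl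

lemma pochPoly_monic (c : ℝ) (k : ℕ) : (pochPoly (X + C c) k).Monic := by
  refine monic_prod_of_monic _ _ fun i _ => ?_
  rw [← map_natCast (C : ℝ →+* ℝ[X]), add_assoc, ← C_add]
  exact monic_X_add_C _

lemma pochPoly_natDegree (c : ℝ) (k : ℕ) : (pochPoly (X + C c) k).natDegree = k := by
  unfold pochPoly
  have h : ∀ i : ℕ, (X + C c + (i : ℝ[X])) = X + C (c + i) := fun i => by
    rw [← map_natCast (C : ℝ →+* ℝ[X]), add_assoc, ← C_add]
  simp only [h]
  rw [natDegree_prod_of_monic _ _ fun i _ => monic_X_add_C _]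
  simp only [natDegree_X_add_C]
  simp

lemma ppoly_eq (m1 m2 : ℕ) (α β : ℝ) : ppoly m1 m2 α β = ∏ r ∈ Finset.range m1,
    C ((-1 : ℝ) ^ r) * pochPoly (X + C (α - ((m1 + m2 : ℕ) : ℝ) + 1)) r *
      pochPoly (X + C (β - (r : ℝ))) r := by
  rcases m1 with _ | k
  · simp [ppoly]
  rw [Finset.prod_range_succ', ppoly]
  have h0 : ∀ a, pochPoly a 0 = 1 := fun a => by simp [pochPoly]
  simp only [h0, pow_zero, C_1, mul_one, Nat.add_sub_cancel]
  refine Finset.prod_nbij' (fun i => k - i) (fun r => k - r) ?_ ?_ ?_ ?_ ?_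
  · intro i hi; simp at hi ⊢; omega
  · intro i hi; simp at hi ⊢; omega
  · intro i hi; simp at hi ⊢; omega
  · intro i hi; simp at hi ⊢; omega
  · intro i hi
    rw [Finset.mem_Icc] at hi
    obtain ⟨l, rfl⟩ := Nat.exists_eq_add_of_le hi.2
    have e1 : i + l + 1 - i = l + 1 := by omega
    have e2 : i + l - i = l := by omega
    rw [e1, e2]
    congr 4
    push_cast; ring

lemma ppoly_factor_ne (c c' : ℝ) (r : ℕ) : C ((-1 : ℝ) ^ r) * pochPoly (X + C c) r *
      pochPoly (X + C c') r ≠ 0 :=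
  mul_ne_zero (mul_ne_zero (by simp) (pochPoly_monic _ _).ne_zero) (pochPoly_monic _ _).ne_zero

lemma ppoly_natDegree (m1 m2 : ℕ) (α β : ℝ) :
    (ppoly m1 m2 α β).natDegree = 2 * m1.choose 2 := by
  rw [ppoly_eq, natDegree_prod _ _ fun r _ => ppoly_factor_ne _ _ r, Nat.choose_two_right,
    ← Finset.sum_range_id, Finset.mul_sum]
  refine Finset.sum_congr rfl fun r _ => ?_
  rw [mul_assoc, natDegree_C_mul (by simp), natDegree_mul (pochPoly_monic _ _).ne_zero
    (pochPoly_monic _ _).ne_zero, pochPoly_natDegree, pochPoly_natDegree]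
  ring

lemma ppoly_dvd (m1 m2 n : ℕ) (hn : m1 + m2 = n + 1) (α β : ℝ) :
    ppoly m1 m2 α β ∣ pS (X + C α) (X + C β) n m1 := by
  rw [ppoly_eq, pS, ← Finset.prod_mul_distrib]
  refine Finset.prod_dvd_prod_of_dvd _ _ fun r _ => ?_
  have e1 : (X + C (α - ((m1 + m2 : ℕ) : ℝ) + 1) : ℝ[X]) = X + C α - (n : ℝ[X]) := by
    rw [hn, ← map_natCast (C : ℝ →+* ℝ[X]), add_sub_assoc, ← C_sub]
    congr 2; push_cast; ring
  have e2 : (X + C (β - (r : ℝ)) : ℝ[X]) = X + C β - (r : ℝ[X]) := by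
    rw [← map_natCast (C : ℝ →+* ℝ[X]), add_sub_assoc, ← C_sub]
  rw [e1, e2, pochPoly_eq, pochPoly_eq, mul_assoc]
  have hu : IsUnit (C ((-1 : ℝ) ^ r)) := isUnit_C.2 (by simp)
  exact hu.mul_left_dvd.2 dvd_rfl

lemma qlin_eq (m : ℕ) (s : ℝ) :
    (∏ h ∈ Finset.Icc 1 (m - 1), ∏ i ∈ Finset.Icc 1 h,
      (2 * (X - C (m : ℝ)) + C (s + (i : ℝ) + (h : ℝ)))) =
    ∏ a : Fin m, ∏ b ∈ Finset.Ioi a, (2 * X + C (s - (a : ℕ) - (b : ℕ) - 1) : ℝ[X]) := by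
  rw [Finset.prod_sigma', Finset.prod_sigma']
  refine Finset.prod_bij'
    (fun x hx => ⟨⟨m - 1 - x.1, by
      simp only [Finset.mem_sigma, Finset.mem_Icc] at hx; omega⟩, ⟨m - x.2, by
      simp only [Finset.mem_sigma, Finset.mem_Icc] at hx; omega⟩⟩)
    (fun y _ => ⟨m - 1 - (y.1 : ℕ), m - (y.2 : ℕ)⟩) ?_ ?_ ?_ ?_ ?_
  · rintro ⟨h, i⟩ hx
    simp only [Finset.mem_sigma, Finset.mem_Icc, Finset.mem_univ, Finset.mem_Ioi, true_and,
      Fin.mk_lt_mk] at hx ⊢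
    omega
  · rintro ⟨a, b⟩ hx
    simp only [Finset.mem_sigma, Finset.mem_Icc, Finset.mem_univ, Finset.mem_Ioi, true_and,
      Fin.lt_def] at hx ⊢
    have := b.2
    omega
  · rintro ⟨h, i⟩ hx
    simp only [Finset.mem_sigma, Finset.mem_Icc] at hx
    have e1 : m - 1 - (m - 1 - h) = h := by omega
    have e2 : m - (m - i) = i := by omega
    simp [e1, e2]
  · rintro ⟨a, b⟩ hx
    have h1 := a.2
    have h2 := b.2
    have e1 : m - 1 - (m - 1 - (a : ℕ)) = a := by omega
    have e2 : m - (m - (b : ℕ)) = b := by omega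
    simp [e1, e2]
  · rintro ⟨h, i⟩ hx
    simp only [Finset.mem_sigma, Finset.mem_Icc] at hx
    simp only
    rw [Nat.cast_sub (by omega), Nat.cast_sub (by omega), Nat.cast_sub (by omega)]
    simp only [C_sub, C_add, Nat.cast_one, C_1]
    ring

lemma qfac_natDegree (c : ℝ) : (2 * X + C c : ℝ[X]).natDegree = 1 := by
  rw [← C_ofNat]
  exact natDegree_linear (by norm_num)

lemma qfac_ne (c : ℝ) : (2 * X + C c : ℝ[X]) ≠ 0 := by
  intro h
  have := qfac_natDegree c
  rw [h] at this
  simp at this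

lemma qpoly_natDegree (m1 m2 : ℕ) (α β : ℝ) :
    (qpoly m1 m2 α β).natDegree = (m1 + m2).choose 2 := by
  have e : ∀ i h : ℕ, (2 * (X - C ((m1 + m2 : ℕ) : ℝ)) + C (α + β + (i : ℝ) + (h : ℝ)) : ℝ[X]) =
      2 * X + C (α + β + i + h - 2 * ((m1 + m2 : ℕ) : ℝ)) := by
    intro i h
    simp only [C_sub, C_mul, C_ofNat]; ring
  rw [qpoly, natDegree_C_mul (by simp)]
  simp only [e]
  rw [natDegree_prod _ _ fun h _ => Finset.prod_ne_zero_iff.2 fun i _ => qfac_ne _]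
  have : ∀ h ∈ Finset.Icc 1 (m1 + m2 - 1), (∏ i ∈ Finset.Icc 1 h,
      (2 * X + C (α + β + i + h - 2 * ((m1 + m2 : ℕ) : ℝ)) : ℝ[X])).natDegree = h := by
    intro h _
    rw [natDegree_prod _ _ fun i _ => qfac_ne _]
    simp only [qfac_natDegree]
    simp
  rw [Finset.sum_congr rfl this]
  rcases Nat.eq_zero_or_pos (m1 + m2) with h0 | h0
  · simp [h0]
  rw [Nat.choose_two_right, ← Finset.sum_range_id]
  obtain ⟨k, hk⟩ := Nat.exists_eq_add_of_lt h0
  rw [hk]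
  simp only [zero_add, Nat.add_sub_cancel]
  rw [Finset.sum_range_succ', Finset.range_eq_Ico]
  rw [Finset.sum_Ico_add' (fun i => i) 0 k 1]
  simp only [add_zero, zero_add]
  rfl

lemma t_diff (α β : ℝ) (i j : ℕ) :
    (θpoly α β).comp (X - C ((j : ℝ) + 1)) - (θpoly α β).comp (X - C ((i : ℝ) + 1)) =
      - ((j : ℝ[X]) - (i : ℝ[X])) * ((X + C α) + (X + C β) - (i : ℝ[X]) - (j : ℝ[X]) - 1) := by
  simp only [θpoly, mul_comp, add_comp, X_comp, C_comp, one_comp, C_add, C_1, map_natCast]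
  ring

lemma vand_eq (m : ℕ) (α β : ℝ) :
    (Matrix.vandermonde fun j : Fin m => (θpoly α β).comp (X - C (((j : ℕ) : ℝ) + 1))).det =
    (∏ a : Fin m, ∏ b ∈ Finset.Ioi a, C (-(((b : ℕ) : ℝ) - ((a : ℕ) : ℝ)))) *
    ∏ a : Fin m, ∏ b ∈ Finset.Ioi a, (2 * X + C (α + β - (a : ℕ) - (b : ℕ) - 1) : ℝ[X]) := by
  rw [Matrix.det_vandermonde, ← Finset.prod_mul_distrib]
  refine Finset.prod_congr rfl fun a _ => ?_
  rw [← Finset.prod_mul_distrib]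
  refine Finset.prod_congr rfl fun b _ => ?_
  rw [t_diff]
  simp only [C_sub, C_add, C_neg, map_natCast, C_1]
  ring

end CQ

/-- **Lemma A.1 (lgp1), degree bound.** `p(x)q(x)` divides `D(x)` in `ℝ[x]` and the
quotient `P = D/(pq)` has degree at most `2 Σᵢ deg Yᵢ - 2(C(m1,2) + C(m2,2))`. -/
theorem casorati_quotient_degree_le
    (m1 m2 : ℕ) (hm : 1 ≤ m1 + m2) (α β : ℝ)
    (Y : ℕ → Polynomial ℝ) (hY : ∀ l ∈ Finset.Icc 1 (m1 + m2), Y l ≠ 0) :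
    ∃ P : Polynomial ℝ,
      Dpoly m1 m2 α β Y = ppoly m1 m2 α β * qpoly m1 m2 α β * P ∧
      (P = 0 ∨ (P.natDegree : ℤ) ≤
        2 * (∑ l ∈ Finset.Icc 1 (m1 + m2), ((Y l).natDegree : ℤ)) -
          2 * ((m1.choose 2 : ℤ) + (m2.choose 2 : ℤ))) := by
  obtain ⟨n, hn⟩ : ∃ n, m1 + m2 = n + 1 := ⟨m1 + m2 - 1, by omega⟩
  let t : ℕ → ℝ[X] := fun j => (θpoly α β).comp (X - C ((j : ℝ) + 1))
  let a : ℝ[X] := X + C α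
  let b : ℝ[X] := X + C β
  have hw : ∀ j < m1 + m2, CQ.wS a b n j = C ((-1 : ℝ) ^ ((m1 + m2) - (j + 1))) *
      pochPoly (X + C (α - ((m1 + m2 : ℕ) : ℝ) + 1)) ((m1 + m2) - (j + 1)) *
      pochPoly (X + C (β + 1 - ((j + 1 : ℕ) : ℝ))) (j + 1 - 1) := by
    intro j hj
    have e0 : m1 + m2 - (j + 1) = n - j := by omega
    have e1 : (X + C (α - ((m1 + m2 : ℕ) : ℝ) + 1) : ℝ[X]) = X + C α - (n : ℝ[X]) := by
      rw [hn, ← map_natCast (C : ℝ →+* ℝ[X]), add_sub_assoc, ← C_sub]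
      congr 2; push_cast; ring
    have e2 : (X + C (β + 1 - ((j + 1 : ℕ) : ℝ)) : ℝ[X]) = X + C β - (j : ℝ[X]) := by
      rw [← map_natCast (C : ℝ →+* ℝ[X]), add_sub_assoc (X : ℝ[X]), ← C_sub]
      congr 2; push_cast; ring
    rw [e0, e1, e2, CQ.pochPoly_eq, CQ.pochPoly_eq, CQ.wS, Nat.add_sub_cancel]
    simp [a, b]
  have hD : Dpoly m1 m2 α β Y = Matrix.det (Matrix.of fun i j : Fin (m1 + m2) =>
        (if (i : ℕ) < m1 then CQ.wS a b n j else 1) * (Y ((i : ℕ) + 1)).comp (t j)) := by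
    unfold Dpoly
    refine congrArg Matrix.det ?_
    refine Matrix.ext fun i j => ?_
    simp only [Matrix.of_apply, entry, t]
    rw [hw j j.2]
    simp only [Nat.succ_le_iff, Nat.cast_add, Nat.cast_one]
  have hdiv := CQ.main_dvd a b m1 m2 n hn t (fun i j => CQ.t_diff α β i j) (by
    rw [CQ.vand_eq]
    refine mul_ne_zero ?_ ?_
    · refine Finset.prod_ne_zero_iff.2 fun a _ => Finset.prod_ne_zero_iff.2 fun b hb => ?_
      rw [Finset.mem_Ioi, Fin.lt_def] at hb
      have : ((a : ℕ) : ℝ) < ((b : ℕ) : ℝ) := by exact_mod_cast hb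
      rw [Ne, C_eq_zero]
      intro h; linarith
    · exact Finset.prod_ne_zero_iff.2 fun a _ => Finset.prod_ne_zero_iff.2 fun b _ =>
        CQ.qfac_ne _) (fun i => Y (i + 1))
  rw [← hD] at hdiv
  have hq : qpoly m1 m2 α β ∣ (Matrix.vandermonde fun j : Fin (m1 + m2) => t j).det := by
    rw [CQ.vand_eq, qpoly, CQ.qlin_eq]
    have hu : IsUnit (C ((-1 : ℝ) ^ ((m1 + m2) * (m1 + m2 - 1) / 2))) := isUnit_C.2 (by simp)
    exact hu.mul_left_dvd.2 (dvd_mul_left _ _)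
  obtain ⟨P, hP⟩ := (mul_dvd_mul (CQ.ppoly_dvd m1 m2 n hn α β) hq).trans hdiv
  refine ⟨P, hP, ?_⟩
  by_cases hP0 : P = 0
  · exact Or.inl hP0
  right
  have hp0 : ppoly m1 m2 α β ≠ 0 := by
    rw [CQ.ppoly_eq]
    exact Finset.prod_ne_zero_iff.2 fun r _ => CQ.ppoly_factor_ne _ _ r
  have hq0 : qpoly m1 m2 α β ≠ 0 := by
    rw [qpoly, CQ.qlin_eq]
    exact mul_ne_zero (by simp) (Finset.prod_ne_zero_iff.2 fun a _ =>
      Finset.prod_ne_zero_iff.2 fun b _ => CQ.qfac_ne _)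
  have hdeg := congrArg natDegree hP
  rw [natDegree_mul (mul_ne_zero hp0 hq0) hP0, natDegree_mul hp0 hq0, CQ.ppoly_natDegree,
    CQ.qpoly_natDegree] at hdeg
  have hθ : (θpoly α β).natDegree ≤ 2 := by
    unfold θpoly
    refine natDegree_mul_le.trans ?_
    rw [natDegree_X, natDegree_X_add_C]
  have hb := CQ.deg_bound m1 m2 n (fun j => CQ.wS a b n j) t (θpoly α β) (by
      intro j hj
      rw [hw j hj, mul_assoc, natDegree_C_mul (by simp)]
      refine natDegree_mul_le.trans ?_
      rw [CQ.pochPoly_natDegree, CQ.pochPoly_natDegree]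
      omega) hθ (by
      intro j
      have : t j - θpoly α β = C (-2 * ((j : ℝ) + 1)) * X +
          C (((j : ℝ) + 1) ^ 2 - ((j : ℝ) + 1) * (α + β + 1)) := by
        simp only [t, θpoly, mul_comp, add_comp, X_comp, C_comp, C_add, C_sub, C_mul, C_neg,
          C_ofNat, C_pow]
        ring
      rw [this]
      exact natDegree_linear_le) (fun i => Y (i + 1)) _ hD
  rcases hb with hb | hb
  · rw [hP] at hb
    exact absurd hb (mul_ne_zero (mul_ne_zero hp0 hq0) hP0)
  have hsum : ∑ l ∈ Finset.Icc 1 (m1 + m2), ((Y l).natDegree : ℤ) =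
      ((∑ i : Fin (m1 + m2), (Y ((i : ℕ) + 1)).natDegree : ℕ) : ℤ) := by
    rw [Fin.sum_univ_eq_sum_range (fun i => (Y (i + 1)).natDegree), Finset.range_eq_Ico,
      Finset.sum_Ico_add' (fun i => (Y i).natDegree) 0 (m1 + m2) 1]
    push_cast
    rfl
  rw [hsum]
  have hc : (m1 + m2).choose 2 = m1.choose 2 + m2.choose 2 + m1 * m2 := by
    clear * -
    induction m2 with
    | zero => simp
    | succ k ih =>
      rw [← add_assoc, Nat.choose_succ_succ' (m1 + k) 1, Nat.choose_succ_succ' k 1, ih]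
      simp; ring
  have hc2 : m1 * n = 2 * m1.choose 2 + m1 * m2 := by
    have h2 : m1 * (m1 - 1) = 2 * m1.choose 2 := by
      rw [Nat.choose_two_right, Nat.mul_div_cancel' (Nat.even_mul_pred_self m1).two_dvd]
    rcases Nat.eq_zero_or_pos m1 with h0 | h0
    · simp [h0]
    · rw [← h2, ← mul_add]; congr 1; omega
  rw [hc2] at hb
  rw [hc] at hdeg
  omega
end
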